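/- arXiv:2312.04246 — 3 statements merged into one kernel-verified Lean document; each statement's English description precedes it below -/
import Mathlib

section
/- Let r ≥ 1 be a fixed integer and let X_n = (X_{n,1},…,X_{n,r}), n ≥ 1, be random vectors whose coordinates are nonnegative random variables, with finite means μ_{n,i} = E X_{n,i} > 0 and mean vector μ_n. Let Γ be a fixed r×r real symmetric positive definite matrix and let σ_n = (σ_{n,1},…,σ_{n,r}) be vectors of positive reals with σ_{n,i} = o(μ_{n,i}) for each i, and set Σ_n = diag(σ_n) Γ diag(σ_n). Assume that for every constant c > 0, uniformly over nonnegative integer vectors k_n with k_{n,i} ≤ c μ_{n,i}/σ_{n,i} for all i, one has E[X_n^{k_n}] / ( μ_n^{k_n} · exp( (1/2)(k_n/μ_n)' Σ_n (k_n/μ_n) ) ) → 1 as n → ∞. Then Σ_n^{-1/2}(X_n − μ_n) converges in distribution to the standard r-dimensional normal distribution N(0, I_r). -/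
open MeasureTheory ProbabilityTheory Filter Finset Matrix
open scoped BigOperators

/-- The standard `r`-dimensional Gaussian measure `N(0, I_r)` on `Fin r → ℝ`. -/
noncomputable def stdGaussian (r : ℕ) : Measure (Fin r → ℝ) :=
  Measure.pi fun _ => gaussianReal 0 1

/-- Two measures whose moment generating functions of `X` and `Y` agree near `0`, and are finite
there, have the same characteristic function. -/
theorem complexMGF_I_eq_of_mgf_eq_near_zero {α β : Type*} {mα : MeasurableSpace α}
    {mβ : MeasurableSpace β} {μ : Measure α} {ν : Measure β} {X : α → ℝ} {Y : β → ℝ} {δ : ℝ}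
    (hδ : 0 < δ)
    (hX : ∀ t ∈ Set.Ioo (-δ) δ, Integrable (fun a => Real.exp (t * X a)) μ)
    (hY : ∀ t ∈ Set.Ioo (-δ) δ, Integrable (fun a => Real.exp (t * Y a)) ν)
    (h : ∀ t ∈ Set.Ioo (-δ) δ, mgf X μ t = mgf Y ν t) :
    complexMGF X μ Complex.I = complexMGF Y ν Complex.I := by
  set S : Set ℂ := Complex.reLm ⁻¹' Set.Ioo (-δ) δ with hS
  have hX' : AnalyticOnNhd ℂ (complexMGF X μ) S := fun z hz =>
    analyticAt_complexMGF (interior_maximal (t := Set.Ioo (-δ) δ) hX isOpen_Ioo hz)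
  have hY' : AnalyticOnNhd ℂ (complexMGF Y ν) S := fun z hz =>
    analyticAt_complexMGF (interior_maximal (t := Set.Ioo (-δ) δ) hY isOpen_Ioo hz)
  refine AnalyticOnNhd.eqOn_of_preconnected_of_frequently_eq hX' hY'
    ((convex_Ioo (-δ) δ).linear_preimage Complex.reLm).isPreconnected
    (z₀ := 0) (by simp [hS, hδ]) ?_ (by simp [hS, hδ])
  have h_real : ∃ᶠ x : ℝ in nhdsWithin 0 {0}ᶜ, complexMGF X μ x = complexMGF Y ν x := by
    refine Eventually.frequently (Filter.mem_of_superset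
      (nhdsWithin_le_nhds (Ioo_mem_nhds (neg_lt_zero.2 hδ) hδ)) fun t ht => ?_)
    simp only [Set.mem_ofPred_eq, complexMGF_ofReal, h t ht]
  refine Tendsto.frequently (f := fun x : ℝ => (x : ℂ)) ?_ h_real
  refine tendsto_nhdsWithin_iff.2 ⟨?_, ?_⟩
  · exact (Complex.continuous_ofReal.tendsto' 0 0 (by simp)).mono_left nhdsWithin_le_nhds
  · filter_upwards [self_mem_nhdsWithin] with x hx
    simpa using hx

/-- Probability measures on `ι → ℝ` are determined by their moment generating functions on the
nonnegative orthant, if these are finite. -/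
theorem MeasureTheory.Measure.ext_of_integral_exp_orthant {ι : Type*} [Fintype ι]
    {ν γ : Measure (ι → ℝ)} [IsProbabilityMeasure ν] [IsProbabilityMeasure γ]
    (hν : ∀ u : ι → ℝ, 0 ≤ u → Integrable (fun y => Real.exp (u ⬝ᵥ y)) ν)
    (hγ : ∀ u : ι → ℝ, 0 ≤ u → Integrable (fun y => Real.exp (u ⬝ᵥ y)) γ)
    (h : ∀ u : ι → ℝ, 0 ≤ u → ∫ y, Real.exp (u ⬝ᵥ y) ∂ν = ∫ y, Real.exp (u ⬝ᵥ y) ∂γ) :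
    ν = γ := by
  classical
  let f : (ι → ℝ) → ℝ := fun y => (1 : ι → ℝ) ⬝ᵥ y
  have h1 : (0 : ι → ℝ) ≤ 1 := zero_le_one
  have : IsProbabilityMeasure (ν.tilted f) := isProbabilityMeasure_tilted (hν 1 h1)
  have : IsProbabilityMeasure (γ.tilted f) := isProbabilityMeasure_tilted (hγ 1 h1)
  suffices hfg : ν.tilted f = γ.tilted f by
    have e1 := tilted_neg_same (hν 1 h1)
    have e2 := tilted_neg_same (hγ 1 h1)
    rw [← e1, ← e2]
    exact congrArg (fun m => m.tilted (-f)) hfg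
  refine Measure.ext_of_charFunDual (funext fun L => ?_)
  let t : ι → ℝ := fun i => L (Pi.single i 1)
  have hL : ∀ y, L y = t ⬝ᵥ y := fun y => by
    conv_lhs => rw [pi_eq_sum_univ' y]
    simp [t, dotProduct, mul_comm]
  have hpos : 0 < 1 + ∑ i, |t i| := by positivity
  have hnn : ∀ s ∈ Set.Ioo (-(1 + ∑ i, |t i|)⁻¹) (1 + ∑ i, |t i|)⁻¹, 0 ≤ 1 + s • t := by
    intro s hs i
    have hs' : |s| < (1 + ∑ i, |t i|)⁻¹ := abs_lt.2 hs
    have hti : |t i| ≤ 1 + ∑ i, |t i| :=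
      (single_le_sum (f := fun i => |t i|) (fun j _ => abs_nonneg _) (mem_univ i)).trans
        (by linarith)
    have : |s * t i| ≤ 1 := by
      rw [abs_mul]
      calc |s| * |t i| ≤ (1 + ∑ i, |t i|)⁻¹ * (1 + ∑ i, |t i|) := by gcongr
        _ = 1 := inv_mul_cancel₀ hpos.ne'
    have := (abs_le.1 this).1
    simp only [Pi.zero_apply, Pi.add_apply, Pi.one_apply, Pi.smul_apply, smul_eq_mul]
    linarith
  have hsum : ∀ s y, f y + s * L y = (1 + s • t) ⬝ᵥ y := fun s y => by
    simp [f, hL, add_dotProduct]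
  have h_int : ∀ ρ : Measure (ι → ℝ), (∀ u : ι → ℝ, 0 ≤ u →
      Integrable (fun y => Real.exp (u ⬝ᵥ y)) ρ) →
      ∀ s ∈ Set.Ioo (-(1 + ∑ i, |t i|)⁻¹) (1 + ∑ i, |t i|)⁻¹,
      Integrable (fun y => Real.exp (s * L y)) (ρ.tilted f) := by
    intro ρ hρ s hs
    rw [integrable_tilted_iff (hρ 1 h1)]
    simp only [smul_eq_mul, ← Real.exp_add]
    exact (hρ _ (hnn s hs)).congr (ae_of_all _ fun y => by simp only [← hsum, f])
  have key := complexMGF_I_eq_of_mgf_eq_near_zero (inv_pos.2 hpos) (h_int ν hν) (h_int γ hγ) ?_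
  · simp only [charFunDual_apply]
    simpa only [complexMGF, mul_comm Complex.I] using key
  · intro s hs
    have hm : ∀ ρ : Measure (ι → ℝ), mgf (fun y => L y) (ρ.tilted f) s =
        (∫ y, Real.exp ((1 + s • t) ⬝ᵥ y) ∂ρ) / ∫ y, Real.exp ((1 : ι → ℝ) ⬝ᵥ y) ∂ρ := by
      intro ρ
      simp only [← hsum]
      exact integral_exp_tilted f (fun y => s * L y)
    rw [hm, hm, h _ (hnn s hs), h 1 h1]

/-- If probability measures `P i` converge weakly to `P₀` and are uniformly tight, and uniformly
bounded functions `F i` converge continuously to `f`, then `∫ F i ∂P i` converges to `∫ f ∂P₀`. -/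
theorem tendsto_integral_of_tendsto_of_continuous_convergence {ι E : Type*} [TopologicalSpace E]
    [LocallyCompactSpace E] [T2Space E] [MeasurableSpace E] [BorelSpace E] {l : Filter ι}
    {P : ι → ProbabilityMeasure E} {P₀ : ProbabilityMeasure E} (hP : Tendsto P l (nhds P₀))
    (htight : ∀ ε > (0 : ℝ), ∃ K : Set E, IsCompact K ∧ ∀ i, (P i : Measure E).real Kᶜ ≤ ε)
    {F : ι → E → ℝ} {f : E → ℝ} {C : ℝ} (hF : ∀ i, Continuous (F i)) (hf : Continuous f)
    (hFC : ∀ i x, |F i x| ≤ C) (hfC : ∀ x, |f x| ≤ C)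
    (hlim : ∀ x, Tendsto (fun p : ι × E => F p.1 p.2) (l ×ˢ nhds x) (nhds (f x))) :
    Tendsto (fun i => ∫ x, F i x ∂(P i : Measure E)) l (nhds (∫ x, f x ∂(P₀ : Measure E))) := by
  have hunif : TendstoLocallyUniformly F f l := by
    rw [tendstoLocallyUniformly_iff_forall_tendsto]
    intro x
    have h1 : Tendsto (fun p : ι × E => f p.2) (l ×ˢ nhds x) (nhds (f x)) :=
      (hf.tendsto x).comp tendsto_snd
    exact (h1.prodMk_nhds (hlim x)).mono_right (nhds_le_uniformity (f x))
  rw [tendstoLocallyUniformly_iff_forall_isCompact] at hunif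
  have hweak : Tendsto (fun i => ∫ x, f x ∂(P i : Measure E)) l
      (nhds (∫ x, f x ∂(P₀ : Measure E))) :=
    ProbabilityMeasure.tendsto_iff_forall_integral_tendsto.1 hP
      (BoundedContinuousFunction.ofNormedAddCommGroup f hf C hfC)
  rcases isEmpty_or_nonempty E with hE | ⟨⟨x₀⟩⟩
  · simp [Measure.eq_zero_of_isEmpty, tendsto_const_nhds]
  have hC : 0 ≤ C := (abs_nonneg _).trans (hfC x₀)
  have hFint : ∀ i, Integrable (F i) (P i : Measure E) := fun i =>
    .of_bound (hF i).aestronglyMeasurable C (ae_of_all _ (hFC i))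
  have hfint : ∀ i, Integrable f (P i : Measure E) := fun i =>
    .of_bound hf.aestronglyMeasurable C (ae_of_all _ hfC)
  have hdiff : Tendsto (fun i => ∫ x, F i x ∂(P i : Measure E) - ∫ x, f x ∂(P i : Measure E)) l
      (nhds 0) := by
    rw [Metric.tendsto_nhds]
    intro ε hε
    obtain ⟨K, hK, hKP⟩ := htight (ε / (4 * (C + 1))) (by positivity)
    filter_upwards [Metric.tendstoUniformlyOn_iff.1 (hunif K hK) (ε / 4) (by positivity)]
      with i hi
    rw [Real.dist_eq, sub_zero, ← integral_sub (hFint i) (hfint i)]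
    have hd : ∀ x, |F i x - f x| ≤ ε / 4 + Kᶜ.indicator (fun _ => 2 * C) x := by
      intro x
      by_cases hx : x ∈ K
      · have := hi x hx
        rw [Real.dist_eq, abs_sub_comm] at this
        simpa [hx] using this.le
      · have := abs_sub (F i x) (f x)
        simp only [Set.indicator_of_mem (Set.mem_compl hx)]
        linarith [hFC i x, hfC x]
    have hmeas : MeasurableSet Kᶜ := hK.isClosed.measurableSet.compl
    have hind : Integrable (Kᶜ.indicator fun _ : E => 2 * C) (P i : Measure E) :=
      (integrable_const _).indicator hmeas
    calc |∫ x, F i x - f x ∂(P i : Measure E)|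
        ≤ ∫ x, |F i x - f x| ∂(P i : Measure E) := abs_integral_le_integral_abs
      _ ≤ ∫ x, (ε / 4 + Kᶜ.indicator (fun _ => 2 * C) x) ∂(P i : Measure E) :=
        integral_mono ((hFint i).sub (hfint i)).abs ((integrable_const _).add hind) hd
      _ = ε / 4 + (P i : Measure E).real Kᶜ * (2 * C) := by
        rw [integral_add (integrable_const _) hind, integral_indicator_const _ hmeas]
        simp
      _ ≤ ε / 4 + ε / (4 * (C + 1)) * (2 * C) := by gcongr; exact hKP i
      _ ≤ ε / 4 + ε / 2 := by
        gcongr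
        rw [div_mul_eq_mul_div, div_le_iff₀ (by positivity)]
        nlinarith
      _ < ε := by linarith
  simpa using hdiff.add hweak

/-- Convergence of expectations of nonnegative functions with uniformly bounded second moments. -/
theorem integrable_and_integral_eq_of_tendsto_of_sq_bound {ι E : Type*} [TopologicalSpace E]
    [LocallyCompactSpace E] [T2Space E] [MeasurableSpace E] [BorelSpace E] {l : Filter ι} [l.NeBot]
    {P : ι → ProbabilityMeasure E} {P₀ : ProbabilityMeasure E} (hP : Tendsto P l (nhds P₀))
    (htight : ∀ ε > (0 : ℝ), ∃ K : Set E, IsCompact K ∧ ∀ i, (P i : Measure E).real Kᶜ ≤ ε)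
    {G : ι → E → ℝ} {g : E → ℝ} {C m : ℝ} (hG : ∀ i, Continuous (G i)) (hg : Continuous g)
    (hG0 : ∀ i x, 0 ≤ G i x) (hg0 : ∀ x, 0 ≤ g x)
    (hlim : ∀ x, Tendsto (fun p : ι × E => G p.1 p.2) (l ×ˢ nhds x) (nhds (g x)))
    (hGint : ∀ i, Integrable (G i) (P i : Measure E))
    (hG2int : ∀ i, Integrable (fun x => G i x ^ 2) (P i : Measure E))
    (hC : ∀ᶠ i in l, ∫ x, G i x ^ 2 ∂(P i : Measure E) ≤ C)
    (hm : Tendsto (fun i => ∫ x, G i x ∂(P i : Measure E)) l (nhds m)) :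
    Integrable g (P₀ : Measure E) ∧ ∫ x, g x ∂(P₀ : Measure E) = m := by
  have hm0 : 0 ≤ m := ge_of_tendsto' hm fun i => integral_nonneg (hG0 i)
  have htrunc : ∀ M : ℝ, 0 < M → Tendsto (fun i => ∫ x, min (G i x) M ∂(P i : Measure E)) l
      (nhds (∫ x, min (g x) M ∂(P₀ : Measure E))) := by
    intro M hM
    have hb : ∀ a : ℝ, 0 ≤ a → |min a M| ≤ M := fun a ha => by
      rw [abs_of_nonneg (le_min ha hM.le)]; exact min_le_right _ _
    exact tendsto_integral_of_tendsto_of_continuous_convergence hP htight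
      (fun i => (hG i).min continuous_const) (hg.min continuous_const)
      (fun i x => hb _ (hG0 i x)) (fun x => hb _ (hg0 x))
      (fun x => (hlim x).min tendsto_const_nhds)
  have hminint : ∀ (i : ι) (M : ℝ), 0 < M →
      Integrable (fun x => min (G i x) M) (P i : Measure E) := fun i M hM =>
    (hGint i).inf (integrable_const M)
  have hup : ∀ M : ℝ, 0 < M → ∫ x, min (g x) M ∂(P₀ : Measure E) ≤ m := fun M hM =>
    le_of_tendsto_of_tendsto' (htrunc M hM) hm fun i =>
      integral_mono (hminint i M hM) (hGint i) fun x => min_le_left _ _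
  have hlow : ∀ M : ℝ, 0 < M → m - C / M ≤ ∫ x, min (g x) M ∂(P₀ : Measure E) := by
    intro M hM
    refine le_of_tendsto_of_tendsto (hm.sub_const _) (htrunc M hM) ?_
    filter_upwards [hC] with i hi
    have hpt : ∀ x, G i x ≤ min (G i x) M + G i x ^ 2 / M := by
      intro x
      rcases le_total (G i x) M with h | h
      · rw [min_eq_left h]
        have : 0 ≤ G i x ^ 2 / M := by positivity
        linarith
      · rw [min_eq_right h]
        have : G i x ≤ G i x ^ 2 / M := by
          rw [le_div_iff₀ hM]; nlinarith [hG0 i x]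
        linarith
    have h1 : ∫ x, G i x ∂(P i : Measure E) ≤ ∫ x, min (G i x) M ∂(P i : Measure E)
        + (∫ x, G i x ^ 2 ∂(P i : Measure E)) / M := by
      rw [← integral_div, ← integral_add (hminint i M hM) ((hG2int i).div_const M)]
      exact integral_mono (hGint i) ((hminint i M hM).add ((hG2int i).div_const M)) hpt
    have h2 : (∫ x, G i x ^ 2 ∂(P i : Measure E)) / M ≤ C / M := by gcongr
    linarith
  have hpos : ∀ n : ℕ, (0 : ℝ) < n + 1 := fun n => by positivity
  have hIlim : Tendsto (fun n : ℕ => ∫ x, min (g x) (n + 1) ∂(P₀ : Measure E)) atTop (nhds m) := by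
    refine tendsto_of_tendsto_of_tendsto_of_le_of_le (g := fun n : ℕ => m - C / (n + 1)) ?_
      tendsto_const_nhds (fun n => hlow _ (hpos n)) (fun n => hup _ (hpos n))
    have : Tendsto (fun n : ℕ => C / ((n : ℝ) + 1)) atTop (nhds 0) :=
      tendsto_const_nhds.div_atTop
        (tendsto_atTop_add_const_right _ _ tendsto_natCast_atTop_atTop)
    simpa using this.const_sub m
  have hgm : ∀ n : ℕ, Integrable (fun x => min (g x) ((n : ℝ) + 1)) (P₀ : Measure E) := fun n =>
    .of_bound (hg.min continuous_const).aestronglyMeasurable ((n : ℝ) + 1)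
      (ae_of_all _ fun x => by
        rw [Real.norm_eq_abs, abs_of_nonneg (le_min (hg0 x) (hpos n).le)]
        exact min_le_right _ _)
  have hlint : ∫⁻ x, ENNReal.ofReal (g x) ∂(P₀ : Measure E) = ENNReal.ofReal m := by
    refine tendsto_nhds_unique (lintegral_tendsto_of_tendsto_of_monotone
      (f := fun (n : ℕ) x => ENNReal.ofReal (min (g x) (n + 1)))
      (fun n => (hgm n).aemeasurable.ennreal_ofReal)
      (ae_of_all _ fun x a b hab => ?_) (ae_of_all _ fun x => ?_)) ?_
    · have : (a : ℝ) ≤ b := by exact_mod_cast hab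
      dsimp only
      gcongr
    · refine tendsto_const_nhds.congr' ?_
      filter_upwards [eventually_ge_atTop ⌈g x⌉₊] with n hn
      rw [min_eq_left]
      have := (Nat.le_ceil (g x)).trans (Nat.cast_le.2 hn)
      linarith
    · refine (ENNReal.tendsto_ofReal hIlim).congr fun n => ?_
      exact ofReal_integral_eq_lintegral_ofReal (hgm n)
        (ae_of_all _ fun x => le_min (hg0 x) (hpos n).le)
  have hgint : Integrable g (P₀ : Measure E) :=
    (lintegral_ofReal_ne_top_iff_integrable hg.aestronglyMeasurable (ae_of_all _ hg0)).1
      (by simp [hlint])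
  refine ⟨hgint, ?_⟩
  rw [integral_eq_lintegral_of_nonneg_ae (ae_of_all _ hg0) hg.aestronglyMeasurable, hlint,
    ENNReal.toReal_ofReal hm0]

/-- Compactness for laws with uniformly bounded first absolute moments. -/
theorem exists_compact_measureReal_compl_le {E ι : Type*} [NormedAddCommGroup E] [ProperSpace E]
    [MeasurableSpace E] [BorelSpace E] {P : ι → ProbabilityMeasure E} {B : ℝ}
    (h_int : ∀ i, Integrable (fun x => ‖x‖) (P i : Measure E))
    (hB : ∀ i, ∫ x, ‖x‖ ∂(P i : Measure E) ≤ B) {ε : ℝ} (hε : 0 < ε) :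
    ∃ K : Set E, IsCompact K ∧ ∀ i, (P i : Measure E).real Kᶜ ≤ ε := by
  refine ⟨Metric.closedBall 0 ((|B| + 1) / ε), isCompact_closedBall _ _, fun i => ?_⟩
  have h1 := mul_meas_ge_le_integral_of_nonneg (ae_of_all _ fun x => norm_nonneg x) (h_int i)
    ((|B| + 1) / ε)
  have h2 : (P i : Measure E).real (Metric.closedBall 0 ((|B| + 1) / ε))ᶜ ≤
      (P i : Measure E).real {x | (|B| + 1) / ε ≤ ‖x‖} := by
    refine measureReal_mono fun x hx => ?_
    simp only [Set.mem_compl_iff, Metric.mem_closedBall, dist_zero_right, not_le] at hx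
    exact hx.le
  have hR : 0 < (|B| + 1) / ε := by positivity
  have h3 : (|B| + 1) / ε * (P i : Measure E).real {x | (|B| + 1) / ε ≤ ‖x‖} ≤ |B| + 1 :=
    h1.trans ((hB i).trans (by linarith [le_abs_self B]))
  refine h2.trans ?_
  rw [div_mul_eq_mul_div, div_le_iff₀ hε] at h3
  exact le_of_mul_le_mul_left h3 (by positivity)

/-- `(1 + s y) ^ k → exp (u y₀)` when `s → 0`, `k s → u` and `y → y₀`. -/
theorem tendsto_one_add_mul_pow_exp {α : Type*} {l : Filter α} {s y : α → ℝ} {k : α → ℕ}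
    {u y₀ : ℝ} (hs : Tendsto s l (nhds 0)) (hk : Tendsto (fun a => k a * s a) l (nhds u))
    (hy : Tendsto y l (nhds y₀)) :
    Tendsto (fun a => (1 + s a * y a) ^ k a) l (nhds (Real.exp (u * y₀))) := by
  have hh : Tendsto (fun a => s a * y a) l (nhds 0) := by simpa using hs.mul hy
  have hd : HasDerivAt (fun h : ℝ => Real.log (1 + h)) 1 0 := by
    simpa using ((hasDerivAt_id (0 : ℝ)).const_add 1).log (by simp)
  have hslope : Tendsto (dslope (fun h : ℝ => Real.log (1 + h)) 0) (nhds 0) (nhds 1) := by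
    have := (continuousAt_dslope_same.2 hd.differentiableAt).tendsto
    rwa [dslope_same, hd.deriv] at this
  have hlim : Tendsto (fun a => (k a * s a) * y a *
      dslope (fun h : ℝ => Real.log (1 + h)) 0 (s a * y a)) l (nhds (u * y₀)) := by
    simpa using (hk.mul hy).mul (hslope.comp hh)
  refine ((Real.continuous_exp.tendsto _).comp hlim).congr' ?_
  filter_upwards [hh.eventually (lt_mem_nhds (show (-1 : ℝ) < 0 by norm_num))] with a ha
  have h1 : (s a * y a) * dslope (fun h : ℝ => Real.log (1 + h)) 0 (s a * y a) =
      Real.log (1 + s a * y a) := by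
    have := sub_smul_dslope (fun h : ℝ => Real.log (1 + h)) 0 (s a * y a)
    simpa using this
  have h2 : (k a * s a) * y a * dslope (fun h : ℝ => Real.log (1 + h)) 0 (s a * y a) =
      k a * Real.log (1 + s a * y a) := by rw [← h1]; ring
  simp only [Function.comp_apply, h2]
  rw [mul_comm, ← Real.rpow_def_of_pos (by linarith), Real.rpow_natCast]

/-- The moment generating function of the standard Gaussian measure. -/
theorem integrable_and_integral_exp_stdGaussian {r : ℕ} (w : Fin r → ℝ) :
    Integrable (fun x => Real.exp (w ⬝ᵥ x)) (_root_.stdGaussian r) ∧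
      ∫ x, Real.exp (w ⬝ᵥ x) ∂(_root_.stdGaussian r) = Real.exp ((1 / 2) * (w ⬝ᵥ w)) := by
  have hprod : (fun x : Fin r → ℝ => Real.exp (w ⬝ᵥ x)) =
      fun x => ∏ i, Real.exp (w i * x i) := by
    funext x; rw [dotProduct, Real.exp_sum]
  rw [hprod, _root_.stdGaussian]
  refine ⟨Integrable.fintype_prod fun i => integrable_exp_mul_gaussianReal (w i), ?_⟩
  rw [integral_fintype_prod_eq_prod (fun i (x : ℝ) => Real.exp (w i * x))]
  have h : ∀ t : ℝ, ∫ x, Real.exp (t * x) ∂(gaussianReal 0 1) = Real.exp (t ^ 2 / 2) := fun t => by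
    simpa [mgf] using congrFun (mgf_id_gaussianReal (μ := 0) (v := 1)) t
  simp only [h, ← Real.exp_sum, dotProduct, mul_sum]
  congr 1
  exact sum_congr rfl fun i _ => by ring

instance isProbabilityMeasure_stdGaussian_pi (r : ℕ) :
    IsProbabilityMeasure (_root_.stdGaussian r) := by
  unfold _root_.stdGaussian; infer_instance

/-- A probability measure whose moment generating function on the nonnegative orthant is that of
`N(0, Γ)` is mapped to `N(0, I)` by any matrix `A` with `A Γ Aᵀ = 1`. -/
theorem map_mulVec_eq_stdGaussian {r : ℕ} {ν : Measure (Fin r → ℝ)} [IsProbabilityMeasure ν]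
    {Γ A : Matrix (Fin r) (Fin r) ℝ} (hA : A * Γ * Aᵀ = 1)
    (hν : ∀ u : Fin r → ℝ, 0 ≤ u → Integrable (fun y => Real.exp (u ⬝ᵥ y)) ν ∧
      ∫ y, Real.exp (u ⬝ᵥ y) ∂ν = Real.exp ((1 / 2) * (u ⬝ᵥ (Γ *ᵥ u)))) :
    ν.map (A *ᵥ ·) = _root_.stdGaussian r := by
  have hcont : ∀ D : Matrix (Fin r) (Fin r) ℝ, Continuous (D *ᵥ ·) := fun D => by fun_prop
  obtain ⟨B, hB1, hB2⟩ : ∃ B, A * B = 1 ∧ Γ = B * Bᵀ := by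
    have h1 : A * (Γ * Aᵀ) = 1 := by rw [← Matrix.mul_assoc, hA]
    have h2 : (Γ * Aᵀ) * A = 1 := mul_eq_one_comm.1 h1
    have h4 : Aᵀ * (Γ * Aᵀ)ᵀ = 1 := by rw [← Matrix.transpose_mul, h2, Matrix.transpose_one]
    exact ⟨Γ * Aᵀ, h1, by rw [Matrix.mul_assoc, h4, Matrix.mul_one]⟩
  have hγ : ∀ u : Fin r → ℝ,
      Integrable (fun y => Real.exp (u ⬝ᵥ y)) ((_root_.stdGaussian r).map (B *ᵥ ·)) ∧
      ∫ y, Real.exp (u ⬝ᵥ y) ∂((_root_.stdGaussian r).map (B *ᵥ ·)) =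
        Real.exp ((1 / 2) * (u ⬝ᵥ (Γ *ᵥ u))) := by
    intro u
    have hexp : Continuous fun y : Fin r → ℝ => Real.exp (u ⬝ᵥ y) := by
      simp only [dotProduct]; fun_prop
    obtain ⟨h1, h2⟩ := integrable_and_integral_exp_stdGaussian (u ᵥ* B)
    rw [integrable_map_measure hexp.aestronglyMeasurable (hcont B).aemeasurable,
      integral_map (hcont B).aemeasurable hexp.aestronglyMeasurable]
    simp only [Function.comp_def, Matrix.dotProduct_mulVec] at h1 h2 ⊢
    refine ⟨h1, h2.trans ?_⟩
    rw [hB2, ← Matrix.dotProduct_mulVec _ (B * Bᵀ), ← Matrix.mulVec_mulVec, Matrix.mulVec_transpose,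
      Matrix.dotProduct_mulVec]
  have := Measure.isProbabilityMeasure_map (μ := _root_.stdGaussian r) (hcont B).aemeasurable
  have hνγ : ν = (_root_.stdGaussian r).map (B *ᵥ ·) :=
    Measure.ext_of_integral_exp_orthant (fun u hu => (hν u hu).1) (fun u _ => (hγ u).1)
      fun u hu => by rw [(hν u hu).2, (hγ u).2]
  rw [hνγ, Measure.map_map (hcont A).measurable (hcont B).measurable]
  have : (fun x : Fin r → ℝ => A *ᵥ x) ∘ (fun x => B *ᵥ x) = id := by
    funext x; simp [Matrix.mulVec_mulVec, hB1]
  rw [this, Measure.map_id]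

/-- Bounds on moments of order `1 / s` and centering control the first absolute moment. -/
theorem integral_abs_le_of_one_add_pow {Ω : Type*} [MeasurableSpace Ω] {P : Measure Ω}
    {Y : Ω → ℝ} {s : ℝ} {k : ℕ} (hks : 1 ≤ k * s) (hnn : ∀ ω, 0 ≤ 1 + s * Y ω)
    (hY : Integrable Y P) (hmean : ∫ ω, Y ω ∂P = 0)
    (h_int : Integrable (fun ω => (1 + s * Y ω) ^ k) P) :
    ∫ ω, |Y ω| ∂P ≤ 2 * ∫ ω, (1 + s * Y ω) ^ k ∂P := by
  have hpt : ∀ ω, |Y ω| ≤ 2 * (1 + s * Y ω) ^ k - Y ω := by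
    intro ω
    have h1 := one_add_mul_le_pow (a := s * Y ω) (by linarith [hnn ω]) k
    have h2 : 0 ≤ (1 + s * Y ω) ^ k := pow_nonneg (hnn ω) k
    rcases le_total 0 (Y ω) with h | h
    · rw [abs_of_nonneg h]
      nlinarith [mul_le_mul_of_nonneg_right hks h]
    · rw [abs_of_nonpos h]
      linarith
  calc ∫ ω, |Y ω| ∂P ≤ ∫ ω, (2 * (1 + s * Y ω) ^ k - Y ω) ∂P :=
        integral_mono hY.abs ((h_int.const_mul 2).sub hY) hpt
    _ = 2 * ∫ ω, (1 + s * Y ω) ^ k ∂P := by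
        rw [integral_sub (h_int.const_mul 2) hY, hmean, integral_const_mul, sub_zero]

/-- If `Y n` is centered, `1 + s n i * Y n i ≥ 0` with `s → 0`, and the moments of `1 + s Y` of
order `k` with `k s → v` converge to the moment generating function of `N(0, Γ)` at `v`, then
`A n *ᵥ Y n` converges in distribution to `N(0, I)` for all matrices with `A n * Γ * (A n)ᵀ = 1`. -/
theorem tendsto_stdGaussian_of_moments {Ω : Type*} [MeasurableSpace Ω] {Q : Measure Ω}
    [IsProbabilityMeasure Q] {r : ℕ} {Y : ℕ → Ω → Fin r → ℝ} {s : ℕ → Fin r → ℝ}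
    {Γ : Matrix (Fin r) (Fin r) ℝ} {A : ℕ → Matrix (Fin r) (Fin r) ℝ}
    (hYmeas : ∀ n, Measurable (Y n)) (hs0 : ∀ n i, 0 < s n i)
    (hs : ∀ i, Tendsto (fun n => s n i) atTop (nhds 0))
    (hnn : ∀ n ω i, 0 ≤ 1 + s n i * Y n ω i)
    (hY : ∀ n i, Integrable (fun ω => Y n ω i) Q) (hmean : ∀ n i, ∫ ω, Y n ω i ∂Q = 0)
    (h_int : ∀ n (k : Fin r → ℕ), Integrable (fun ω => ∏ i, (1 + s n i * Y n ω i) ^ k i) Q)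
    (hmom : ∀ (k : ℕ → Fin r → ℕ) (v : Fin r → ℝ),
      (∀ i, Tendsto (fun n => (k n i : ℝ) * s n i) atTop (nhds (v i))) →
      Tendsto (fun n => ∫ ω, ∏ i, (1 + s n i * Y n ω i) ^ k n i ∂Q) atTop
        (nhds (Real.exp ((1 / 2) * (v ⬝ᵥ (Γ *ᵥ v))))))
    (hA : ∀ n, A n * Γ * (A n)ᵀ = 1) (φ : BoundedContinuousFunction (Fin r → ℝ) ℝ) :
    Tendsto (fun n => ∫ ω, φ (A n *ᵥ Y n ω) ∂Q) atTop
      (nhds (∫ x, φ x ∂(_root_.stdGaussian r))) := by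
  classical
  have hprob : ∀ n, IsProbabilityMeasure (Q.map (Y n)) := fun n =>
    Measure.isProbabilityMeasure_map (hYmeas n).aemeasurable
  let P : ℕ → ProbabilityMeasure (Fin r → ℝ) := fun n => ⟨Q.map (Y n), hprob n⟩
  have hPint : ∀ n (f : (Fin r → ℝ) → ℝ), Continuous f →
      ∫ y, f y ∂(P n : Measure (Fin r → ℝ)) = ∫ ω, f (Y n ω) ∂Q := fun n f hf =>
    integral_map (hYmeas n).aemeasurable hf.aestronglyMeasurable
  have hPintegrable : ∀ n (f : (Fin r → ℝ) → ℝ), Continuous f →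
      (Integrable f (P n : Measure (Fin r → ℝ)) ↔ Integrable (fun ω => f (Y n ω)) Q) :=
    fun n f hf => integrable_map_measure hf.aestronglyMeasurable (hYmeas n).aemeasurable
  -- First absolute moments are bounded.
  have hbound : ∀ i, ∃ B, ∀ n, ∫ ω, |Y n ω i| ∂Q ≤ B := by
    intro i
    let k : ℕ → Fin r → ℕ := fun n => Pi.single i ⌈1 / s n i⌉₊
    have hk : ∀ j, Tendsto (fun n => (k n j : ℝ) * s n j) atTop
        (nhds ((Pi.single i 1 : Fin r → ℝ) j)) := by
      intro j
      rcases eq_or_ne j i with rfl | hj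
      · simp only [k, Pi.single_eq_same]
        refine tendsto_of_tendsto_of_tendsto_of_le_of_le (g := fun _ => 1)
          (h := fun n => 1 + s n j) tendsto_const_nhds (by simpa using (hs j).const_add 1)
          (fun n => ?_) (fun n => ?_)
        · have := Nat.le_ceil (1 / s n j)
          rwa [div_le_iff₀ (hs0 n j)] at this
        · have := (Nat.ceil_lt_add_one (one_div_pos.2 (hs0 n j)).le).le
          calc (⌈1 / s n j⌉₊ : ℝ) * s n j ≤ (1 / s n j + 1) * s n j :=
                mul_le_mul_of_nonneg_right this (hs0 n j).le
            _ = 1 + s n j := by rw [add_mul, one_div_mul_cancel (hs0 n j).ne', one_mul]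
      · simp [k, Pi.single_eq_of_ne hj]
    obtain ⟨B, hB⟩ := (hmom k _ hk).bddAbove_range
    have hprod : ∀ n ω, ∏ j, (1 + s n j * Y n ω j) ^ k n j =
        (1 + s n i * Y n ω i) ^ ⌈1 / s n i⌉₊ := by
      intro n ω
      rw [prod_eq_single i (fun j _ hj => by simp [k, Pi.single_eq_of_ne hj]) (by simp)]
      simp [k]
    refine ⟨2 * B, fun n => ?_⟩
    have hi := h_int n (k n)
    have hB' := hB (Set.mem_range_self n)
    simp only [hprod] at hi hB'
    have h1 : 1 ≤ (⌈1 / s n i⌉₊ : ℝ) * s n i := by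
      have := Nat.le_ceil (1 / s n i)
      rwa [div_le_iff₀ (hs0 n i)] at this
    have := integral_abs_le_of_one_add_pow h1 (fun ω => hnn n ω i) (hY n i) (hmean n i) hi
    linarith
  choose B hB using hbound
  have hnormle : ∀ y : Fin r → ℝ, ‖y‖ ≤ ∑ i, |y i| := fun y =>
    (pi_norm_le_iff_of_nonneg (sum_nonneg fun i _ => abs_nonneg _)).2 fun i =>
      single_le_sum (f := fun i => |y i|) (fun j _ => abs_nonneg _) (mem_univ i)
  have hsumint : ∀ n, Integrable (fun ω => ∑ i, |Y n ω i|) Q := fun n =>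
    integrable_finsetSum _ fun i _ => (hY n i).abs
  have hnormint : ∀ n, Integrable (fun ω => ‖Y n ω‖) Q := fun n =>
    (hsumint n).mono' (hYmeas n).norm.aestronglyMeasurable
      (ae_of_all _ fun ω => by simpa using hnormle (Y n ω))
  have htight : ∀ ε > (0 : ℝ), ∃ K : Set (Fin r → ℝ), IsCompact K ∧
      ∀ n, (P n : Measure (Fin r → ℝ)).real Kᶜ ≤ ε := by
    intro ε hε
    refine exists_compact_measureReal_compl_le (B := ∑ i, B i)
      (fun n => (hPintegrable n _ continuous_norm).2 (hnormint n)) (fun n => ?_) hε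
    rw [hPint n _ continuous_norm]
    calc ∫ ω, ‖Y n ω‖ ∂Q ≤ ∫ ω, ∑ i, |Y n ω i| ∂Q :=
          integral_mono (hnormint n) (hsumint n) fun ω => hnormle _
      _ = ∑ i, ∫ ω, |Y n ω i| ∂Q := integral_finsetSum _ fun i _ => (hY n i).abs
      _ ≤ ∑ i, B i := sum_le_sum fun i _ => hB i n
  have hcompact : IsCompact (closure (Set.range P)) := by
    refine isCompact_closure_of_isTightMeasureSet ?_
    rw [isTightMeasureSet_iff_exists_isCompact_measure_compl_le]
    intro ε hε
    obtain ⟨δ, hδ0, hδ⟩ := ENNReal.lt_iff_exists_nnreal_btwn.1 hε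
    obtain ⟨K, hK, hKP⟩ := htight δ (by exact_mod_cast hδ0)
    refine ⟨K, hK, ?_⟩
    rintro _ ⟨_, ⟨n, rfl⟩, rfl⟩
    refine le_trans ?_ hδ.le
    have := hKP n
    exact (ENNReal.toReal_le_toReal (measure_ne_top _ _) ENNReal.coe_ne_top).1 this
  rw [tendsto_iff_ultrafilter]
  intro U hU
  obtain ⟨P₀, -, hP₀⟩ := hcompact.ultrafilter_le_nhds (U.map P)
    (le_principal_iff.2 (mem_of_superset (Filter.range_mem_map) subset_closure))
  have hP : Tendsto P U (nhds P₀) := hP₀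
  have hAlim : ∀ i j, ∃ a, Tendsto (fun n => A n i j) U (nhds a) := by
    intro i j
    have hAA : ∀ n, (A n)ᵀ * A n = Γ⁻¹ := fun n => by
      have h1 : (Γ * (A n)ᵀ) * A n = 1 :=
        mul_eq_one_comm.1 (by rw [← Matrix.mul_assoc, hA n])
      rw [Matrix.mul_assoc] at h1
      exact (Matrix.inv_eq_right_inv h1).symm
    have hmem : ∀ n, A n i j ∈ Set.Icc (-(1 + Γ⁻¹ j j)) (1 + Γ⁻¹ j j) := by
      intro n
      have h1 : Γ⁻¹ j j = ∑ l, A n l j ^ 2 := by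
        rw [← hAA n, Matrix.mul_apply]
        exact sum_congr rfl fun l _ => by rw [Matrix.transpose_apply, sq]
      have h2 : A n i j ^ 2 ≤ Γ⁻¹ j j := by
        rw [h1]
        exact single_le_sum (f := fun l => A n l j ^ 2) (fun l _ => sq_nonneg _) (mem_univ i)
      constructor <;> nlinarith [sq_nonneg (A n i j - 1), sq_nonneg (A n i j + 1)]
    obtain ⟨a, -, ha⟩ := isCompact_Icc.ultrafilter_le_nhds (U.map fun n => A n i j)
      (le_principal_iff.2 (mem_of_superset Filter.range_mem_map (Set.range_subset_iff.2 hmem)))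
    exact ⟨a, ha⟩
  choose A₀ hA₀ using hAlim
  have hAt : Tendsto A U (nhds (Matrix.of A₀)) :=
    tendsto_pi_nhds.2 fun i => tendsto_pi_nhds.2 fun j => hA₀ i j
  have hA₀1 : Matrix.of A₀ * Γ * (Matrix.of A₀)ᵀ = 1 := by
    have hc : Continuous fun D : Matrix (Fin r) (Fin r) ℝ => D * Γ * Dᵀ := by fun_prop
    refine tendsto_nhds_unique ((hc.tendsto _).comp hAt) ?_
    simp only [Function.comp_def, hA]
    exact tendsto_const_nhds
  have hmgf : ∀ u : Fin r → ℝ, 0 ≤ u →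
      Integrable (fun y => Real.exp (u ⬝ᵥ y)) (P₀ : Measure (Fin r → ℝ)) ∧
      ∫ y, Real.exp (u ⬝ᵥ y) ∂(P₀ : Measure (Fin r → ℝ)) =
        Real.exp ((1 / 2) * (u ⬝ᵥ (Γ *ᵥ u))) := by
    intro u hu
    let k : ℕ → Fin r → ℕ := fun n i => ⌊u i / s n i⌋₊
    have hk : ∀ i, Tendsto (fun n => (k n i : ℝ) * s n i) atTop (nhds (u i)) := by
      intro i
      refine tendsto_of_tendsto_of_tendsto_of_le_of_le (g := fun n => u i - s n i)
        (h := fun _ => u i) (by simpa using (hs i).const_sub (u i)) tendsto_const_nhds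
        (fun n => ?_) (fun n => ?_)
      · have := (Nat.lt_floor_add_one (u i / s n i)).le
        rw [div_le_iff₀ (hs0 n i), add_mul, one_mul] at this
        simp only [k]
        linarith
      · have := Nat.floor_le (div_nonneg (hu i) (hs0 n i).le)
        rwa [le_div_iff₀ (hs0 n i)] at this
    have hk2 : ∀ i, Tendsto (fun n => ((k n i * 2 : ℕ) : ℝ) * s n i) atTop (nhds (u i * 2)) := by
      intro i
      refine ((hk i).mul_const 2).congr fun n => ?_
      push_cast; ring
    have hm2 := hmom (fun n i => k n i * 2) (fun i => u i * 2) hk2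
    let G : ℕ → (Fin r → ℝ) → ℝ := fun n y => |∏ i, (1 + s n i * y i) ^ k n i|
    have hGc : ∀ n, Continuous (G n) := fun n => by fun_prop
    have hG2c : ∀ n, Continuous fun y => G n y ^ 2 := fun n => (hGc n).pow 2
    have hGY : ∀ n ω, G n (Y n ω) = ∏ i, (1 + s n i * Y n ω i) ^ k n i := fun n ω =>
      abs_of_nonneg (prod_nonneg fun i _ => pow_nonneg (hnn n ω i) _)
    have hGY2 : ∀ n ω, G n (Y n ω) ^ 2 = ∏ i, (1 + s n i * Y n ω i) ^ (k n i * 2) :=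
      fun n ω => by simp only [hGY, ← prod_pow, pow_mul]
    have hexp : Continuous fun y : Fin r → ℝ => Real.exp (u ⬝ᵥ y) := by
      simp only [dotProduct]; fun_prop
    refine integrable_and_integral_eq_of_tendsto_of_sq_bound hP htight hGc hexp
      (fun n y => abs_nonneg _) (fun y => (Real.exp_pos _).le) (fun y => ?_) (fun n => ?_)
      (fun n => ?_) (C := Real.exp ((1 / 2) * ((fun i => u i * 2) ⬝ᵥ (Γ *ᵥ fun i => u i * 2))) + 1)
      ?_ ?_
    · have hfst : Tendsto (fun p : ℕ × (Fin r → ℝ) => p.1) ((U : Filter ℕ) ×ˢ nhds y) atTop :=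
        tendsto_fst.mono_right hU
      have hi : ∀ i, Tendsto (fun p : ℕ × (Fin r → ℝ) => (1 + s p.1 i * p.2 i) ^ k p.1 i)
          ((U : Filter ℕ) ×ˢ nhds y) (nhds (Real.exp (u i * y i))) := fun i =>
        tendsto_one_add_mul_pow_exp ((hs i).comp hfst) ((hk i).comp hfst)
          (((continuous_apply i).tendsto y).comp tendsto_snd)
      have := (tendsto_finsetProd univ fun i _ => hi i).abs
      rwa [← Real.exp_sum, abs_of_pos (Real.exp_pos _)] at this
    · rw [hPintegrable n _ (hGc n)]
      simpa only [hGY] using h_int n (k n)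
    · rw [hPintegrable n _ (hG2c n)]
      simpa only [hGY2] using h_int n fun i => k n i * 2
    · filter_upwards [hU (hm2.eventually (gt_mem_nhds (lt_add_one _)))] with n hn
      rw [hPint n _ (hG2c n)]
      simp only [hGY2]
      exact hn.le
    · refine ((hmom k u hk).mono_left hU).congr fun n => ?_
      rw [hPint n _ (hGc n)]
      simp only [hGY]
  have hmap := map_mulVec_eq_stdGaussian hA₀1 hmgf
  have hlim := tendsto_integral_of_tendsto_of_continuous_convergence hP htight
    (F := fun n y => φ (A n *ᵥ y)) (f := fun y => φ (Matrix.of A₀ *ᵥ y)) (C := ‖φ‖)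
    (fun n => by fun_prop) (by fun_prop) (fun n y => φ.norm_coe_le_norm _)
    (fun y => φ.norm_coe_le_norm _) (fun y => ?_)
  · rw [← hmap, integral_map (by fun_prop) φ.continuous.aestronglyMeasurable]
    refine hlim.congr fun n => hPint n _ ?_
    fun_prop
  · have hc : Continuous fun q : Matrix (Fin r) (Fin r) ℝ × (Fin r → ℝ) => φ (q.1 *ᵥ q.2) := by
      fun_prop
    exact (hc.tendsto (Matrix.of A₀, y)).comp
      ((hAt.comp tendsto_fst).prodMk_nhds tendsto_snd)

/-- **Corollary (fixed correlation matrix form).**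
Let `X n` be random vectors in `ℝ^r` with nonnegative coordinates and means `μ n i > 0`.
Let `Γ` be a fixed symmetric positive definite matrix, `σ n` vectors of positive reals with
`σ n i = o(μ n i)`, and `Sig n = diag(σ n) Γ diag(σ n)`, with principal square root `Sqrt n`.
If for every `c > 0`, uniformly over nonnegative integer vectors `k` with
`k i ≤ c μ n i / σ n i` for all `i`,
`E[X^k] / (μ^k exp(½ (k/μ)' Sig (k/μ))) → 1`, then
`(Sqrt n)⁻¹ (X n − μ n)` converges in distribution to `N(0, I_r)`. -/
theorem statement1
    {Ω : Type*} [MeasureSpace Ω] [IsProbabilityMeasure (ℙ : Measure Ω)]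
    (r : ℕ) (hr : 1 ≤ r)
    (X : ℕ → Ω → Fin r → ℝ) (hXmeas : ∀ n, Measurable (X n))
    (hXnn : ∀ n ω i, 0 ≤ X n ω i)
    (μ : ℕ → Fin r → ℝ) (hμpos : ∀ n i, 0 < μ n i)
    (hμint : ∀ n i, Integrable (fun ω => X n ω i))
    (hμ : ∀ n i, μ n i = ∫ ω, X n ω i)
    (Γ : Matrix (Fin r) (Fin r) ℝ) (hΓ : Γ.PosDef)
    (σ : ℕ → Fin r → ℝ) (hσpos : ∀ n i, 0 < σ n i)
    (hσμ : ∀ i, Tendsto (fun n => σ n i / μ n i) atTop (nhds 0))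
    (Sig Sqrt : ℕ → Matrix (Fin r) (Fin r) ℝ)
    (hSigdef : ∀ n, Sig n = Matrix.diagonal (σ n) * Γ * Matrix.diagonal (σ n))
    (hSqrt : ∀ n, (Sqrt n).PosDef ∧ Sqrt n * Sqrt n = Sig n)
    -- the joint moments in the relevant range exist
    (hInt : ∀ c > (0:ℝ), ∀ n, ∀ k : Fin r → ℕ, (∀ i, (k i : ℝ) ≤ c * μ n i / σ n i) →
        Integrable (fun ω => ∏ i, X n ω i ^ k i))
    -- uniform convergence of the normalized moments, for every `c > 0`
    (hmom : ∀ c > (0:ℝ), ∀ ε > (0:ℝ), ∃ n₀ : ℕ, ∀ n ≥ n₀, ∀ k : Fin r → ℕ,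
        (∀ i, (k i : ℝ) ≤ c * μ n i / σ n i) →
        |(∫ ω, ∏ i, X n ω i ^ k i) /
            ((∏ i, μ n i ^ k i) *
              Real.exp ((1/2) * ∑ i, ∑ j,
                ((k i : ℝ) / μ n i) * Sig n i j * ((k j : ℝ) / μ n j))) - 1| ≤ ε) :
    -- conclusion: `Σ_n^{-1/2} (X_n − μ_n) →d N(0, I_r)`
    ∀ φ : BoundedContinuousFunction (Fin r → ℝ) ℝ,
      Tendsto (fun n => ∫ ω, φ ((Sqrt n)⁻¹ *ᵥ (fun i => X n ω i - μ n i)))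
        atTop (nhds (∫ x, φ x ∂ stdGaussian r)) := by
  have hs0 : ∀ n i, 0 < σ n i / μ n i := fun n i => div_pos (hσpos n i) (hμpos n i)
  have hone : ∀ n ω i, 1 + σ n i / μ n i * ((X n ω i - μ n i) / σ n i) = X n ω i / μ n i := by
    intro n ω i
    have h1 := (hσpos n i).ne'
    have h2 := (hμpos n i).ne'
    field_simp
    ring
  have hprod : ∀ n (k : Fin r → ℕ) ω,
      ∏ i, (1 + σ n i / μ n i * ((X n ω i - μ n i) / σ n i)) ^ k i =
        (∏ i, X n ω i ^ k i) / ∏ i, μ n i ^ k i := by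
    intro n k ω
    simp only [hone, div_pow, prod_div_distrib]
  have hrange : ∀ c n (k : Fin r → ℕ), (∀ i, (k i : ℝ) * (σ n i / μ n i) ≤ c) →
      ∀ i, (k i : ℝ) ≤ c * μ n i / σ n i := by
    intro c n k h i
    have := h i
    rwa [← mul_div_assoc, div_le_iff₀ (hμpos n i), ← le_div_iff₀ (hσpos n i)] at this
  have hXint : ∀ n (k : Fin r → ℕ), Integrable (fun ω => ∏ i, X n ω i ^ k i) := by
    intro n k
    have hnn : ∀ i, 0 ≤ (k i : ℝ) * (σ n i / μ n i) := fun i =>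
      mul_nonneg (Nat.cast_nonneg _) (hs0 n i).le
    refine hInt (1 + ∑ i, (k i : ℝ) * (σ n i / μ n i))
      (add_pos_of_pos_of_nonneg one_pos (sum_nonneg fun i _ => hnn i)) n k
      (hrange _ n k fun i => ?_)
    have := single_le_sum (f := fun i => (k i : ℝ) * (σ n i / μ n i)) (fun j _ => hnn j)
      (mem_univ i)
    linarith
  have hA : ∀ n, (Sqrt n)⁻¹ * diagonal (σ n) * Γ * ((Sqrt n)⁻¹ * diagonal (σ n))ᵀ = 1 := by
    intro n
    obtain ⟨hpd, hsq⟩ := hSqrt n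
    have hu : IsUnit (Sqrt n).det := hpd.det_pos.ne'.isUnit
    have hT : (Sqrt n)ᵀ = Sqrt n := by simpa [Matrix.IsHermitian] using hpd.isHermitian
    rw [transpose_mul, diagonal_transpose, transpose_nonsing_inv, hT]
    calc (Sqrt n)⁻¹ * diagonal (σ n) * Γ * (diagonal (σ n) * (Sqrt n)⁻¹)
        = (Sqrt n)⁻¹ * (diagonal (σ n) * Γ * diagonal (σ n)) * (Sqrt n)⁻¹ := by
          simp only [Matrix.mul_assoc]
      _ = (Sqrt n)⁻¹ * Sqrt n * (Sqrt n * (Sqrt n)⁻¹) := by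
          rw [← hSigdef, ← hsq]; simp only [Matrix.mul_assoc]
      _ = 1 := by rw [nonsing_inv_mul _ hu, mul_nonsing_inv _ hu, Matrix.mul_one]
  have hAY : ∀ n ω, ((Sqrt n)⁻¹ * diagonal (σ n)) *ᵥ (fun i => (X n ω i - μ n i) / σ n i) =
      (Sqrt n)⁻¹ *ᵥ (fun i => X n ω i - μ n i) := by
    intro n ω
    rw [← mulVec_mulVec]
    congr 1
    funext i
    rw [mulVec_diagonal, mul_div_cancel₀ _ (hσpos n i).ne']
  intro φ
  simp only [← hAY]
  refine tendsto_stdGaussian_of_moments (Y := fun n ω i => (X n ω i - μ n i) / σ n i)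
    (s := fun n i => σ n i / μ n i) (Γ := Γ) (fun n => ?_) hs0 hσμ (fun n ω i => ?_)
    (fun n i => ((hμint n i).sub (integrable_const _)).div_const _) (fun n i => ?_)
    (fun n k => ?_) (fun k v hk => ?_) hA φ
  · refine measurable_pi_iff.2 fun i => ?_
    exact (((measurable_pi_apply i).comp (hXmeas n)).sub_const _).div_const _
  · rw [hone]
    exact div_nonneg (hXnn n ω i) (hμpos n i).le
  · rw [integral_div, integral_sub (hμint n i) (integrable_const _), ← hμ]
    simp
  · simp only [hprod]
    exact (hXint n k).div_const _
  · simp only [hprod, integral_div]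
    have hexp : ∀ n, ∑ i, ∑ j, ((k n i : ℝ) / μ n i) * Sig n i j * ((k n j : ℝ) / μ n j) =
        ∑ i, ∑ j, (k n i * (σ n i / μ n i)) * Γ i j * (k n j * (σ n j / μ n j)) := by
      intro n
      refine sum_congr rfl fun i _ => sum_congr rfl fun j _ => ?_
      rw [hSigdef, mul_diagonal, diagonal_mul]
      ring
    have hv : v ⬝ᵥ (Γ *ᵥ v) = ∑ i, ∑ j, v i * Γ i j * v j := by
      simp only [dotProduct, mulVec, mul_sum, mul_assoc]
    have hlim : Tendsto (fun n => Real.exp ((1 / 2) *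
        ∑ i, ∑ j, ((k n i : ℝ) / μ n i) * Sig n i j * ((k n j : ℝ) / μ n j))) atTop
        (nhds (Real.exp ((1 / 2) * (v ⬝ᵥ (Γ *ᵥ v))))) := by
      simp only [hexp, hv]
      refine (Real.continuous_exp.tendsto _).comp (Tendsto.const_mul _ ?_)
      exact tendsto_finsetSum _ fun i _ => tendsto_finsetSum _ fun j _ =>
        ((hk i).mul_const _).mul (hk j)
    have hratio : Tendsto (fun n => (∫ ω, ∏ i, X n ω i ^ k n i) /
        ((∏ i, μ n i ^ k n i) * Real.exp ((1 / 2) *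
          ∑ i, ∑ j, ((k n i : ℝ) / μ n i) * Sig n i j * ((k n j : ℝ) / μ n j)))) atTop
        (nhds 1) := by
      have hc : 0 < 1 + ∑ i, |v i| :=
        add_pos_of_pos_of_nonneg one_pos (sum_nonneg fun i _ => abs_nonneg _)
      have hev : ∀ᶠ n in atTop, ∀ i, (k n i : ℝ) * (σ n i / μ n i) ≤ 1 + ∑ i, |v i| := by
        refine eventually_all.2 fun i => ((hk i).eventually_lt_const ?_).mono fun n hn => hn.le
        have := single_le_sum (f := fun i => |v i|) (fun j _ => abs_nonneg _) (mem_univ i)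
        linarith [le_abs_self (v i)]
      rw [Metric.tendsto_nhds]
      intro ε hε
      obtain ⟨n₀, hn₀⟩ := hmom _ hc (ε / 2) (half_pos hε)
      filter_upwards [hev, eventually_ge_atTop n₀] with n hn hge
      rw [Real.dist_eq]
      exact (hn₀ n hge (k n) (hrange _ n _ hn)).trans_lt (half_lt_self hε)
    have := hratio.mul hlim
    rw [one_mul] at this
    refine this.congr fun n => ?_
    rw [← div_div, div_mul_cancel₀ _ (Real.exp_pos _).ne']
end

section
/- Fix an integer C ≥ 1, a constant c_1 > 0, an integer r ≥ 1 and distinct integers m_1,…,m_r ∈ {0,1,…,C}. Let n = n(ν) and N = N(ν) be sequences of positive integers with N → ∞, c_1 N < n ≤ CN − 1 and CN − n → ∞, let λ_0 = λ_0(n/N) be the unique positive solution of λ g′(λ)/g(λ) = n/N, let W = W(λ_0), and set μ_i = N λ_0^{m_i} / (g(λ_0) m_i!) for i = 1,…,r. Let k_1 = k_1(ν),…,k_r = k_r(ν) be nonnegative integers with Σ_{i=1}^r k_i = o( (N/λ_0)^{2/3} ). Then, in the uniform allocation model, E[ ∏_{i=1}^r [X_{m_i}]_{k_i} ] ∼ (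 ∏_{i=1}^r μ_i^{k_i} ) · exp( − ( Σ_{i=1}^r k_i (m_i − n/N) )^2 / (2 N Var(W)) − ( Σ_{i=1}^r k_i )^2 / (2N) ) as ν → ∞. -/
open Filter Finset
open scoped BigOperators

/-- Placements of `n` distinguishable balls into `N` distinguishable bins with
no bin containing more than `C` balls. -/
def validPlacements (n N C : ℕ) : Finset (Fin n → Fin N) :=
  Finset.univ.filter fun f => ∀ j, (Finset.univ.filter fun i => f i = j).card ≤ C

/-- `binCount f m` is the number of bins containing exactly `m` balls under placement `f`. -/
def binCount {n N : ℕ} (f : Fin n → Fin N) (m : ℕ) : ℕ :=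
  (Finset.univ.filter fun j => (Finset.univ.filter fun i => f i = j).card = m).card

/-- `g(λ) = ∑_{k=0}^C λ^k / k!`. -/
noncomputable def gfun (C : ℕ) (x : ℝ) : ℝ :=
  ∑ k ∈ Finset.range (C + 1), x ^ k / (Nat.factorial k)

/-- Mean of the truncated Poisson random variable `W(λ)`. -/
noncomputable def meanW (C : ℕ) (x : ℝ) : ℝ :=
  ∑ j ∈ Finset.range (C + 1), (j : ℝ) * (x ^ j / (Nat.factorial j * gfun C x))

/-- Variance of the truncated Poisson random variable `W(λ)`. -/
noncomputable def varW (C : ℕ) (x : ℝ) : ℝ :=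
  (∑ j ∈ Finset.range (C + 1), (j : ℝ) ^ 2 * (x ^ j / (Nat.factorial j * gfun C x)))
    - (meanW C x) ^ 2

theorem descFactorial_succ_left (x k : ℕ) :
    (x + 1).descFactorial k = x.descFactorial k + k * x.descFactorial (k - 1) := by
  cases k with
  | zero => simp
  | succ k =>
    rw [Nat.succ_descFactorial_succ, Nat.descFactorial_succ, Nat.add_sub_cancel]
    rcases le_or_gt k x with h | h
    · obtain ⟨d, rfl⟩ := Nat.exists_eq_add_of_le h
      rw [Nat.add_sub_cancel_left]; ring
    · rw [Nat.descFactorial_of_lt h]; simp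

/-- Joint factorial moments of the letter counts of a word, weighted multiplicatively. -/
theorem sum_prod_mul_prod_descFactorial {α ι R : Type*} [Fintype α] [DecidableEq α]
    [Fintype ι] [DecidableEq ι] [CommRing R] (q : α → R) (m : ι → α)
    (hm : Function.Injective m) (N : ℕ) (k : ι → ℕ) :
    ∑ c : Fin N → α, (∏ j, q (c j)) *
        ∏ i, (((univ.filter fun j => c j = m i).card.descFactorial (k i) : ℕ) : R) =
      (N.descFactorial (∑ i, k i) : R) * (∏ i, q (m i) ^ k i) *
        (∑ a, q a) ^ (N - ∑ i, k i) := by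
  induction N generalizing k with
  | zero =>
    by_cases h : ∀ i, k i = 0
    · simp [h]
    · push Not at h
      obtain ⟨i, hi⟩ := h
      have h1 : 0 < ∑ i, k i :=
        Finset.sum_pos' (fun _ _ => Nat.zero_le _) ⟨i, mem_univ _, Nat.pos_of_ne_zero hi⟩
      have h2 : (∏ i, (((Nat.descFactorial 0 (k i) : ℕ)) : R)) = 0 :=
        Finset.prod_eq_zero (mem_univ i) (by
          rw [Nat.descFactorial_of_lt (Nat.pos_of_ne_zero hi)]; simp)
      rw [Nat.descFactorial_of_lt h1]
      simp [h2]
  | succ N ih =>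
    have hstep : ∀ (a : α) (c : Fin N → α),
        (∏ i, (((univ.filter fun j => (Fin.cons a c : Fin (N + 1) → α) j = m i).card.descFactorial
          (k i) : ℕ) : R)) =
        (∏ i, (((univ.filter fun j => c j = m i).card.descFactorial (k i) : ℕ) : R)) +
        ∑ i, if a = m i then (k i : R) *
          ∏ l, (((univ.filter fun j => c j = m l).card.descFactorial
            (Function.update k i (k i - 1) l) : ℕ) : R) else 0 := by
      intro a c
      have hcard : ∀ i, (univ.filter fun j => (Fin.cons a c : Fin (N + 1) → α) j = m i).card =
          (univ.filter fun j => c j = m i).card + if a = m i then 1 else 0 := by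
        intro i
        rw [Finset.card_filter, Finset.card_filter, Fin.sum_univ_succ, add_comm]
        simp
      simp_rw [hcard]
      by_cases ha : ∃ i, a = m i
      · obtain ⟨i, rfl⟩ := ha
        simp_rw [hm.eq_iff]
        rw [Finset.sum_ite_eq]
        simp only [mem_univ, if_true]
        rw [← Finset.mul_prod_erase univ _ (mem_univ i),
          ← Finset.mul_prod_erase univ (fun l => (((univ.filter fun j => c j = m l).card.descFactorial
            (k l) : ℕ) : R)) (mem_univ i),
          ← Finset.mul_prod_erase univ (fun l => (((univ.filter fun j => c j = m l).card.descFactorial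
            (Function.update k i (k i - 1) l) : ℕ) : R)) (mem_univ i)]
        have e1 : ∏ x ∈ univ.erase i, ((((univ.filter fun j => c j = m x).card +
            if i = x then 1 else 0).descFactorial (k x) : ℕ) : R) =
            ∏ x ∈ univ.erase i, (((univ.filter fun j => c j = m x).card.descFactorial (k x) : ℕ) : R) := by
          refine Finset.prod_congr rfl fun x hx => ?_
          rw [if_neg (Finset.ne_of_mem_erase hx).symm, add_zero]
        have e2 : ∏ x ∈ univ.erase i, (((univ.filter fun j => c j = m x).card.descFactorial
            (Function.update k i (k i - 1) x) : ℕ) : R) =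
            ∏ x ∈ univ.erase i, (((univ.filter fun j => c j = m x).card.descFactorial (k x) : ℕ) : R) := by
          refine Finset.prod_congr rfl fun x hx => ?_
          rw [Function.update_of_ne (Finset.ne_of_mem_erase hx)]
        rw [e1, e2, if_pos rfl, descFactorial_succ_left, Function.update_self]
        push_cast
        ring
      · push Not at ha
        simp [ha]
    have hsum : ∀ i, k i ≠ 0 → ∑ l, Function.update k i (k i - 1) l + 1 = ∑ l, k l := by
      intro i hi
      rw [← Finset.add_sum_erase univ _ (mem_univ i), ← Finset.add_sum_erase univ k (mem_univ i),
        Function.update_self]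
      have : ∑ x ∈ univ.erase i, Function.update k i (k i - 1) x = ∑ x ∈ univ.erase i, k x :=
        Finset.sum_congr rfl fun x hx => Function.update_of_ne (Finset.ne_of_mem_erase hx) _ _
      omega
    have hprod : ∀ i, k i ≠ 0 →
        q (m i) * ∏ l, q (m l) ^ Function.update k i (k i - 1) l = ∏ l, q (m l) ^ k l := by
      intro i hi
      rw [← Finset.mul_prod_erase univ _ (mem_univ i),
        ← Finset.mul_prod_erase univ (fun l => q (m l) ^ k l) (mem_univ i), Function.update_self,
        ← mul_assoc, ← pow_succ', Nat.sub_add_cancel (Nat.pos_of_ne_zero hi)]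
      congr 1
      refine Finset.prod_congr rfl fun x hx => ?_
      rw [Function.update_of_ne (Finset.ne_of_mem_erase hx)]
    have hcons : ∀ F : (Fin (N + 1) → α) → R,
        ∑ c, F c = ∑ a, ∑ c : Fin N → α, F (Fin.cons a c) := fun F => by
      rw [← (Fin.consEquiv fun _ : Fin (N + 1) => α).sum_comp, Fintype.sum_prod_type]
      rfl
    rw [hcons]
    simp only [Fin.prod_univ_succ, Fin.cons_zero, Fin.cons_succ,
      hstep, mul_add, Finset.sum_add_distrib]
    have hA : ∑ a, ∑ c : Fin N → α, q a * (∏ j, q (c j)) *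
        ∏ i, (((univ.filter fun j => c j = m i).card.descFactorial (k i) : ℕ) : R) =
        (∑ a, q a) * ((N.descFactorial (∑ i, k i) : R) * (∏ i, q (m i) ^ k i) *
        (∑ a, q a) ^ (N - ∑ i, k i)) := by
      rw [← ih, Finset.sum_mul]
      refine Finset.sum_congr rfl fun a _ => ?_
      rw [Finset.mul_sum]
      refine Finset.sum_congr rfl fun c _ => ?_
      ring
    have hB : ∑ a, ∑ c : Fin N → α, q a * (∏ j, q (c j)) *
        (∑ i, if a = m i then (k i : R) *
          ∏ l, (((univ.filter fun j => c j = m l).card.descFactorial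
            (Function.update k i (k i - 1) l) : ℕ) : R) else 0) =
        ∑ i, (k i : R) * (q (m i) * ((N.descFactorial (∑ l, Function.update k i (k i - 1) l) : R) *
          (∏ l, q (m l) ^ Function.update k i (k i - 1) l) *
          (∑ a, q a) ^ (N - ∑ l, Function.update k i (k i - 1) l))) := by
      simp_rw [← ih, Finset.mul_sum]
      rw [Finset.sum_congr rfl fun a _ => Finset.sum_comm, Finset.sum_comm]
      refine Finset.sum_congr rfl fun i _ => ?_
      rw [Finset.sum_comm]
      refine Finset.sum_congr rfl fun c _ => ?_
      simp_rw [mul_ite, mul_zero]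
      rw [Finset.sum_ite_eq']
      simp only [mem_univ, if_true]
      ring
    rw [hA, hB]
    have hB2 : ∀ i, (k i : R) * (q (m i) *
          ((N.descFactorial (∑ l, Function.update k i (k i - 1) l) : R) *
          (∏ l, q (m l) ^ Function.update k i (k i - 1) l) *
          (∑ a, q a) ^ (N - ∑ l, Function.update k i (k i - 1) l))) =
        (k i : R) * ((N.descFactorial (∑ l, k l - 1) : R) * (∏ l, q (m l) ^ k l) *
          (∑ a, q a) ^ (N + 1 - ∑ l, k l)) := by
      intro i
      by_cases hi : k i = 0
      · simp [hi]
      · rw [← hprod i hi, ← hsum i hi, Nat.add_sub_cancel, Nat.add_sub_add_right]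
        ring
    rw [Finset.sum_congr rfl fun i _ => hB2 i, ← Finset.sum_mul, descFactorial_succ_left]
    push_cast
    rcases le_or_gt (∑ i, k i) N with h | h
    · rw [Nat.sub_add_comm h, pow_succ]
      ring
    · rw [Nat.descFactorial_of_lt h]
      push_cast
      ring

theorem card_filter_fiber_card_eq (n N : ℕ) (c : Fin N → ℕ) (hc : ∑ j, c j = n) :
    ((univ.filter fun f : Fin n → Fin N =>
        ∀ j, (univ.filter fun i => f i = j).card = c j).card) * ∏ j, (c j).factorial =
      n.factorial := by
  classical
  have h1 : (∑ j : Fin N, (MvPolynomial.X j : MvPolynomial (Fin N) ℕ)) ^ n =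
      ∑ f : Fin n → Fin N, MvPolynomial.monomial
        (Finsupp.equivFunOnFinite.symm fun j => (univ.filter fun i => f i = j).card) 1 := by
    rw [← Fin.prod_const, Finset.prod_univ_sum]
    simp only [Fintype.piFinset_univ]
    refine Finset.sum_congr rfl fun f _ => ?_
    rw [MvPolynomial.monomial_eq, Finsupp.prod_fintype _ _ (fun _ => pow_zero _)]
    simp only [map_one, one_mul, Finsupp.equivFunOnFinite_symm_apply_apply]
    rw [← Finset.prod_fiberwise univ f]
    refine Finset.prod_congr rfl fun j _ => ?_
    rw [Finset.prod_congr rfl (g := fun _ => MvPolynomial.X j), Finset.prod_const]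
    intro i hi
    rw [(Finset.mem_filter.1 hi).2]
  have h2 := congrArg (MvPolynomial.coeff (Finsupp.equivFunOnFinite.symm c)) h1
  rw [MvPolynomial.coeff_sum] at h2
  simp only [MvPolynomial.coeff_monomial, EmbeddingLike.apply_eq_iff_eq] at h2
  rw [← Finset.card_filter] at h2
  have h3 : MvPolynomial.coeff (Finsupp.equivFunOnFinite.symm c)
      ((∑ j : Fin N, (MvPolynomial.X j : MvPolynomial (Fin N) ℕ)) ^ n) =
      Nat.multinomial univ c := by
    rw [Finset.sum_pow_eq_sum_piAntidiag, Finset.sum_congr rfl (g := fun d =>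
      MvPolynomial.monomial (Finsupp.equivFunOnFinite.symm d) (Nat.multinomial univ d)),
      MvPolynomial.coeff_sum]
    · simp only [MvPolynomial.coeff_monomial, EmbeddingLike.apply_eq_iff_eq]
      rw [Finset.sum_ite_eq', if_pos (by simp [hc])]
    · intro d _
      rw [MvPolynomial.monomial_eq, Finsupp.prod_fintype _ _ (fun _ => pow_zero _)]
      simp
  rw [show (univ.filter fun f : Fin n → Fin N =>
        ∀ j, (univ.filter fun i => f i = j).card = c j) = univ.filter fun f : Fin n → Fin N =>
        (fun j => (univ.filter fun i => f i = j).card) = c from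
      Finset.filter_congr fun f _ => by rw [funext_iff], ← h2, h3, mul_comm,
    Nat.multinomial_spec, hc]

/-- The truncated exponential polynomial `∑_{j ≤ C} X^j / j!`. -/
noncomputable def truncExp (C : ℕ) : Polynomial ℝ :=
  ∑ j ∈ range (C + 1), Polynomial.monomial j ((j.factorial : ℝ)⁻¹)

theorem sum_fiber_card {n N : ℕ} (f : Fin n → Fin N) :
    ∑ j, (univ.filter fun i => f i = j).card = n := by
  rw [← Finset.card_eq_sum_card_fiberwise (f := f) (s := univ) (t := univ) (by simp)]
  simp

theorem sum_validPlacements_eq_coeff (n N C r : ℕ) (m : Fin r → ℕ) (hmC : ∀ i, m i ≤ C)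
    (hm : Function.Injective m) (k : Fin r → ℕ) :
    ∑ f ∈ validPlacements n N C, ∏ i, ((binCount f (m i)).descFactorial (k i) : ℝ) =
      n.factorial * (((N.descFactorial (∑ i, k i) : Polynomial ℝ) *
        (∏ i, Polynomial.monomial (m i) (((m i).factorial : ℝ)⁻¹) ^ k i) *
        truncExp C ^ (N - ∑ i, k i)).coeff n) := by
  classical
  let m' : Fin r → Fin (C + 1) := fun i => ⟨m i, Nat.lt_succ_of_le (hmC i)⟩
  have hm' : Function.Injective m' := fun i j h => hm (congrArg Fin.val h)
  let Φ : (Fin N → Fin (C + 1)) → ℝ := fun c =>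
    ∏ i, (((univ.filter fun j => c j = m' i).card.descFactorial (k i) : ℕ) : ℝ)
  have hG : truncExp C =
      ∑ a : Fin (C + 1), Polynomial.monomial (a : ℕ) (((a : ℕ).factorial : ℝ)⁻¹) := by
    rw [truncExp, Finset.sum_range]
  have hR := sum_prod_mul_prod_descFactorial
    (fun a : Fin (C + 1) => Polynomial.monomial (a : ℕ) (((a : ℕ).factorial : ℝ)⁻¹)) m' hm' N k
  rw [← hG] at hR
  rw [← hR]
  have hmon : ∀ (s : Finset (Fin N)) (c : Fin N → Fin (C + 1)),
      ∏ j ∈ s, Polynomial.monomial (c j : ℕ) (((c j : ℕ).factorial : ℝ)⁻¹) =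
      Polynomial.monomial (∑ j ∈ s, (c j : ℕ)) (∏ j ∈ s, ((c j : ℕ).factorial : ℝ)⁻¹) := by
    intro s c
    induction s using Finset.induction_on with
    | empty => simp
    | insert a s ha ih =>
      rw [Finset.prod_insert ha, ih, Polynomial.monomial_mul_monomial, Finset.sum_insert ha,
        Finset.prod_insert ha]
  rw [Polynomial.finsetSum_coeff]
  have hcoef : ∀ c : Fin N → Fin (C + 1),
      ((∏ j, Polynomial.monomial (c j : ℕ) (((c j : ℕ).factorial : ℝ)⁻¹)) *
        ∏ i, (((univ.filter fun j => c j = m' i).card.descFactorial (k i) : ℕ) :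
          Polynomial ℝ)).coeff n =
      if ∑ j, (c j : ℕ) = n then (∏ j, ((c j : ℕ).factorial : ℝ)⁻¹) * Φ c else 0 := by
    intro c
    have : (∏ i, (((univ.filter fun j => c j = m' i).card.descFactorial (k i) : ℕ) :
          Polynomial ℝ)) = Polynomial.C (Φ c) := by
      simp [Φ]
    rw [this, Polynomial.coeff_mul_C, hmon, Polynomial.coeff_monomial]
    split_ifs <;> simp
  rw [Finset.sum_congr rfl fun c _ => hcoef c]
  have hF : ∀ f : Fin n → Fin N,
      (if ∀ j, (univ.filter fun i => f i = j).card ≤ C then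
        ∏ i, ((binCount f (m i)).descFactorial (k i) : ℝ) else 0) =
      ∑ c : Fin N → Fin (C + 1),
        if ∀ j, (univ.filter fun i => f i = j).card = (c j : ℕ) then Φ c else 0 := by
    intro f
    split_ifs with h
    · let c₀ : Fin N → Fin (C + 1) := fun j => ⟨_, Nat.lt_succ_of_le (h j)⟩
      rw [Finset.sum_eq_single c₀]
      · rw [if_pos fun j => rfl]
        refine Finset.prod_congr rfl fun i _ => ?_
        have : binCount f (m i) = (univ.filter fun j => c₀ j = m' i).card := by
          unfold binCount
          congr 1
          refine Finset.filter_congr fun j _ => ?_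
          simp [c₀, m', Fin.ext_iff]
        rw [this]
      · intro c _ hc
        refine if_neg fun h' => hc ?_
        funext j
        exact Fin.ext (h' j).symm
      · simp
    · refine (Finset.sum_eq_zero fun c _ => if_neg fun h' => h fun j => ?_).symm
      rw [h' j]
      exact Nat.le_of_lt_succ (c j).2
  rw [validPlacements, Finset.sum_filter, Finset.sum_congr rfl fun f _ => hF f, Finset.sum_comm,
    Finset.mul_sum]
  refine Finset.sum_congr rfl fun c _ => ?_
  rw [← Finset.sum_filter, Finset.sum_const, nsmul_eq_mul]
  split_ifs with h
  · have h2 := card_filter_fiber_card_eq n N (fun j => (c j : ℕ)) h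
    have h3 : (∏ j, ((c j : ℕ).factorial : ℝ)) ≠ 0 :=
      Finset.prod_ne_zero_iff.2 fun j _ => by positivity
    rw [← h2]
    push_cast
    rw [Finset.prod_inv_distrib]
    field_simp
  · rw [Finset.filter_false_of_mem]
    · simp
    · intro f _ hf
      exact h (by rw [← sum_fiber_card f]; exact Finset.sum_congr rfl fun j _ => (hf j).symm)

/-- Exact formula for the joint factorial moments in the allocation model. -/
theorem factorialMoment_eq (n N C r : ℕ) (m : Fin r → ℕ) (hmC : ∀ i, m i ≤ C)
    (hm : Function.Injective m) (k : Fin r → ℕ) (hM : ∑ i, k i * m i ≤ n) :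
    (∑ f ∈ validPlacements n N C, ∏ i, ((binCount f (m i)).descFactorial (k i) : ℝ)) /
        ((validPlacements n N C).card : ℝ) =
      N.descFactorial (∑ i, k i) * (∏ i, (((m i).factorial : ℝ)⁻¹) ^ k i) *
        ((truncExp C ^ (N - ∑ i, k i)).coeff (n - ∑ i, k i * m i) /
          (truncExp C ^ N).coeff n) := by
  have hmon : (∏ i, Polynomial.monomial (m i) (((m i).factorial : ℝ)⁻¹) ^ k i) =
      Polynomial.monomial (∑ i, k i * m i) (∏ i, (((m i).factorial : ℝ)⁻¹) ^ k i) := by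
    simp only [Polynomial.monomial_pow]
    induction (univ : Finset (Fin r)) using Finset.induction_on with
    | empty => simp
    | insert a s ha ih =>
      rw [Finset.prod_insert ha, ih, Polynomial.monomial_mul_monomial, Finset.sum_insert ha,
        Finset.prod_insert ha, mul_comm (m a)]
  have h0 := sum_validPlacements_eq_coeff n N C 0 Fin.elim0 (fun i => i.elim0)
    (fun i => i.elim0) Fin.elim0
  simp only [univ_eq_empty, prod_empty, sum_empty, sum_const, Nat.descFactorial_zero,
    Nat.cast_one, one_mul, Nat.sub_zero, nsmul_eq_mul, mul_one] at h0
  have hn : (n.factorial : ℝ) ≠ 0 := by positivity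
  rw [sum_validPlacements_eq_coeff n N C r m hmC hm k, h0, mul_div_mul_left _ _ hn, hmon,
    mul_assoc, ← Polynomial.C_eq_natCast, Polynomial.coeff_C_mul, 
    ← Polynomial.C_mul_X_pow_eq_monomial, mul_assoc, Polynomial.coeff_C_mul, mul_comm (_ ^ _),
    Polynomial.coeff_mul_X_pow', if_pos hM]
  ring

theorem integral_exp_int_mul_I (k : ℤ) :
    ∫ t in (-Real.pi)..Real.pi, Complex.exp (k * t * Complex.I) =
      if k = 0 then (2 * Real.pi : ℂ) else 0 := by
  split_ifs with h
  · subst h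
    simp
    ring
  · have hc : ((k : ℂ) * Complex.I) ≠ 0 := mul_ne_zero (by exact_mod_cast h) Complex.I_ne_zero
    have h1 : ∀ t : ℝ, Complex.exp (k * t * Complex.I) = Complex.exp (((k : ℂ) * Complex.I) * t) :=
      fun t => by ring_nf
    simp_rw [h1]
    rw [integral_exp_mul_complex hc, div_eq_zero_iff]
    left
    rw [sub_eq_zero, Complex.exp_eq_exp_iff_exists_int]
    exact ⟨k, by push_cast; ring⟩

theorem coeff_eq_integral (Q : Polynomial ℝ) (n : ℕ) :
    (Q.coeff n : ℂ) = (2 * Real.pi : ℂ)⁻¹ * ∫ t in (-Real.pi)..Real.pi,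
      Polynomial.aeval (Complex.exp (t * Complex.I)) Q * Complex.exp (-(n * t * Complex.I)) := by
  have hpi : (2 * Real.pi : ℂ) ≠ 0 := by
    exact_mod_cast Real.two_pi_pos.ne'
  have hcont : ∀ Q : Polynomial ℝ, Continuous fun t : ℝ =>
      Polynomial.aeval (Complex.exp (t * Complex.I)) Q * Complex.exp (-(n * t * Complex.I)) := by
    intro Q
    refine Continuous.mul ?_ (by fun_prop)
    exact Q.continuous_aeval.comp (by fun_prop)
  induction Q using Polynomial.induction_on' with
  | add p q hp hq =>
    simp only [Polynomial.coeff_add, Complex.ofReal_add, map_add, add_mul]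
    rw [intervalIntegral.integral_add ((hcont p).intervalIntegrable _ _)
      ((hcont q).intervalIntegrable _ _), mul_add, ← hp, ← hq]
  | monomial j a =>
    have h1 : ∀ t : ℝ, Polynomial.aeval (Complex.exp (t * Complex.I)) (Polynomial.monomial j a) *
        Complex.exp (-(n * t * Complex.I)) =
        a * Complex.exp ((((j : ℤ) - n : ℤ) : ℂ) * t * Complex.I) := by
      intro t
      rw [Polynomial.aeval_monomial, ← Complex.exp_nat_mul, mul_assoc, ← Complex.exp_add]
      push_cast
      simp only [Complex.coe_algebraMap]
      ring_nf
    simp_rw [h1]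
    rw [intervalIntegral.integral_const_mul, integral_exp_int_mul_I, Polynomial.coeff_monomial]
    by_cases h : j = n
    · subst h
      simp
      field_simp
    · rw [if_neg h, if_neg (by omega)]
      simp

theorem norm_charFun_le {p : ℕ → ℝ} {C : ℕ} (hC : 1 ≤ C) (hp : ∀ j, 0 ≤ p j)
    (hsum : ∑ j ∈ range (C + 1), p j = 1) {t : ℝ} (ht : |t| ≤ Real.pi) :
    ‖∑ j ∈ range (C + 1), (p j : ℂ) * Complex.exp (j * t * Complex.I)‖ ≤
      Real.exp (-(2 / Real.pi ^ 2) * (p C * p (C - 1)) * t ^ 2) := by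
  obtain ⟨D, rfl⟩ : ∃ D, C = D + 1 := ⟨C - 1, by omega⟩
  rw [Nat.add_sub_cancel]
  rw [Finset.sum_range_succ, Finset.sum_range_succ] at hsum ⊢
  set q := p D with hq
  set q' := p (D + 1) with hq'
  have hrest : ‖∑ j ∈ range D, (p j : ℂ) * Complex.exp (j * t * Complex.I)‖ ≤
      ∑ j ∈ range D, p j := by
    refine (norm_sum_le _ _).trans (Finset.sum_le_sum fun j _ => ?_)
    rw [norm_mul, Complex.norm_real, Real.norm_of_nonneg (hp j)]
    have : ‖Complex.exp (j * t * Complex.I)‖ = 1 := by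
      rw [show ((j : ℂ) * t * Complex.I) = ((j * t : ℝ) : ℂ) * Complex.I by push_cast; ring]
      exact Complex.norm_exp_ofReal_mul_I _
    rw [this, mul_one]
  have hrest0 : 0 ≤ ∑ j ∈ range D, p j := Finset.sum_nonneg fun j _ => hp j
  have hq0 : 0 ≤ q := hp D
  have hq0' : 0 ≤ q' := hp (D + 1)
  have hpair : ‖(q : ℂ) * Complex.exp (D * t * Complex.I) +
      q' * Complex.exp ((D + 1 : ℕ) * t * Complex.I)‖ ≤ q + q' - q' * q * (1 - Real.cos t) := by
    have e1 : (q : ℂ) * Complex.exp (D * t * Complex.I) +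
        q' * Complex.exp ((D + 1 : ℕ) * t * Complex.I) =
        Complex.exp ((D * t : ℝ) * Complex.I) * (q + q' * Complex.exp (t * Complex.I)) := by
      rw [mul_add, mul_left_comm _ (q' : ℂ), ← Complex.exp_add]
      push_cast
      ring_nf
    rw [e1, norm_mul, Complex.norm_exp_ofReal_mul_I, one_mul]
    have hcos := Real.neg_one_le_cos t
    have hcos1 := Real.cos_le_one t
    have hle1 : q + q' ≤ 1 := by linarith
    have hnn : 0 ≤ q + q' - q' * q * (1 - Real.cos t) := by
      nlinarith [mul_nonneg hq0 hq0', sq_nonneg (q - q')]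
    refine le_of_sq_le_sq ?_ hnn
    rw [← Complex.normSq_eq_norm_sq, Complex.normSq_apply, Complex.exp_mul_I]
    simp [← Complex.ofReal_cos, ← Complex.ofReal_sin]
    have hsc := Real.sin_sq_add_cos_sq t
    have : 0 ≤ q' * q * (1 - Real.cos t) :=
      mul_nonneg (mul_nonneg hq0' hq0) (by linarith)
    have e2 : (q + q' * Real.cos t) * (q + q' * Real.cos t) +
        q' * Real.sin t * (q' * Real.sin t) = (q + q') ^ 2 - 2 * (q' * q * (1 - Real.cos t)) := by
      linear_combination q' ^ 2 * hsc
    rw [e2]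
    nlinarith [mul_nonneg this (by linarith : 0 ≤ 1 - (q + q')), sq_nonneg (q' * q * (1 - Real.cos t))]
  have hcosb := Real.cos_le_one_sub_mul_cos_sq ht
  calc _ ≤ (∑ j ∈ range D, p j) + (q + q' - q' * q * (1 - Real.cos t)) := by
        rw [add_assoc]
        exact (norm_add_le _ _).trans (add_le_add hrest hpair)
    _ = 1 - q' * q * (1 - Real.cos t) := by linarith
    _ ≤ 1 + (-(2 / Real.pi ^ 2) * (q' * q) * t ^ 2) := by
        nlinarith [mul_nonneg hq0' hq0]
    _ ≤ _ := by
        have := Real.add_one_le_exp (-(2 / Real.pi ^ 2) * (q' * q) * t ^ 2)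
        linarith

theorem abs_sub_mean_le {p : ℕ → ℝ} {C : ℕ} (hp : ∀ j, 0 ≤ p j)
    (hsum : ∑ j ∈ range (C + 1), p j = 1) {j : ℕ} (hj : j ∈ range (C + 1)) :
    |(j : ℝ) - ∑ j ∈ range (C + 1), (j : ℝ) * p j| ≤ C := by
  have h0 : 0 ≤ ∑ j ∈ range (C + 1), (j : ℝ) * p j :=
    Finset.sum_nonneg fun j _ => mul_nonneg (Nat.cast_nonneg _) (hp j)
  have h1 : ∑ j ∈ range (C + 1), (j : ℝ) * p j ≤ C := by
    calc _ ≤ ∑ j ∈ range (C + 1), (C : ℝ) * p j := by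
          refine Finset.sum_le_sum fun i hi => mul_le_mul_of_nonneg_right ?_ (hp i)
          exact_mod_cast Nat.le_of_lt_succ (Finset.mem_range.1 hi)
      _ = C := by rw [← Finset.mul_sum, hsum, mul_one]
  have h2 : (j : ℝ) ≤ C := by exact_mod_cast Nat.le_of_lt_succ (Finset.mem_range.1 hj)
  have h3 : (0 : ℝ) ≤ j := Nat.cast_nonneg _
  rw [abs_le]
  constructor <;> linarith

theorem var_le {p : ℕ → ℝ} {C : ℕ} (hp : ∀ j, 0 ≤ p j)
    (hsum : ∑ j ∈ range (C + 1), p j = 1) {μ v : ℝ} (hμ : μ = ∑ j ∈ range (C + 1), (j : ℝ) * p j)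
    (hv : v = ∑ j ∈ range (C + 1), p j * ((j : ℝ) - μ) ^ 2) : v ≤ C ^ 2 := by
  rw [hv]
  calc _ ≤ ∑ j ∈ range (C + 1), p j * (C : ℝ) ^ 2 := by
        refine Finset.sum_le_sum fun j hj => mul_le_mul_of_nonneg_left ?_ (hp j)
        have := abs_sub_mean_le hp hsum hj
        rw [← hμ] at this
        exact sq_le_sq' (by linarith [(abs_le.1 this).1]) (abs_le.1 this).2
    _ = _ := by rw [← Finset.sum_mul, hsum, one_mul]

theorem norm_centered_charFun_sub_le {p : ℕ → ℝ} {C : ℕ} (hp : ∀ j, 0 ≤ p j)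
    (hsum : ∑ j ∈ range (C + 1), p j = 1) {μ v : ℝ} (hμ : μ = ∑ j ∈ range (C + 1), (j : ℝ) * p j)
    (hv : v = ∑ j ∈ range (C + 1), p j * ((j : ℝ) - μ) ^ 2) {t : ℝ} (ht : C * |t| ≤ 1) :
    ‖(∑ j ∈ range (C + 1), (p j : ℂ) * Complex.exp (j * t * Complex.I)) *
        Complex.exp (-(μ * t * Complex.I)) - (Real.exp (-(v * t ^ 2 / 2)) : ℂ)‖ ≤
      v * C * |t| ^ 3 + v ^ 2 * t ^ 4 := by
  have hv0 : 0 ≤ v := by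
    rw [hv]; exact Finset.sum_nonneg fun j _ => mul_nonneg (hp j) (sq_nonneg _)
  have hvC : v ≤ C ^ 2 := var_le hp hsum hμ hv
  have hcen : ∑ j ∈ range (C + 1), p j * ((j : ℝ) - μ) = 0 := by
    simp_rw [mul_sub]
    rw [Finset.sum_sub_distrib, ← Finset.sum_mul, hsum, hμ]
    simp [mul_comm]
  have hlhs : (∑ j ∈ range (C + 1), (p j : ℂ) * Complex.exp (j * t * Complex.I)) *
        Complex.exp (-(μ * t * Complex.I)) - ((1 - v * t ^ 2 / 2 : ℝ) : ℂ) =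
      ∑ j ∈ range (C + 1), (p j : ℂ) * (Complex.exp ((((j : ℝ) - μ) * t : ℝ) * Complex.I) -
        ∑ i ∈ range 3, ((((j : ℝ) - μ) * t : ℝ) * Complex.I) ^ i / (i.factorial : ℂ)) := by
    have e : ∀ j : ℕ, (p j : ℂ) * (Complex.exp ((((j : ℝ) - μ) * t : ℝ) * Complex.I) -
        ∑ i ∈ range 3, ((((j : ℝ) - μ) * t : ℝ) * Complex.I) ^ i / (i.factorial : ℂ)) =
        (p j : ℂ) * Complex.exp (j * t * Complex.I) * Complex.exp (-(μ * t * Complex.I)) -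
        (p j : ℂ) - ((p j * ((j : ℝ) - μ) : ℝ) : ℂ) * (t * Complex.I) +
        ((p j * ((j : ℝ) - μ) ^ 2 : ℝ) : ℂ) * ((t : ℂ) ^ 2 / 2) := by
      intro j
      rw [mul_assoc (p j : ℂ), ← Complex.exp_add]
      simp only [Finset.sum_range_succ, Finset.sum_range_zero, Nat.factorial]
      push_cast
      rw [mul_pow _ Complex.I 2, Complex.I_sq]
      ring_nf
    simp_rw [e]
    rw [Finset.sum_add_distrib, Finset.sum_sub_distrib, Finset.sum_sub_distrib, ← Finset.sum_mul,
      ← Finset.sum_mul, ← Finset.sum_mul, ← Complex.ofReal_sum, ← Complex.ofReal_sum,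
      ← Complex.ofReal_sum, hcen, hsum, ← hv]
    push_cast
    ring
  have h1 : ‖(∑ j ∈ range (C + 1), (p j : ℂ) * Complex.exp (j * t * Complex.I)) *
        Complex.exp (-(μ * t * Complex.I)) - ((1 - v * t ^ 2 / 2 : ℝ) : ℂ)‖ ≤ v * C * |t| ^ 3 := by
    rw [hlhs, hv, Finset.sum_mul, Finset.sum_mul]
    refine (norm_sum_le _ _).trans (Finset.sum_le_sum fun j hj => ?_)
    have hj1 := abs_sub_mean_le hp hsum hj
    rw [← hμ] at hj1
    have hn : ‖((((j : ℝ) - μ) * t : ℝ) : ℂ) * Complex.I‖ = |(j : ℝ) - μ| * |t| := by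
      rw [norm_mul, Complex.norm_I, mul_one, Complex.norm_real, Real.norm_eq_abs, abs_mul]
    have hb : ‖((((j : ℝ) - μ) * t : ℝ) : ℂ) * Complex.I‖ ≤ 1 := by
      rw [hn]
      exact (mul_le_mul_of_nonneg_right hj1 (abs_nonneg t)).trans ht
    have := Complex.exp_bound hb (n := 3) (by norm_num)
    rw [norm_mul, Complex.norm_real, Real.norm_of_nonneg (hp j), mul_assoc, mul_assoc]
    refine mul_le_mul_of_nonneg_left (this.trans ?_) (hp j)
    rw [hn]
    norm_num [Nat.factorial]
    rw [← sq_abs ((j : ℝ) - μ)]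
    have ha := abs_nonneg ((j : ℝ) - μ)
    have h3 : 0 ≤ |(j : ℝ) - μ| ^ 2 * |t| ^ 3 := by positivity
    have h4 : |(j : ℝ) - μ| ^ 2 * |t| ^ 3 * |(j : ℝ) - μ| ≤ |(j : ℝ) - μ| ^ 2 * |t| ^ 3 * C :=
      mul_le_mul_of_nonneg_left hj1 h3
    have h5 : 0 ≤ |(j : ℝ) - μ| ^ 2 * |t| ^ 3 * |(j : ℝ) - μ| := by positivity
    nlinarith
  have h2 : ‖((1 - v * t ^ 2 / 2 : ℝ) : ℂ) - (Real.exp (-(v * t ^ 2 / 2)) : ℂ)‖ ≤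
      v ^ 2 * t ^ 4 := by
    rw [← Complex.ofReal_sub, Complex.norm_real, Real.norm_eq_abs]
    have hy0 : 0 ≤ v * t ^ 2 := by positivity
    have hy : v * t ^ 2 ≤ 1 := by
      calc v * t ^ 2 ≤ C ^ 2 * t ^ 2 := mul_le_mul_of_nonneg_right hvC (sq_nonneg _)
        _ = (C * |t|) ^ 2 := by rw [mul_pow, sq_abs]
        _ ≤ 1 := pow_le_one₀ (by positivity) ht
    have := Real.abs_exp_sub_one_sub_id_le (x := -(v * t ^ 2 / 2))
      (by rw [abs_neg, abs_of_nonneg (by positivity)]; linarith)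
    rw [abs_sub_comm]
    refine le_trans (le_of_eq ?_) (this.trans ?_)
    · congr 1; ring
    · nlinarith [sq_nonneg (v * t ^ 2)]
  calc _ = ‖((∑ j ∈ range (C + 1), (p j : ℂ) * Complex.exp (j * t * Complex.I)) *
        Complex.exp (-(μ * t * Complex.I)) - ((1 - v * t ^ 2 / 2 : ℝ) : ℂ)) +
        (((1 - v * t ^ 2 / 2 : ℝ) : ℂ) - (Real.exp (-(v * t ^ 2 / 2)) : ℂ))‖ := by
        rw [sub_add_sub_cancel]
    _ ≤ _ := (norm_add_le _ _).trans (add_le_add h1 h2)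

theorem norm_pow_sub_pow_le {a b : ℂ} (ha : ‖a‖ ≤ 1) (hb : ‖b‖ ≤ 1) (n : ℕ) :
    ‖a ^ n - b ^ n‖ ≤ n * ‖a - b‖ := by
  induction n with
  | zero => simp
  | succ n ih =>
    have : a ^ (n + 1) - b ^ (n + 1) = a ^ n * (a - b) + (a ^ n - b ^ n) * b := by ring
    rw [this]
    calc _ ≤ ‖a ^ n‖ * ‖a - b‖ + ‖a ^ n - b ^ n‖ * ‖b‖ := by
          rw [← norm_mul, ← norm_mul]; exact norm_add_le _ _
      _ ≤ 1 * ‖a - b‖ + (n * ‖a - b‖) * 1 := by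
          gcongr
          rw [norm_pow]; exact pow_le_one₀ (norm_nonneg _) ha
      _ = _ := by push_cast; ring

theorem norm_charFun_le_one {p : ℕ → ℝ} {C : ℕ} (hp : ∀ j, 0 ≤ p j)
    (hsum : ∑ j ∈ range (C + 1), p j = 1) (t : ℝ) :
    ‖∑ j ∈ range (C + 1), (p j : ℂ) * Complex.exp (j * t * Complex.I)‖ ≤ 1 := by
  rw [← hsum]
  refine (norm_sum_le _ _).trans (Finset.sum_le_sum fun j _ => ?_)
  rw [norm_mul, Complex.norm_real, Real.norm_of_nonneg (hp j),
    show ((j : ℂ) * t * Complex.I) = ((j * t : ℝ) : ℂ) * Complex.I by push_cast; ring,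
    Complex.norm_exp_ofReal_mul_I, mul_one]

/-- Pointwise convergence of the normalized characteristic functions. -/
theorem tendsto_charFun_pow {C : ℕ} {p : ℕ → ℕ → ℝ} {N n : ℕ → ℕ} {μ v : ℕ → ℝ}
    (hp : ∀ ν j, 0 ≤ p ν j) (hsum : ∀ ν, ∑ j ∈ range (C + 1), p ν j = 1)
    (hμ : ∀ ν, μ ν = ∑ j ∈ range (C + 1), (j : ℝ) * p ν j)
    (hv : ∀ ν, v ν = ∑ j ∈ range (C + 1), p ν j * ((j : ℝ) - μ ν) ^ 2)
    (hS : Tendsto (fun ν => √(N ν * v ν)) atTop atTop)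
    (hd : Tendsto (fun ν => ((n ν : ℝ) - N ν * μ ν) / √(N ν * v ν)) atTop (nhds 0)) (u : ℝ) :
    Tendsto (fun ν => (∑ j ∈ range (C + 1), (p ν j : ℂ) *
        Complex.exp (j * (u / √(N ν * v ν) : ℝ) * Complex.I)) ^ N ν *
        Complex.exp (-(n ν * (u / √(N ν * v ν) : ℝ) * Complex.I)))
      atTop (nhds (Real.exp (-(1 / 2) * u ^ 2) : ℂ)) := by
  set s : ℕ → ℝ := fun ν => √(N ν * v ν) with hs
  set ψ : ℕ → ℂ := fun ν => ∑ j ∈ range (C + 1), (p ν j : ℂ) *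
        Complex.exp (j * (u / s ν : ℝ) * Complex.I) with hψ
  have hv0 : ∀ ν, 0 ≤ v ν := fun ν => by
    rw [hv]; exact Finset.sum_nonneg fun j _ => mul_nonneg (hp ν j) (sq_nonneg _)
  have hsq : ∀ ν, s ν ^ 2 = N ν * v ν := fun ν =>
    Real.sq_sqrt (mul_nonneg (Nat.cast_nonneg _) (hv0 ν))
  have hinv : Tendsto (fun ν => (s ν)⁻¹) atTop (nhds 0) := tendsto_inv_atTop_zero.comp hS
  have hus : Tendsto (fun ν => u / s ν) atTop (nhds 0) := by
    simpa [div_eq_mul_inv] using hinv.const_mul u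
  have h1 : Tendsto (fun ν => Complex.exp (-((((n ν : ℝ) - N ν * μ ν) / s ν * u : ℝ) : ℂ) *
      Complex.I)) atTop (nhds 1) := by
    have : Tendsto (fun ν => (((n ν : ℝ) - N ν * μ ν) / s ν * u : ℝ)) atTop (nhds 0) := by
      have := hd.mul_const u
      rwa [zero_mul] at this
    have h2 := (Complex.continuous_exp.comp (f := fun x : ℝ => -(x : ℂ) * Complex.I)
      (by fun_prop)).tendsto 0
    simp only [Function.comp_apply, Complex.ofReal_zero, neg_zero, zero_mul, Complex.exp_zero] at h2
    exact h2.comp this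
  have h3 : Tendsto (fun ν => (ψ ν * Complex.exp (-(μ ν * (u / s ν : ℝ) * Complex.I))) ^ N ν)
      atTop (nhds (Real.exp (-(1 / 2) * u ^ 2) : ℂ)) := by
    rw [tendsto_iff_norm_sub_tendsto_zero]
    have hbound : Tendsto (fun ν => C * |u| ^ 3 * (s ν)⁻¹ + C ^ 2 * u ^ 4 * ((s ν)⁻¹ * (s ν)⁻¹))
        atTop (nhds 0) := by
      simpa using (hinv.const_mul (C * |u| ^ 3)).add ((hinv.mul hinv).const_mul (C ^ 2 * u ^ 4))
    refine squeeze_zero' (Eventually.of_forall fun _ => norm_nonneg _) ?_ hbound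
    have hsmall : ∀ᶠ ν in atTop, C * |u / s ν| < 1 := by
      have : Tendsto (fun ν => C * |u / s ν|) atTop (nhds 0) := by
        simpa using (hus.abs).const_mul (C : ℝ)
      exact this.eventually_lt_const one_pos
    filter_upwards [hsmall, hS.eventually_gt_atTop 0] with ν hν hspos
    have hspos' : 0 < s ν := hspos
    have hmain := norm_centered_charFun_sub_le (hp ν) (hsum ν) (hμ ν) (hv ν) hν.le
    have hexp : (Real.exp (-(1 / 2) * u ^ 2) : ℂ) =
        (Real.exp (-(v ν * (u / s ν) ^ 2 / 2)) : ℂ) ^ N ν := by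
      rw [← Complex.ofReal_pow, ← Real.exp_nat_mul]
      congr 2
      have : (N ν : ℝ) * v ν / s ν ^ 2 = 1 := by
        rw [hsq, div_self]; rw [← hsq]; positivity
      rw [div_pow]
      linear_combination (1 / 2 * u ^ 2) * this
    rw [hexp]
    refine (norm_pow_sub_pow_le ?_ ?_ _).trans ?_
    · rw [norm_mul, show -((μ ν : ℂ) * (u / s ν : ℝ) * Complex.I) =
        ((-(μ ν * (u / s ν)) : ℝ) : ℂ) * Complex.I by push_cast; ring,
        Complex.norm_exp_ofReal_mul_I, mul_one]
      exact norm_charFun_le_one (hp ν) (hsum ν) _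
    · rw [Complex.norm_real, Real.norm_of_nonneg (Real.exp_pos _).le, Real.exp_le_one_iff]
      have := mul_nonneg (hv0 ν) (sq_nonneg (u / s ν))
      linarith
    · refine (mul_le_mul_of_nonneg_left hmain (Nat.cast_nonneg _)).trans ?_
      have hvC : v ν ≤ C ^ 2 := var_le (hp ν) (hsum ν) (hμ ν) (hv ν)
      have e1 : (N ν : ℝ) * (v ν * C * |u / s ν| ^ 3 + v ν ^ 2 * (u / s ν) ^ 4) =
          C * |u| ^ 3 * (s ν)⁻¹ + v ν * u ^ 4 * ((s ν)⁻¹ * (s ν)⁻¹) := by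
        have : (N ν : ℝ) * v ν = s ν ^ 2 := (hsq ν).symm
        rw [abs_div, abs_of_pos hspos']
        calc _ = ((N ν : ℝ) * v ν) * (C * (|u| / s ν) ^ 3 + v ν * (u / s ν) ^ 4) := by ring
          _ = _ := by rw [this]; field_simp
      rw [e1]
      gcongr
  have h4 := h3.mul h1
  rw [mul_one] at h4
  refine h4.congr fun ν => ?_
  rw [mul_pow, mul_assoc, ← Complex.exp_nat_mul, ← Complex.exp_add]
  congr 2
  push_cast
  ring

/-- A local limit theorem for sums of bounded lattice variables in a triangular array. -/
theorem tendsto_sqrt_mul_coeff {C : ℕ} (hC : 1 ≤ C) {p : ℕ → ℕ → ℝ} {N n : ℕ → ℕ} {μ v : ℕ → ℝ}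
    {c : ℝ} (hc : 0 < c)
    (hp : ∀ ν j, 0 ≤ p ν j) (hsum : ∀ ν, ∑ j ∈ range (C + 1), p ν j = 1)
    (hμ : ∀ ν, μ ν = ∑ j ∈ range (C + 1), (j : ℝ) * p ν j)
    (hv : ∀ ν, v ν = ∑ j ∈ range (C + 1), p ν j * ((j : ℝ) - μ ν) ^ 2)
    (hcv : ∀ᶠ ν in atTop, c * v ν ≤ p ν C * p ν (C - 1))
    (hS : Tendsto (fun ν => N ν * v ν) atTop atTop)
    (hd : Tendsto (fun ν => ((n ν : ℝ) - N ν * μ ν) / √(N ν * v ν)) atTop (nhds 0)) :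
    Tendsto (fun ν => √(N ν * v ν) *
        ((∑ j ∈ range (C + 1), Polynomial.monomial j (p ν j)) ^ N ν).coeff (n ν))
      atTop (nhds ((2 * Real.pi)⁻¹ * √(2 * Real.pi))) := by
  have hS' : Tendsto (fun ν => √(N ν * v ν)) atTop atTop := Real.tendsto_sqrt_atTop.comp hS
  have hpt := tendsto_charFun_pow hp hsum hμ hv hS' hd
  have hv0 : ∀ ν, 0 ≤ v ν := fun ν => by
    rw [hv]; exact Finset.sum_nonneg fun j _ => mul_nonneg (hp ν j) (sq_nonneg _)
  set s : ℕ → ℝ := fun ν => √(N ν * v ν) with hs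
  have hsq : ∀ ν, s ν ^ 2 = N ν * v ν := fun ν =>
    Real.sq_sqrt (mul_nonneg (Nat.cast_nonneg _) (hv0 ν))
  set f : ℕ → ℝ → ℂ := fun ν t => (∑ j ∈ range (C + 1), (p ν j : ℂ) *
        Complex.exp (j * (t : ℝ) * Complex.I)) ^ N ν *
        Complex.exp (-(n ν * (t : ℝ) * Complex.I)) with hf
  have hfc : ∀ ν, Continuous (f ν) := fun ν => by
    simp only [hf]; fun_prop
  set F : ℕ → ℝ → ℂ := fun ν => (Set.Ioc (-Real.pi * s ν) (Real.pi * s ν)).indicator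
    (fun u => f ν (u / s ν)) with hF
  have hcoef : ∀ᶠ ν in atTop, ((s ν * ((∑ j ∈ range (C + 1),
      Polynomial.monomial j (p ν j)) ^ N ν).coeff (n ν) : ℝ) : ℂ) =
      (2 * Real.pi : ℂ)⁻¹ * ∫ u, F ν u := by
    filter_upwards [hS'.eventually_gt_atTop 0] with ν hspos
    have hspos' : 0 < s ν := hspos
    have hle : -Real.pi * s ν ≤ Real.pi * s ν := by
      nlinarith [Real.pi_pos]
    rw [MeasureTheory.integral_indicator measurableSet_Ioc,
      ← intervalIntegral.integral_of_le hle, intervalIntegral.integral_comp_div (f ν) hspos'.ne',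
      mul_div_cancel_right₀ _ hspos'.ne', mul_div_cancel_right₀ _ hspos'.ne']
    push_cast
    rw [coeff_eq_integral, Complex.real_smul, mul_left_comm]
    congr 3
    funext t
    simp only [hf, map_pow, map_sum, Polynomial.aeval_monomial, Complex.coe_algebraMap,
      ← Complex.exp_nat_mul, mul_assoc]
  have hlim : Tendsto (fun ν => ∫ u, F ν u) atTop
      (nhds (∫ u : ℝ, (Real.exp (-(1 / 2) * u ^ 2) : ℂ))) := by
    refine MeasureTheory.tendsto_integral_filter_of_dominated_convergence
      (fun u => Real.exp (-(2 / Real.pi ^ 2 * c) * u ^ 2)) ?_ ?_ ?_ ?_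
    · refine Eventually.of_forall fun ν => ?_
      refine (Measurable.indicator ?_ measurableSet_Ioc).aestronglyMeasurable
      exact ((hfc ν).comp (continuous_id.div_const _)).measurable
    · filter_upwards [hcv, hS'.eventually_gt_atTop 0] with ν hcν hspos
      have hspos' : 0 < s ν := hspos
      refine Eventually.of_forall fun u => ?_
      simp only [hF]
      by_cases hu : u ∈ Set.Ioc (-Real.pi * s ν) (Real.pi * s ν)
      · rw [Set.indicator_of_mem hu]
        have hu' : |u / s ν| ≤ Real.pi := by
          rw [abs_div, abs_of_pos hspos', div_le_iff₀ hspos', abs_le]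
          exact ⟨by linarith [hu.1], hu.2⟩
        simp only [hf]
        rw [norm_mul, norm_pow, show -((n ν : ℂ) * (u / s ν : ℝ) * Complex.I) =
          ((-(n ν * (u / s ν)) : ℝ) : ℂ) * Complex.I by push_cast; ring,
          Complex.norm_exp_ofReal_mul_I, mul_one]
        refine (pow_le_pow_left₀ (norm_nonneg _)
          (norm_charFun_le hC (hp ν) (hsum ν) hu') _).trans ?_
        rw [← Real.exp_nat_mul, Real.exp_le_exp]
        have h1 : (N ν : ℝ) * v ν / s ν ^ 2 = 1 := by
          rw [hsq, div_self]; rw [← hsq]; positivity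
        calc (N ν : ℝ) * (-(2 / Real.pi ^ 2) * (p ν C * p ν (C - 1)) * (u / s ν) ^ 2)
            = -((2 / Real.pi ^ 2 * N ν * (u / s ν) ^ 2) * (p ν C * p ν (C - 1))) := by ring
          _ ≤ -((2 / Real.pi ^ 2 * N ν * (u / s ν) ^ 2) * (c * v ν)) := by
              gcongr
          _ = -(2 / Real.pi ^ 2 * c) * u ^ 2 * (N ν * v ν / s ν ^ 2) := by
              rw [div_pow]; ring
          _ = _ := by rw [h1, mul_one]
      · rw [Set.indicator_of_notMem hu, norm_zero]
        exact (Real.exp_pos _).le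
    · exact integrable_exp_neg_mul_sq (by have := Real.pi_pos; positivity)
    · refine Eventually.of_forall fun u => ?_
      refine (hpt u).congr' ?_
      have h1 : Tendsto (fun ν => Real.pi * s ν) atTop atTop :=
        hS'.const_mul_atTop Real.pi_pos
      filter_upwards [h1.eventually_gt_atTop |u|] with ν hν
      have := abs_lt.1 hν
      simp only [hF]
      rw [Set.indicator_of_mem]
      exact ⟨by linarith [this.1], this.2.le⟩
  have hG : ∫ u : ℝ, (Real.exp (-(1 / 2) * u ^ 2) : ℂ) = ((√(2 * Real.pi) : ℝ) : ℂ) := by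
    rw [integral_complex_ofReal, integral_gaussian]
    congr 2
    field_simp
  rw [hG] at hlim
  have h5 := (hlim.const_mul ((2 * Real.pi : ℂ)⁻¹)).congr' (hcoef.mono fun ν h => h.symm)
  have h6 := (Complex.continuous_re.tendsto _).comp h5
  have e : ((2 * Real.pi : ℂ)⁻¹ * ((√(2 * Real.pi) : ℝ) : ℂ)).re =
      (2 * Real.pi)⁻¹ * √(2 * Real.pi) := by
    rw [← Complex.ofReal_re ((2 * Real.pi)⁻¹ * √(2 * Real.pi))]
    push_cast
    rfl
  rw [e] at h6
  exact h6

/-- Moment expansions under a small exponential tilt of a bounded distribution. -/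
theorem tilt_bounds {p : ℕ → ℝ} {C : ℕ} (hp : ∀ j, 0 ≤ p j)
    (hsum : ∑ j ∈ range (C + 1), p j = 1) {μ v δ R : ℝ}
    (hμ : μ = ∑ j ∈ range (C + 1), (j : ℝ) * p j)
    (hv : v = ∑ j ∈ range (C + 1), p j * ((j : ℝ) - μ) ^ 2) (hδ : C * |δ| ≤ 1)
    (hR : R = ∑ j ∈ range (C + 1), p j * Real.exp (δ * ((j : ℝ) - μ))) :
    1 ≤ R ∧ |Real.log R - v * δ ^ 2 / 2| ≤ 5 * v * C * |δ| ^ 3 ∧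
    |(∑ j ∈ range (C + 1), (j : ℝ) * (p j * Real.exp (δ * ((j : ℝ) - μ)) / R)) - μ - v * δ| ≤
      3 * v * C * |δ| ^ 2 ∧
    |(∑ j ∈ range (C + 1), (j : ℝ) ^ 2 * (p j * Real.exp (δ * ((j : ℝ) - μ)) / R)) -
      (∑ j ∈ range (C + 1), (j : ℝ) * (p j * Real.exp (δ * ((j : ℝ) - μ)) / R)) ^ 2 - v| ≤
      8 * v * C * |δ| := by
  have hv0 : 0 ≤ v := by
    rw [hv]; exact Finset.sum_nonneg fun j _ => mul_nonneg (hp j) (sq_nonneg _)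
  have hvC : v ≤ C ^ 2 := var_le hp hsum hμ hv
  have hC0 : (0 : ℝ) ≤ C := Nat.cast_nonneg _
  have hd0 : 0 ≤ |δ| := abs_nonneg δ
  have hcen : ∑ j ∈ range (C + 1), p j * ((j : ℝ) - μ) = 0 := by
    simp_rw [mul_sub]
    rw [Finset.sum_sub_distrib, ← Finset.sum_mul, hsum, hμ]
    simp [mul_comm]
  have hy : ∀ j ∈ range (C + 1), |(j : ℝ) - μ| ≤ C := fun j hj => by
    rw [hμ]; exact abs_sub_mean_le hp hsum hj
  have hdy : ∀ j ∈ range (C + 1), |δ * ((j : ℝ) - μ)| ≤ 1 := fun j hj => by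
    rw [abs_mul, mul_comm]
    exact (mul_le_mul_of_nonneg_right (hy j hj) hd0).trans hδ
  set e : ℕ → ℝ := fun j => Real.exp (δ * ((j : ℝ) - μ)) with he
  set R1 := ∑ j ∈ range (C + 1), p j * ((j : ℝ) - μ) * e j with hR1
  set R2 := ∑ j ∈ range (C + 1), p j * ((j : ℝ) - μ) ^ 2 * e j with hR2
  have bR : |R - 1 - v * δ ^ 2 / 2| ≤ v * C * |δ| ^ 3 := by
    have : R - 1 - v * δ ^ 2 / 2 = ∑ j ∈ range (C + 1), p j * (e j -
        ∑ i ∈ range 3, (δ * ((j : ℝ) - μ)) ^ i / (i.factorial : ℝ)) := by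
      have e1 : ∀ j : ℕ, p j * (e j - ∑ i ∈ range 3, (δ * ((j : ℝ) - μ)) ^ i / (i.factorial : ℝ)) =
          p j * e j - p j - p j * ((j : ℝ) - μ) * δ - p j * ((j : ℝ) - μ) ^ 2 * (δ ^ 2 / 2) := by
        intro j
        simp only [Finset.sum_range_succ, Finset.sum_range_zero, Nat.factorial]
        push_cast
        ring
      simp_rw [e1]
      rw [Finset.sum_sub_distrib, Finset.sum_sub_distrib, Finset.sum_sub_distrib, ← Finset.sum_mul,
        ← Finset.sum_mul, hcen, hsum, ← hv, ← hR]
      ring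
    rw [this]
    refine (Finset.abs_sum_le_sum_abs _ _).trans ?_
    rw [hv, Finset.sum_mul, Finset.sum_mul]
    refine Finset.sum_le_sum fun j hj => ?_
    have hb := Real.exp_bound (hdy j hj) (n := 3) (by norm_num)
    rw [abs_mul, abs_of_nonneg (hp j), mul_assoc, mul_assoc]
    refine mul_le_mul_of_nonneg_left (hb.trans ?_) (hp j)
    rw [abs_mul]
    norm_num [Nat.factorial]
    rw [← sq_abs ((j : ℝ) - μ)]
    have h3 : 0 ≤ |(j : ℝ) - μ| ^ 2 * |δ| ^ 3 := by positivity
    have h4 := mul_le_mul_of_nonneg_left (hy j hj) h3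
    have h5 : 0 ≤ |(j : ℝ) - μ| ^ 2 * |δ| ^ 3 * |(j : ℝ) - μ| := by positivity
    nlinarith
  have bR1 : |R1 - v * δ| ≤ v * C * |δ| ^ 2 := by
    have : R1 - v * δ = ∑ j ∈ range (C + 1), p j * ((j : ℝ) - μ) *
        (e j - 1 - δ * ((j : ℝ) - μ)) := by
      have e1 : ∀ j : ℕ, p j * ((j : ℝ) - μ) * (e j - 1 - δ * ((j : ℝ) - μ)) =
          p j * ((j : ℝ) - μ) * e j - p j * ((j : ℝ) - μ) - p j * ((j : ℝ) - μ) ^ 2 * δ := by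
        intro j; ring
      simp_rw [e1]
      rw [Finset.sum_sub_distrib, Finset.sum_sub_distrib, ← Finset.sum_mul, hcen, ← hv]
      ring
    rw [this]
    refine (Finset.abs_sum_le_sum_abs _ _).trans ?_
    rw [hv, Finset.sum_mul, Finset.sum_mul]
    refine Finset.sum_le_sum fun j hj => ?_
    have hb := Real.abs_exp_sub_one_sub_id_le (hdy j hj)
    rw [abs_mul, abs_mul, abs_of_nonneg (hp j), mul_assoc, mul_assoc, mul_assoc]
    refine mul_le_mul_of_nonneg_left ?_ (hp j)
    refine (mul_le_mul_of_nonneg_left hb (abs_nonneg _)).trans ?_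
    rw [← sq_abs ((j : ℝ) - μ), ← sq_abs (δ * ((j : ℝ) - μ)), abs_mul]
    have h3 : 0 ≤ |(j : ℝ) - μ| ^ 2 * |δ| ^ 2 := by positivity
    have h4 := mul_le_mul_of_nonneg_left (hy j hj) h3
    nlinarith
  have bR2 : |R2 - v| ≤ 2 * v * C * |δ| := by
    have : R2 - v = ∑ j ∈ range (C + 1), p j * ((j : ℝ) - μ) ^ 2 * (e j - 1) := by
      simp_rw [mul_sub, mul_one]
      rw [Finset.sum_sub_distrib, ← hv]
    rw [this]
    refine (Finset.abs_sum_le_sum_abs _ _).trans ?_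
    rw [hv, Finset.mul_sum, Finset.sum_mul, Finset.sum_mul]
    refine Finset.sum_le_sum fun j hj => ?_
    have hb := Real.abs_exp_sub_one_le (hdy j hj)
    have hq : 0 ≤ p j * ((j : ℝ) - μ) ^ 2 := mul_nonneg (hp j) (sq_nonneg _)
    rw [abs_mul, abs_of_nonneg hq]
    refine (mul_le_mul_of_nonneg_left hb hq).trans ?_
    rw [abs_mul]
    have h4 := mul_le_mul_of_nonneg_left (hy j hj) (mul_nonneg hq hd0)
    nlinarith
  have hR1' : 1 ≤ R := by
    have : 1 = ∑ j ∈ range (C + 1), p j * (δ * ((j : ℝ) - μ) + 1) := by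
      have e1 : ∀ j : ℕ, p j * (δ * ((j : ℝ) - μ) + 1) = p j * ((j : ℝ) - μ) * δ + p j := by
        intro j; ring
      simp_rw [e1]
      rw [Finset.sum_add_distrib, ← Finset.sum_mul, hcen, hsum]
      ring
    rw [this, hR]
    exact Finset.sum_le_sum fun j _ => mul_le_mul_of_nonneg_left (Real.add_one_le_exp _) (hp j)
  have hRpos : 0 < R := by linarith
  have hδ2 : δ ^ 2 = |δ| ^ 2 := (sq_abs δ).symm
  have hd3 : v * C * |δ| ^ 3 ≤ v * |δ| ^ 2 := by
    have : 0 ≤ v * |δ| ^ 2 := by positivity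
    nlinarith [mul_le_mul_of_nonneg_left hδ this]
  have hz : R - 1 ≤ 2 * v * |δ| ^ 2 := by
    have := (abs_le.1 bR).2
    rw [hδ2] at this
    nlinarith [mul_nonneg hv0 (sq_nonneg |δ|)]
  have hvd : v * |δ| ≤ C := by
    calc v * |δ| ≤ C ^ 2 * |δ| := mul_le_mul_of_nonneg_right hvC hd0
      _ = C * (C * |δ|) := by ring
      _ ≤ C * 1 := mul_le_mul_of_nonneg_left hδ hC0
      _ = C := mul_one _
  have hmean : (∑ j ∈ range (C + 1), (j : ℝ) * (p j * e j / R)) = μ + R1 / R := by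
    have e1 : ∀ j : ℕ, (j : ℝ) * (p j * e j / R) =
        (p j * ((j : ℝ) - μ) * e j) * R⁻¹ + (p j * e j) * (μ * R⁻¹) := by
      intro j; rw [div_eq_mul_inv]; ring
    simp_rw [e1]
    rw [Finset.sum_add_distrib, ← Finset.sum_mul, ← Finset.sum_mul, ← hR, ← hR1]
    field_simp
    ring
  have hsec : (∑ j ∈ range (C + 1), (j : ℝ) ^ 2 * (p j * e j / R)) =
      R2 / R + 2 * μ * (R1 / R) + μ ^ 2 := by
    have e1 : ∀ j : ℕ, (j : ℝ) ^ 2 * (p j * e j / R) =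
        (p j * ((j : ℝ) - μ) ^ 2 * e j) * R⁻¹ + (p j * ((j : ℝ) - μ) * e j) * (2 * μ * R⁻¹) +
          (p j * e j) * (μ ^ 2 * R⁻¹) := by
      intro j; rw [div_eq_mul_inv]; ring
    simp_rw [e1]
    rw [Finset.sum_add_distrib, Finset.sum_add_distrib, ← Finset.sum_mul, ← Finset.sum_mul,
      ← Finset.sum_mul, ← hR, ← hR1, ← hR2]
    field_simp
  have habsR1 : |R1| ≤ 2 * v * |δ| := by
    have h1 : |R1| ≤ |R1 - v * δ| + |v * δ| := by
      have := abs_add_le (R1 - v * δ) (v * δ)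
      rwa [sub_add_cancel] at this
    rw [abs_mul v, abs_of_nonneg hv0] at h1
    have h2 : v * C * |δ| ^ 2 ≤ v * |δ| := by
      have : 0 ≤ v * |δ| := by positivity
      nlinarith [mul_le_mul_of_nonneg_left hδ this]
    linarith
  refine ⟨hR1', ?_, ?_, ?_⟩
  · have hlog1 := Real.log_le_sub_one_of_pos hRpos
    have hlog2 := Real.one_sub_inv_le_log_of_pos hRpos
    have h1 : R - 1 - (R - 1) ^ 2 ≤ 1 - R⁻¹ := by
      have : 1 - R⁻¹ - (R - 1 - (R - 1) ^ 2) = (R - 1) ^ 3 / R := by field_simp; ring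
      have h2 : 0 ≤ (R - 1) ^ 3 / R := div_nonneg (pow_nonneg (by linarith) 3) hRpos.le
      linarith
    have h2 : (R - 1) ^ 2 ≤ 4 * v * C * |δ| ^ 3 := by
      calc (R - 1) ^ 2 ≤ (2 * v * |δ| ^ 2) ^ 2 := pow_le_pow_left₀ (by linarith) hz 2
        _ = 4 * v * |δ| ^ 3 * (v * |δ|) := by ring
        _ ≤ 4 * v * |δ| ^ 3 * C := mul_le_mul_of_nonneg_left hvd (by positivity)
        _ = _ := by ring
    have h3 := abs_le.1 bR
    rw [abs_le]
    have h4 : 0 ≤ v * C * |δ| ^ 3 := by positivity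
    constructor <;> linarith [h3.1, h3.2]
  · rw [hmean]
    have h1 : μ + R1 / R - μ - v * δ = (R1 - v * δ - v * δ * (R - 1)) / R := by
      field_simp; ring
    rw [h1, abs_div, abs_of_pos hRpos]
    refine (div_le_self (abs_nonneg _) hR1').trans ?_
    have h2 : |v * δ * (R - 1)| ≤ 2 * v * C * |δ| ^ 2 := by
      rw [abs_mul, abs_mul, abs_of_nonneg hv0, abs_of_nonneg (by linarith : 0 ≤ R - 1)]
      calc v * |δ| * (R - 1) ≤ v * |δ| * (2 * v * |δ| ^ 2) :=
            mul_le_mul_of_nonneg_left hz (by positivity)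
        _ = 2 * v * |δ| ^ 2 * (v * |δ|) := by ring
        _ ≤ 2 * v * |δ| ^ 2 * C := mul_le_mul_of_nonneg_left hvd (by positivity)
        _ = _ := by ring
    have h3 := abs_sub (R1 - v * δ) (v * δ * (R - 1))
    linarith
  · rw [hmean, hsec]
    have h1 : R2 / R + 2 * μ * (R1 / R) + μ ^ 2 - (μ + R1 / R) ^ 2 - v =
        (R2 - v - v * (R - 1)) / R - (R1 / R) ^ 2 := by
      field_simp; ring
    rw [h1]
    have h2 : |(R2 - v - v * (R - 1)) / R| ≤ 4 * v * C * |δ| := by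
      rw [abs_div, abs_of_pos hRpos]
      refine (div_le_self (abs_nonneg _) hR1').trans ?_
      have h3 := abs_sub (R2 - v) (v * (R - 1))
      rw [abs_mul, abs_of_nonneg hv0, abs_of_nonneg (by linarith : 0 ≤ R - 1)] at h3
      have h4 : v * (R - 1) ≤ 2 * v * C * |δ| := by
        calc v * (R - 1) ≤ v * (2 * v * |δ| ^ 2) := mul_le_mul_of_nonneg_left hz hv0
          _ = 2 * v * |δ| * (v * |δ|) := by ring
          _ ≤ 2 * v * |δ| * C := mul_le_mul_of_nonneg_left hvd (by positivity)
          _ = _ := by ring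
      linarith
    have h5 : |(R1 / R) ^ 2| ≤ 4 * v * C * |δ| := by
      rw [abs_pow, abs_div, abs_of_pos hRpos]
      calc (|R1| / R) ^ 2 ≤ (2 * v * |δ|) ^ 2 :=
            pow_le_pow_left₀ (by positivity) ((div_le_self (abs_nonneg _) hR1').trans habsR1) 2
        _ = 4 * v * |δ| * (v * |δ|) := by ring
        _ ≤ 4 * v * |δ| * C := mul_le_mul_of_nonneg_left hvd (by positivity)
        _ = _ := by ring
    have := abs_sub ((R2 - v - v * (R - 1)) / R) ((R1 / R) ^ 2)
    linarith

/-- The probability mass function of the truncated Poisson random variable `W(λ)`. -/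
noncomputable def truncPoisson (C : ℕ) (x : ℝ) (j : ℕ) : ℝ :=
  x ^ j / (Nat.factorial j * gfun C x)

theorem gfun_pos (C : ℕ) {x : ℝ} (hx : 0 < x) : 0 < gfun C x := by
  unfold gfun
  exact Finset.sum_pos (fun j _ => by positivity) ⟨0, by simp⟩

theorem truncPoisson_nonneg (C : ℕ) {x : ℝ} (hx : 0 < x) (j : ℕ) : 0 ≤ truncPoisson C x j := by
  have := gfun_pos C hx
  unfold truncPoisson
  positivity

theorem sum_truncPoisson (C : ℕ) {x : ℝ} (hx : 0 < x) :
    ∑ j ∈ range (C + 1), truncPoisson C x j = 1 := by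
  have h := gfun_pos C hx
  unfold truncPoisson
  simp_rw [← div_div]
  rw [← Finset.sum_div]
  exact div_self h.ne'

theorem meanW_eq (C : ℕ) (x : ℝ) :
    meanW C x = ∑ j ∈ range (C + 1), (j : ℝ) * truncPoisson C x j := rfl

theorem varW_eq (C : ℕ) {x : ℝ} (hx : 0 < x) :
    varW C x = ∑ j ∈ range (C + 1), truncPoisson C x j * ((j : ℝ) - meanW C x) ^ 2 := by
  have e : ∀ j : ℕ, truncPoisson C x j * ((j : ℝ) - meanW C x) ^ 2 =
      (j : ℝ) ^ 2 * truncPoisson C x j - (j : ℝ) * truncPoisson C x j * (2 * meanW C x) +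
        truncPoisson C x j * meanW C x ^ 2 := by
    intro j; ring
  simp_rw [e]
  rw [Finset.sum_add_distrib, Finset.sum_sub_distrib, ← Finset.sum_mul, ← Finset.sum_mul,
    sum_truncPoisson C hx, ← meanW_eq]
  unfold varW truncPoisson
  ring

theorem deriv_gfun (C : ℕ) (x : ℝ) :
    x * deriv (gfun C) x = ∑ j ∈ range (C + 1), (j : ℝ) * (x ^ j / Nat.factorial j) := by
  have h : deriv (gfun C) x =
      ∑ j ∈ range (C + 1), ((j : ℝ) * x ^ (j - 1)) / Nat.factorial j := by
    have : HasDerivAt (gfun C)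
        (∑ j ∈ range (C + 1), ((j : ℝ) * x ^ (j - 1)) / Nat.factorial j) x := by
      unfold gfun
      exact HasDerivAt.fun_sum fun j _ => (hasDerivAt_pow j x).div_const _
    exact this.deriv
  rw [h, Finset.mul_sum]
  refine Finset.sum_congr rfl fun j _ => ?_
  cases j with
  | zero => simp
  | succ j => rw [Nat.add_sub_cancel, pow_succ]; ring

theorem meanW_eq_deriv (C : ℕ) (x : ℝ) :
    meanW C x = x * deriv (gfun C) x / gfun C x := by
  rw [deriv_gfun, meanW, Finset.sum_div]
  refine Finset.sum_congr rfl fun j _ => ?_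
  rw [← div_div]; ring

theorem meanW_le_self (C : ℕ) {x : ℝ} (hx : 0 < x) : meanW C x ≤ x := by
  have h := gfun_pos C hx
  rw [meanW_eq_deriv, div_le_iff₀ h, deriv_gfun, Finset.sum_range_succ', gfun,
    Finset.sum_range_succ, mul_add, Finset.mul_sum]
  have e : ∀ j : ℕ, ((j + 1 : ℕ) : ℝ) * (x ^ (j + 1) / (j + 1).factorial) =
      x * (x ^ j / j.factorial) := by
    intro j
    rw [Nat.factorial_succ]
    push_cast
    field_simp
    ring
  simp_rw [e]
  have : 0 ≤ x * (x ^ C / C.factorial) := by positivity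
  simpa using this

/-- Bounds for the truncated Poisson distribution, uniform in the parameter away from zero. -/
theorem truncPoisson_bounds {C : ℕ} (hC : 1 ≤ C) {L : ℝ} (hL : 0 < L) :
    ∃ c : ℝ, 0 < c ∧ ∀ x, L ≤ x →
      c * varW C x ≤ truncPoisson C x C * truncPoisson C x (C - 1) ∧
      c / x ≤ varW C x ∧ c * (C - meanW C x) ≤ 1 / x := by
  set B : ℝ := C.factorial * (1 + 1 / L) ^ C with hB
  have hCr : (1 : ℝ) ≤ C := by exact_mod_cast hC
  have hBpos : 0 < B := by positivity
  set D : ℝ := 1 + B * C / L with hD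
  have hDpos : 0 < D := by positivity
  have hD1 : 1 ≤ D := by
    have : 0 ≤ B * C / L := by positivity
    linarith
  have main : ∀ x, L ≤ x → (C ^ 2 * B * D)⁻¹ * varW C x ≤
      truncPoisson C x C * truncPoisson C x (C - 1) ∧
      1 / D ^ 2 / x ≤ varW C x ∧ (C ^ 2 * B)⁻¹ * (C - meanW C x) ≤ 1 / x := by
    intro x hLx
    have hx : 0 < x := hL.trans_le hLx
    have hg := gfun_pos C hx
    set p := truncPoisson C x with hp
    have hp0 : ∀ j, 0 ≤ p j := truncPoisson_nonneg C hx
    have hsum : ∑ j ∈ range (C + 1), p j = 1 := sum_truncPoisson C hx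
    have hratio : p (C - 1) = C / x * p C := by
      obtain ⟨d, rfl⟩ : ∃ d, C = d + 1 := ⟨C - 1, by omega⟩
      simp only [hp, truncPoisson, Nat.add_sub_cancel, Nat.factorial_succ, pow_succ]
      push_cast
      field_simp
    have hsmall : ∀ j ∈ range C, p j ≤ (B / C) * p (C - 1) := by
      intro j hj
      have hj' : j ≤ C - 1 := by have := Finset.mem_range.1 hj; omega
      obtain ⟨d, hd⟩ := Nat.exists_eq_add_of_le hj'
      have h1 : p j = ((C - 1).factorial / j.factorial) * (1 / x) ^ d * p (C - 1) := by
        simp only [hp, truncPoisson, hd, pow_add]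
        field_simp
        rw [← mul_pow, one_div_mul_cancel hx.ne', one_pow]
      rw [h1]
      refine mul_le_mul_of_nonneg_right ?_ (hp0 _)
      have h2 : ((C - 1).factorial : ℝ) / j.factorial ≤ (C - 1).factorial :=
        div_le_self (by positivity) (by exact_mod_cast Nat.factorial_pos j)
      have h3 : (1 / x) ^ d ≤ (1 + 1 / L) ^ C := by
        have : 1 / x ≤ 1 / L := one_div_le_one_div_of_le hL hLx
        calc (1 / x) ^ d ≤ (1 + 1 / L) ^ d :=
              pow_le_pow_left₀ (by positivity) (by linarith) d
          _ ≤ (1 + 1 / L) ^ C :=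
              pow_le_pow_right₀ (by have : 0 ≤ 1 / L := by positivity
                                    linarith) (by omega)
      have h4 : B / C = (C - 1).factorial * (1 + 1 / L) ^ C := by
        rw [hB, ← Nat.mul_factorial_pred (by omega : C ≠ 0)]
        push_cast
        field_simp
      rw [h4]
      exact mul_le_mul h2 h3 (by positivity) (by positivity)
    have hrest : 1 - p C ≤ B * p (C - 1) := by
      rw [← hsum, Finset.sum_range_succ, add_sub_cancel_right]
      refine (Finset.sum_le_card_nsmul _ _ _ hsmall).trans (le_of_eq ?_)
      rw [Finset.card_range, nsmul_eq_mul]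
      field_simp
    have hpC : 1 ≤ D * p C := by
      have h1 : B * p (C - 1) ≤ B * C / L * p C := by
        rw [hratio]
        have : C / x ≤ C / L := div_le_div_of_nonneg_left (by positivity) hL hLx
        calc B * (C / x * p C) ≤ B * (C / L * p C) := by
              gcongr
              exact hp0 _
          _ = _ := by ring
      rw [hD]; linarith
    have hpC1 : p C ≤ 1 := by
      rw [← hsum]
      exact Finset.single_le_sum (fun j _ => hp0 j) (by simp)
    have hμ : meanW C x = ∑ j ∈ range (C + 1), (j : ℝ) * p j := meanW_eq C x
    have hv := varW_eq C hx
    rw [← hp] at hv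
    have hpair : p (C - 1) + p C ≤ 1 := by
      obtain ⟨d, rfl⟩ : ∃ d, C = d + 1 := ⟨C - 1, by omega⟩
      rw [← hsum, Finset.sum_range_succ, Finset.sum_range_succ, Nat.add_sub_cancel]
      have : 0 ≤ ∑ j ∈ range d, p j := Finset.sum_nonneg fun j _ => hp0 j
      linarith
    have hCm : (C : ℝ) - meanW C x ≤ C * (1 - p C) := by
      have h1 : (C : ℝ) - meanW C x = ∑ j ∈ range C, ((C : ℝ) - j) * p j := by
        have : ∑ j ∈ range (C + 1), ((C : ℝ) - j) * p j = C - meanW C x := by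
          simp_rw [sub_mul]
          rw [Finset.sum_sub_distrib, ← Finset.mul_sum, hsum, ← hμ, mul_one]
        rw [← this, Finset.sum_range_succ]
        ring
      rw [h1, ← hsum, Finset.sum_range_succ, add_sub_cancel_right, Finset.mul_sum]
      refine Finset.sum_le_sum fun j _ => mul_le_mul_of_nonneg_right ?_ (hp0 j)
      have : (0 : ℝ) ≤ j := Nat.cast_nonneg _
      linarith
    have hvar_le : varW C x ≤ C ^ 2 * (1 - p C) := by
      have h1 : varW C x ≤ ∑ j ∈ range (C + 1), p j * ((j : ℝ) - C) ^ 2 := by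
        have : ∑ j ∈ range (C + 1), p j * ((j : ℝ) - C) ^ 2 =
            varW C x + (meanW C x - C) ^ 2 := by
          have e : ∀ j : ℕ, p j * ((j : ℝ) - C) ^ 2 = p j * ((j : ℝ) - meanW C x) ^ 2 +
              (j * p j) * (2 * (meanW C x - C)) + p j * (C ^ 2 - meanW C x ^ 2) := by
            intro j; ring
          simp_rw [e]
          rw [Finset.sum_add_distrib, Finset.sum_add_distrib, ← Finset.sum_mul, ← Finset.sum_mul,
            hsum, ← hμ, ← hv]
          ring
        rw [this]
        linarith [sq_nonneg (meanW C x - C)]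
      refine h1.trans ?_
      rw [← hsum, Finset.sum_range_succ, Finset.sum_range_succ, add_sub_cancel_right, sub_self,
        Finset.mul_sum]
      simp only [ne_eq, OfNat.ofNat_ne_zero, not_false_eq_true, zero_pow, mul_zero, add_zero]
      refine Finset.sum_le_sum fun j hj => ?_
      rw [mul_comm]
      refine mul_le_mul_of_nonneg_right ?_ (hp0 j)
      have h2 : (j : ℝ) ≤ C := by exact_mod_cast (Finset.mem_range.1 hj).le
      have h3 : (0 : ℝ) ≤ j := Nat.cast_nonneg _
      nlinarith
    have hvar_ge : p C * p (C - 1) ≤ varW C x := by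
      have h1 : p (C - 1) * (((C - 1 : ℕ) : ℝ) - meanW C x) ^ 2 +
          p C * ((C : ℝ) - meanW C x) ^ 2 ≤ varW C x := by
        rw [hv]
        obtain ⟨d, rfl⟩ : ∃ d, C = d + 1 := ⟨C - 1, by omega⟩
        rw [Finset.sum_range_succ, Finset.sum_range_succ, Nat.add_sub_cancel]
        have : 0 ≤ ∑ j ∈ range d, p j * ((j : ℝ) - meanW (d + 1) x) ^ 2 :=
          Finset.sum_nonneg fun j _ => mul_nonneg (hp0 j) (sq_nonneg _)
        linarith
      refine le_trans ?_ h1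
      rw [Nat.cast_sub hC, Nat.cast_one]
      set a := (C : ℝ) - meanW C x with ha
      rw [show (C : ℝ) - 1 - meanW C x = a - 1 by rw [ha]; ring]
      have hq0 := hp0 (C - 1)
      have hq1 := hp0 C
      set q := p (C - 1)
      set q' := p C
      have h5 : 0 < q + q' := by
        rcases hq1.lt_or_eq with h | h
        · linarith
        · rw [← h] at hpC; linarith
      have h6 : q' * q ≤ (q + q') * (q * (a - 1) ^ 2 + q' * a ^ 2) := by
        nlinarith [sq_nonneg ((q + q') * a - q)]
      have h7 : 0 ≤ q * (a - 1) ^ 2 + q' * a ^ 2 := by positivity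
      nlinarith
    refine ⟨?_, ?_, ?_⟩
    · rw [inv_mul_le_iff₀ (by positivity)]
      calc varW C x ≤ C ^ 2 * (1 - p C) := hvar_le
        _ ≤ C ^ 2 * (B * p (C - 1)) := by gcongr
        _ ≤ C ^ 2 * (B * p (C - 1)) * (D * p C) :=
            le_mul_of_one_le_right (mul_nonneg (by positivity)
              (mul_nonneg hBpos.le (hp0 _))) hpC
        _ = _ := by ring
    · refine le_trans ?_ hvar_ge
      rw [hratio]
      have h1 : 1 / D ≤ p C := by rw [div_le_iff₀ hDpos]; linarith
      calc 1 / D ^ 2 / x = (1 / D) * (1 / x * (1 / D)) := by field_simp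
        _ ≤ p C * (C / x * p C) := by
            have := hp0 C
            gcongr
    · rw [inv_mul_le_iff₀ (by positivity)]
      calc (C : ℝ) - meanW C x ≤ C * (B * p (C - 1)) :=
            hCm.trans (mul_le_mul_of_nonneg_left hrest (by positivity))
        _ = C ^ 2 * B * (1 / x) * p C := by rw [hratio]; ring
        _ ≤ C ^ 2 * B * (1 / x) * 1 := by gcongr
        _ = _ := by ring
  refine ⟨min (C ^ 2 * B * D)⁻¹ (min (1 / D ^ 2) (C ^ 2 * B)⁻¹), by positivity, ?_⟩
  intro x hLx
  have hx : 0 < x := hL.trans_le hLx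
  obtain ⟨h1, h2, h3⟩ := main x hLx
  have hv0 : 0 ≤ varW C x := by
    rw [varW_eq C hx]
    exact Finset.sum_nonneg fun j _ => mul_nonneg (truncPoisson_nonneg C hx j) (sq_nonneg _)
  have hm0 : 0 ≤ (C : ℝ) - meanW C x := by
    have := (abs_le.1 (abs_sub_mean_le (truncPoisson_nonneg C hx) (sum_truncPoisson C hx)
      (Finset.mem_range.2 (Nat.succ_pos C)))).1
    have h2 : ∑ j ∈ range (C + 1), (j : ℝ) * truncPoisson C x j ≤
        ∑ j ∈ range (C + 1), (C : ℝ) * truncPoisson C x j := by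
      refine Finset.sum_le_sum fun j hj => mul_le_mul_of_nonneg_right ?_ (truncPoisson_nonneg C hx j)
      exact_mod_cast Nat.le_of_lt_succ (Finset.mem_range.1 hj)
    rw [← Finset.mul_sum, sum_truncPoisson C hx, ← meanW_eq] at h2
    linarith
  refine ⟨?_, ?_, ?_⟩
  · exact (mul_le_mul_of_nonneg_right (min_le_left _ _) hv0).trans h1
  · refine le_trans ?_ h2
    exact div_le_div_of_nonneg_right ((min_le_right _ _).trans (min_le_left _ _)) hx.le
  · exact (mul_le_mul_of_nonneg_right ((min_le_right _ _).trans (min_le_right _ _)) hm0).trans h3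

theorem coeff_pow_truncPoisson (C N n : ℕ) {x : ℝ} (hx : 0 < x) :
    ((∑ j ∈ range (C + 1), Polynomial.monomial j (truncPoisson C x j)) ^ N).coeff n =
      (truncExp C ^ N).coeff n * x ^ n / gfun C x ^ N := by
  have h : (∑ j ∈ range (C + 1), Polynomial.monomial j (truncPoisson C x j)) =
      Polynomial.C (gfun C x)⁻¹ * (truncExp C).comp (Polynomial.C x * Polynomial.X) := by
    rw [truncExp, Polynomial.sum_comp, Finset.mul_sum]
    refine Finset.sum_congr rfl fun j _ => ?_
    rw [Polynomial.monomial_comp]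
    rw [mul_pow, ← Polynomial.C_pow, ← Polynomial.C_mul_X_pow_eq_monomial, ← mul_assoc, ← mul_assoc,
      ← Polynomial.C_mul, ← Polynomial.C_mul]
    congr 2
    unfold truncPoisson
    have := gfun_pos C hx
    field_simp
  rw [h, mul_pow, ← Polynomial.C_pow, Polynomial.coeff_C_mul, ← Polynomial.pow_comp,
    Polynomial.comp_C_mul_X_coeff, inv_pow]
  ring

theorem gfun_mul_exp (C : ℕ) {x : ℝ} (hx : 0 < x) (δ : ℝ) :
    gfun C (x * Real.exp δ) = gfun C x * Real.exp (δ * meanW C x) *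
      ∑ j ∈ range (C + 1), truncPoisson C x j * Real.exp (δ * ((j : ℝ) - meanW C x)) := by
  have hg := gfun_pos C hx
  rw [gfun, Finset.mul_sum]
  refine Finset.sum_congr rfl fun j _ => ?_
  rw [mul_pow, ← Real.exp_nat_mul, truncPoisson, mul_sub, Real.exp_sub, mul_comm (j : ℝ) δ]
  have := Real.exp_pos (δ * meanW C x)
  field_simp

theorem truncPoisson_mul_exp (C : ℕ) {x : ℝ} (hx : 0 < x) (δ : ℝ) (j : ℕ) :
    truncPoisson C (x * Real.exp δ) j =
      truncPoisson C x j * Real.exp (δ * ((j : ℝ) - meanW C x)) /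
      ∑ j ∈ range (C + 1), truncPoisson C x j * Real.exp (δ * ((j : ℝ) - meanW C x)) := by
  have hg := gfun_pos C hx
  have hg1 := gfun_pos C (mul_pos hx (Real.exp_pos δ))
  rw [truncPoisson, gfun_mul_exp C hx] at *
  set R := ∑ j ∈ range (C + 1), truncPoisson C x j * Real.exp (δ * ((j : ℝ) - meanW C x))
  have he := Real.exp_pos (δ * meanW C x)
  have hR : R ≠ 0 := by
    rintro h
    rw [h, mul_zero] at hg1
    exact lt_irrefl _ hg1
  rw [mul_pow, ← Real.exp_nat_mul, truncPoisson, mul_sub, Real.exp_sub, mul_comm (j : ℝ) δ]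
  field_simp

theorem tilted_truncPoisson (C : ℕ) {x δ : ℝ} (hx : 0 < x) (hδ : C * |δ| ≤ 1) {R : ℝ}
    (hR : R = ∑ j ∈ range (C + 1), truncPoisson C x j * Real.exp (δ * ((j : ℝ) - meanW C x))) :
    1 ≤ R ∧ |Real.log R - varW C x * δ ^ 2 / 2| ≤ 5 * varW C x * C * |δ| ^ 3 ∧
    |meanW C (x * Real.exp δ) - meanW C x - varW C x * δ| ≤ 3 * varW C x * C * |δ| ^ 2 ∧
    |varW C (x * Real.exp δ) - varW C x| ≤ 8 * varW C x * C * |δ| := by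
  obtain ⟨h1, h2, h3, h4⟩ := tilt_bounds (truncPoisson_nonneg C hx) (sum_truncPoisson C hx)
    (meanW_eq C x) (varW_eq C hx) hδ hR
  have ht : ∀ j, truncPoisson C (x * Real.exp δ) j =
      truncPoisson C x j * Real.exp (δ * ((j : ℝ) - meanW C x)) / R := fun j => by
    rw [truncPoisson_mul_exp C hx, hR]
  simp only [← ht] at h3 h4
  exact ⟨h1, h2, h3, h4⟩

theorem abs_log_descFactorial_div_pow_add_le {N K : ℕ} (h : 2 * K ≤ N) (hN : 0 < N) :
    0 < (N.descFactorial K : ℝ) / (N : ℝ) ^ K ∧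
    |Real.log ((N.descFactorial K : ℝ) / (N : ℝ) ^ K) + (K : ℝ) ^ 2 / (2 * N)| ≤
      K / N + 2 * (K : ℝ) ^ 3 / (N : ℝ) ^ 2 := by
  have hNr : (0 : ℝ) < N := by exact_mod_cast hN
  have key : ∀ J : ℕ, J ≤ K → 0 < (N.descFactorial J : ℝ) / (N : ℝ) ^ J ∧
    |Real.log ((N.descFactorial J : ℝ) / (N : ℝ) ^ J) + (J : ℝ) ^ 2 / (2 * N)| ≤
      J * (1 / N + 2 * (K : ℝ) ^ 2 / (N : ℝ) ^ 2) := by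
    intro J
    induction J with
    | zero => simp
    | succ J ih =>
      intro hJ
      obtain ⟨hpos, hb⟩ := ih (by omega)
      set y : ℝ := J / N with hy
      have hy0 : 0 ≤ y := by positivity
      have hyK : y ≤ K / N := by
        rw [hy]; gcongr; omega
      have hy2 : y ≤ 1 / 2 := by
        rw [hy, div_le_div_iff₀ hNr two_pos]
        have : (2 * J : ℝ) ≤ N := by exact_mod_cast (by omega : 2 * J ≤ N)
        linarith
      have hy1 : 0 < 1 - y := by linarith
      have e1 : (N.descFactorial (J + 1) : ℝ) / (N : ℝ) ^ (J + 1) =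
          (1 - y) * ((N.descFactorial J : ℝ) / (N : ℝ) ^ J) := by
        rw [Nat.descFactorial_succ, Nat.cast_mul, Nat.cast_sub (by omega), hy, pow_succ]
        field_simp
      refine ⟨by rw [e1]; positivity, ?_⟩
      rw [e1, Real.log_mul hy1.ne' hpos.ne']
      have hl1 := Real.log_le_sub_one_of_pos hy1
      have hl2 := Real.one_sub_inv_le_log_of_pos hy1
      have hl3 : -y - 2 * y ^ 2 ≤ 1 - (1 - y)⁻¹ := by
        have : 1 - (1 - y)⁻¹ - (-y - 2 * y ^ 2) = y ^ 2 * (1 - 2 * y) / (1 - y) := by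
          field_simp; ring
        have h2 : 0 ≤ y ^ 2 * (1 - 2 * y) / (1 - y) :=
          div_nonneg (mul_nonneg (sq_nonneg _) (by linarith)) hy1.le
        linarith
      have hyy : 2 * y ^ 2 ≤ 2 * (K : ℝ) ^ 2 / (N : ℝ) ^ 2 := by
        calc 2 * y ^ 2 ≤ 2 * (K / N : ℝ) ^ 2 := by gcongr
          _ = _ := by rw [div_pow]; ring
      have e2 : ((J + 1 : ℕ) : ℝ) ^ 2 / (2 * N) = (J : ℝ) ^ 2 / (2 * N) + y + 1 / N / 2 := by
        rw [hy]; push_cast; field_simp; ring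
      have hN1 : (0 : ℝ) ≤ 1 / N := by positivity
      rw [e2]
      push_cast
      have := abs_le.1 hb
      rw [abs_le]
      constructor <;> nlinarith [this.1, this.2]
  obtain ⟨h1, h2⟩ := key K le_rfl
  refine ⟨h1, h2.trans (le_of_eq ?_)⟩
  ring

/-- If `K³ = o(N²)` then `[N]_K ∼ N^K exp (-K² / (2N))`. -/
theorem tendsto_descFactorial_div_pow {N K : ℕ → ℕ} (hN : ∀ ν, 0 < N ν)
    (h1 : Tendsto (fun ν => (K ν : ℝ) / N ν) atTop (nhds 0))
    (h3 : Tendsto (fun ν => (K ν : ℝ) ^ 3 / (N ν : ℝ) ^ 2) atTop (nhds 0)) :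
    Tendsto (fun ν => ((N ν).descFactorial (K ν) : ℝ) / (N ν : ℝ) ^ K ν *
      Real.exp ((K ν : ℝ) ^ 2 / (2 * N ν))) atTop (nhds 1) := by
  have hb : Tendsto (fun ν => (K ν : ℝ) / N ν + 2 * (K ν : ℝ) ^ 3 / (N ν : ℝ) ^ 2)
      atTop (nhds 0) := by
    simpa [mul_div_assoc] using h1.add (h3.const_mul 2)
  have hev : ∀ᶠ ν in atTop, 2 * K ν ≤ N ν := by
    filter_upwards [h1.eventually_lt_const (by norm_num : (0 : ℝ) < 1 / 2)] with ν hν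
    have hNr : (0 : ℝ) < N ν := by exact_mod_cast hN ν
    rw [div_lt_div_iff₀ hNr two_pos] at hν
    have : (2 * K ν : ℝ) ≤ N ν := by linarith
    exact_mod_cast this
  have hlog : Tendsto (fun ν => Real.log (((N ν).descFactorial (K ν) : ℝ) / (N ν : ℝ) ^ K ν) +
      (K ν : ℝ) ^ 2 / (2 * N ν)) atTop (nhds 0) :=
    squeeze_zero_norm' (by
      filter_upwards [hev] with ν hν
      exact (abs_log_descFactorial_div_pow_add_le hν (hN ν)).2) hb
  have := (Real.continuous_exp.tendsto 0).comp hlog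
  rw [Real.exp_zero] at this
  refine this.congr' ?_
  filter_upwards [hev] with ν hν
  rw [Function.comp_apply, Real.exp_add,
    Real.exp_log (abs_log_descFactorial_div_pow_add_le hν (hN ν)).1]

/-- Rewrites the ratio of the factorial moment to its claimed asymptotic value after
exponential tilting by `δ`. -/
theorem tilted_ratio_identity (N₁ K n₁ M : ℕ) {g l R : ℝ} (hg : 0 < g) (hl : 0 < l) (hR : 0 < R)
    {x δ μ S Nr Q : ℝ} (D a₀ a₁ : ℝ) (hQ : 0 < Q) (hNr : 0 < Nr)
    (hx : (n₁ : ℝ) - N₁ * μ = -x) (hδ : δ * x = -x ^ 2 / S) :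
    D * Q * (a₁ / a₀) /
      ((Nr ^ K * l ^ M / g ^ K * Q) * Real.exp (-x ^ 2 / (2 * S) - (K : ℝ) ^ 2 / (2 * Nr))) =
    (D / Nr ^ K * Real.exp ((K : ℝ) ^ 2 / (2 * Nr))) *
      ((a₁ * (l * Real.exp δ) ^ n₁ / (g * Real.exp (δ * μ) * R) ^ N₁) /
        (a₀ * l ^ (n₁ + M) / g ^ (N₁ + K))) *
      (R ^ N₁ * Real.exp (-x ^ 2 / (2 * S))) := by
  have e1 : Real.exp δ ^ n₁ = Real.exp (δ * μ) ^ N₁ * Real.exp (x ^ 2 / S) := by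
    rw [← Real.exp_nat_mul, ← Real.exp_nat_mul, ← Real.exp_add]
    congr 1
    have : x ^ 2 / S = -(δ * x) := by rw [hδ]; ring
    rw [this]
    linear_combination δ * hx
  have e2 : Real.exp (x ^ 2 / S) * Real.exp (-x ^ 2 / (2 * S)) * Real.exp (-x ^ 2 / (2 * S)) = 1 := by
    rw [← Real.exp_add, ← Real.exp_add, Real.exp_eq_one_iff]
    ring
  have e3 : Real.exp (-x ^ 2 / (2 * S) - (K : ℝ) ^ 2 / (2 * Nr)) =
      Real.exp (-x ^ 2 / (2 * S)) / Real.exp ((K : ℝ) ^ 2 / (2 * Nr)) := Real.exp_sub _ _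
  rw [e3, mul_pow l, e1, mul_pow (g * Real.exp (δ * μ)), mul_pow g, pow_add, pow_add]
  have p1 := Real.exp_pos (x ^ 2 / S)
  have p2 := Real.exp_pos (-x ^ 2 / (2 * S))
  have p3 := Real.exp_pos ((K : ℝ) ^ 2 / (2 * Nr))
  have p4 := Real.exp_pos (δ * μ)
  set E1 := Real.exp (x ^ 2 / S)
  set E2 := Real.exp (-x ^ 2 / (2 * S))
  set E3 := Real.exp ((K : ℝ) ^ 2 / (2 * Nr))
  set E4 := Real.exp (δ * μ)
  rcases eq_or_ne a₀ 0 with h0 | h0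
  · simp [h0]
  · field_simp
    linear_combination (-(D * a₁)) * e2

theorem tendsto_rates {K S : ℕ → ℝ} (hSpos : ∀ ν, 0 < S ν) (hS : Tendsto S atTop atTop)
    (h : Tendsto (fun ν => K ν / S ν ^ ((2 : ℝ) / 3)) atTop (nhds 0)) :
    Tendsto (fun ν => K ν / S ν) atTop (nhds 0) ∧
    Tendsto (fun ν => K ν ^ 3 / S ν ^ 2) atTop (nhds 0) ∧
    Tendsto (fun ν => K ν ^ 2 / S ν / √(S ν)) atTop (nhds 0) := by
  have ha := (tendsto_rpow_neg_atTop (by norm_num : (0 : ℝ) < 1 / 3)).comp hS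
  have hb := (tendsto_rpow_neg_atTop (by norm_num : (0 : ℝ) < 1 / 6)).comp hS
  refine ⟨?_, ?_, ?_⟩
  · have := h.mul ha
    rw [mul_zero] at this
    refine this.congr fun ν => ?_
    have e : S ν = S ν ^ ((2 : ℝ) / 3) * S ν ^ ((1 : ℝ) / 3) := by
      rw [← Real.rpow_add (hSpos ν)]; norm_num
    simp only [Function.comp_apply]
    rw [Real.rpow_neg (hSpos ν).le]
    conv_rhs => rw [e]
    rw [← div_eq_mul_inv, div_div]
  · have := h.pow 3
    rw [zero_pow three_ne_zero] at this
    refine this.congr fun ν => ?_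
    rw [div_pow, ← Real.rpow_mul_natCast (hSpos ν).le, ← Real.rpow_natCast (S ν) 2]
    norm_num
  · have := (h.pow 2).mul hb
    rw [mul_zero] at this
    refine this.congr fun ν => ?_
    have e : S ν * √(S ν) = (S ν ^ ((2 : ℝ) / 3)) ^ 2 * S ν ^ ((1 : ℝ) / 6) := by
      rw [Real.sqrt_eq_rpow, ← Real.rpow_mul_natCast (hSpos ν).le, ← Real.rpow_add (hSpos ν)]
      conv_lhs => enter [1]; rw [← Real.rpow_one (S ν)]
      rw [← Real.rpow_add (hSpos ν)]
      norm_num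
    simp only [Function.comp_apply]
    rw [Real.rpow_neg (hSpos ν).le, div_div, e, div_pow, ← div_eq_mul_inv, div_div]

theorem tendsto_pow_mul_exp {C : ℕ} {R v δ x S : ℕ → ℝ} {N K : ℕ → ℕ}
    (hNpos : ∀ ν, 0 < N ν) (hv : ∀ ν, 0 < v ν) (hvC : ∀ ν, v ν ≤ C ^ 2)
    (hS : ∀ ν, S ν = N ν * v ν) (hδ : ∀ ν, δ ν = -x ν / S ν) (hx : ∀ ν, |x ν| ≤ C * K ν)
    (hKN : ∀ᶠ ν in atTop, K ν ≤ N ν) (hR : ∀ᶠ ν in atTop, 1 ≤ R ν)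
    (hlog : ∀ᶠ ν in atTop, |Real.log (R ν) - v ν * δ ν ^ 2 / 2| ≤ 5 * v ν * C * |δ ν| ^ 3)
    (h3 : Tendsto (fun ν => (K ν : ℝ) ^ 3 / S ν ^ 2) atTop (nhds 0)) :
    Tendsto (fun ν => R ν ^ (N ν - K ν) * Real.exp (-x ν ^ 2 / (2 * S ν))) atTop (nhds 1) := by
  have hlim : Tendsto (fun ν => Real.log (R ν) * (N ν - K ν : ℕ) + -x ν ^ 2 / (2 * S ν))
      atTop (nhds 0) := by
    have := h3.const_mul ((C : ℝ) ^ 4 / 2 + 5 * C ^ 4)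
    rw [mul_zero] at this
    refine squeeze_zero_norm' ?_ this
    filter_upwards [hKN, hlog] with ν h1 h2
    have hN : (0 : ℝ) < N ν := by exact_mod_cast hNpos ν
    have hSp : 0 < S ν := by rw [hS]; exact mul_pos hN (hv ν)
    have hδK : |δ ν| ≤ C * K ν / S ν := by
      rw [hδ, abs_div, abs_neg, abs_of_pos hSp]
      gcongr; exact hx ν
    have e : x ν ^ 2 / (2 * S ν) = N ν * (v ν * δ ν ^ 2 / 2) := by
      rw [hδ]
      have : N ν = S ν / v ν := by rw [hS]; field_simp [(hv ν).ne']
      rw [this]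
      field_simp [(hv ν).ne']
    rw [Real.norm_eq_abs, Nat.cast_sub h1, neg_div, e]
    have e2 : Real.log (R ν) * ((N ν : ℝ) - K ν) + -(N ν * (v ν * δ ν ^ 2 / 2)) =
        ((N ν : ℝ) - K ν) * (Real.log (R ν) - v ν * δ ν ^ 2 / 2) - K ν * (v ν * |δ ν| ^ 2 / 2) := by
      rw [sq_abs]; ring
    rw [e2]
    have hK0 : (0 : ℝ) ≤ K ν := by positivity
    have hKNr : (K ν : ℝ) ≤ N ν := by exact_mod_cast h1
    have hvn := (hv ν).le
    calc _ ≤ |((N ν : ℝ) - K ν) * (Real.log (R ν) - v ν * δ ν ^ 2 / 2)| +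
          |K ν * (v ν * |δ ν| ^ 2 / 2)| := abs_sub _ _
      _ ≤ N ν * (5 * v ν * C * (C * K ν / S ν) ^ 3) + K ν * (C ^ 2 * (C * K ν / S ν) ^ 2 / 2) := by
        rw [abs_mul, abs_of_nonneg (by linarith : (0 : ℝ) ≤ N ν - K ν),
          abs_of_nonneg (by positivity : 0 ≤ K ν * (v ν * |δ ν| ^ 2 / 2))]
        gcongr
        · linarith
        · exact h2.trans (by gcongr)
        · exact hvC ν
      _ = 5 * C * (S ν * (C * K ν / S ν) ^ 3) + K ν * (C ^ 2 * (C * K ν / S ν) ^ 2 / 2) := by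
        rw [hS]; ring
      _ = _ := by field_simp; ring
  have := (Real.continuous_exp.tendsto 0).comp hlim
  rw [Real.exp_zero] at this
  refine this.congr' ?_
  filter_upwards [hR] with ν hν
  rw [Function.comp_apply, Real.exp_add, ← Real.rpow_def_of_pos (by linarith), Real.rpow_natCast]

/-- The local probabilities of the original and the tilted truncated Poisson sums are
asymptotically equal. -/
theorem tendsto_coeff_ratio {C : ℕ} (hC : 1 ≤ C) {c : ℝ} (hc : 0 < c) {l δ x S : ℕ → ℝ}
    {N K n M : ℕ → ℕ} (hl : ∀ ν, 0 < l ν) (hv : ∀ ν, 0 < varW C (l ν)) (hNpos : ∀ ν, 0 < N ν)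
    (hcl : ∀ᶠ ν in atTop,
      c * varW C (l ν) ≤ truncPoisson C (l ν) C * truncPoisson C (l ν) (C - 1))
    (hcl' : ∀ᶠ ν in atTop, c * varW C (l ν * Real.exp (δ ν)) ≤
      truncPoisson C (l ν * Real.exp (δ ν)) C * truncPoisson C (l ν * Real.exp (δ ν)) (C - 1))
    (hmean : ∀ ν, N ν * meanW C (l ν) = n ν)
    (hKN : ∀ᶠ ν in atTop, K ν ≤ N ν) (hMn : ∀ᶠ ν in atTop, M ν ≤ n ν)
    (hS : ∀ ν, S ν = N ν * varW C (l ν)) (hStop : Tendsto S atTop atTop)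
    (hx : ∀ ν, x ν = M ν - K ν * meanW C (l ν)) (hxK : ∀ ν, |x ν| ≤ C * K ν)
    (hδ : ∀ ν, δ ν = -x ν / S ν)
    (hKS : Tendsto (fun ν => (K ν : ℝ) / S ν) atTop (nhds 0))
    (hKS' : Tendsto (fun ν => (K ν : ℝ) ^ 2 / S ν / √(S ν)) atTop (nhds 0))
    (hKNlim : Tendsto (fun ν => (K ν : ℝ) / N ν) atTop (nhds 0)) :
    Tendsto (fun ν =>
      ((∑ j ∈ range (C + 1), Polynomial.monomial j (truncPoisson C (l ν * Real.exp (δ ν)) j)) ^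
        (N ν - K ν)).coeff (n ν - M ν) /
      ((∑ j ∈ range (C + 1), Polynomial.monomial j (truncPoisson C (l ν) j)) ^ N ν).coeff (n ν))
      atTop (nhds 1) := by
  have hN : ∀ ν, (0 : ℝ) < N ν := fun ν => by exact_mod_cast hNpos ν
  have hSp : ∀ ν, 0 < S ν := fun ν => by rw [hS]; exact mul_pos (hN ν) (hv ν)
  have hl' : ∀ ν, 0 < l ν * Real.exp (δ ν) := fun ν => mul_pos (hl ν) (Real.exp_pos _)
  have hvC : ∀ ν, varW C (l ν) ≤ C ^ 2 := fun ν =>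
    var_le (truncPoisson_nonneg C (hl ν)) (sum_truncPoisson C (hl ν)) (meanW_eq C _)
      (varW_eq C (hl ν))
  have hδK : ∀ ν, |δ ν| ≤ C * K ν / S ν := fun ν => by
    rw [hδ, abs_div, abs_neg, abs_of_pos (hSp ν)]
    have := hSp ν
    gcongr; exact hxK ν
  have hδ0 : Tendsto (fun ν => C * |δ ν|) atTop (nhds 0) := by
    have := hKS.const_mul ((C : ℝ) * C)
    rw [mul_zero] at this
    refine squeeze_zero (fun ν => by positivity) (fun ν => ?_) this
    calc C * |δ ν| ≤ C * (C * K ν / S ν) := by gcongr; exact hδK ν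
      _ = _ := by ring
  have hδ1 : ∀ᶠ ν in atTop, C * |δ ν| ≤ 1 := (hδ0.eventually_lt_const one_pos).mono fun _ h => h.le
  have hratio : Tendsto (fun ν => ((N ν - K ν : ℕ) : ℝ) * varW C (l ν * Real.exp (δ ν)) / S ν)
      atTop (nhds 1) := by
    have hvv : Tendsto (fun ν => varW C (l ν * Real.exp (δ ν)) / varW C (l ν)) atTop (nhds 1) := by
      rw [tendsto_iff_norm_sub_tendsto_zero]
      have := hδ0.const_mul 8
      rw [mul_zero] at this
      refine squeeze_zero' (Eventually.of_forall fun ν => norm_nonneg _) ?_ this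
      filter_upwards [hδ1] with ν h1
      have h4 := (tilted_truncPoisson C (hl ν) h1 rfl).2.2.2
      have := hv ν
      rw [Real.norm_eq_abs, div_sub_one this.ne', abs_div, abs_of_pos this, div_le_iff₀ this]
      linarith
    have := (hKNlim.const_sub 1).mul hvv
    rw [sub_zero, mul_one] at this
    refine this.congr' ?_
    filter_upwards [hKN] with ν h1
    have h2 := (hN ν).ne'
    have h3 := (hv ν).ne'
    rw [Nat.cast_sub h1, hS]
    field_simp
  have hS1top : Tendsto (fun ν => ((N ν - K ν : ℕ) : ℝ) * varW C (l ν * Real.exp (δ ν)))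
      atTop atTop := by
    refine (hStop.atTop_mul_pos one_pos hratio).congr fun ν => ?_
    rw [mul_div_cancel₀ _ (hSp ν).ne']
  have hsq : Tendsto (fun ν => √(((N ν - K ν : ℕ) : ℝ) * varW C (l ν * Real.exp (δ ν))) / √(S ν))
      atTop (nhds 1) := by
    have := (Real.continuous_sqrt.tendsto 1).comp hratio
    rw [Real.sqrt_one] at this
    refine this.congr fun ν => ?_
    rw [Function.comp_apply, Real.sqrt_div' _ (hSp ν).le]
  have hd : Tendsto (fun ν => (((n ν - M ν : ℕ) : ℝ) -
      ((N ν - K ν : ℕ) : ℝ) * meanW C (l ν * Real.exp (δ ν))) /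
      √(((N ν - K ν : ℕ) : ℝ) * varW C (l ν * Real.exp (δ ν)))) atTop (nhds 0) := by
    have hd' : Tendsto (fun ν => (((n ν - M ν : ℕ) : ℝ) -
        ((N ν - K ν : ℕ) : ℝ) * meanW C (l ν * Real.exp (δ ν))) / √(S ν)) atTop (nhds 0) := by
      have := hKS'.const_mul (4 * (C : ℝ) ^ 3)
      rw [mul_zero] at this
      refine squeeze_zero_norm' ?_ this
      filter_upwards [hδ1, hKN, hMn] with ν h1 h2 h3
      have h4 := (tilted_truncPoisson C (hl ν) h1 rfl).2.2.1
      have hs := hSp ν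
      have hvn := (hv ν).le
      have hKNr : (K ν : ℝ) ≤ N ν := by exact_mod_cast h2
      set ζ := meanW C (l ν * Real.exp (δ ν)) - meanW C (l ν) - varW C (l ν) * δ ν with hζ
      have hSδ : N ν * varW C (l ν) * δ ν = -x ν := by
        rw [← hS, hδ, mul_div_cancel₀ _ hs.ne']
      have e : ((n ν - M ν : ℕ) : ℝ) - ((N ν - K ν : ℕ) : ℝ) * meanW C (l ν * Real.exp (δ ν)) =
          K ν * (varW C (l ν) * δ ν) - (N ν - K ν) * ζ := by
        rw [Nat.cast_sub h2, Nat.cast_sub h3, hζ]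
        linear_combination (-1 : ℝ) * hmean ν - hSδ + hx ν
      rw [e, norm_div, Real.norm_eq_abs, Real.norm_of_nonneg (Real.sqrt_nonneg _), ← mul_div_assoc]
      gcongr
      calc _ ≤ |K ν * (varW C (l ν) * δ ν)| + |((N ν : ℝ) - K ν) * ζ| := abs_sub _ _
        _ ≤ K ν * (C ^ 2 * (C * K ν / S ν)) +
            N ν * (3 * varW C (l ν) * C * (C * K ν / S ν) ^ 2) := by
          rw [abs_mul, abs_mul, abs_mul, abs_of_nonneg hvn,
            abs_of_nonneg (by linarith : (0 : ℝ) ≤ N ν - K ν), Nat.abs_cast]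
          gcongr
          · exact hvC ν
          · exact hδK ν
          · linarith [(Nat.cast_nonneg (K ν) : (0 : ℝ) ≤ K ν)]
          · refine h4.trans ?_
            gcongr
            exact hδK ν
        _ = K ν * (C ^ 2 * (C * K ν / S ν)) + 3 * C * (S ν * (C * K ν / S ν) ^ 2) := by
          rw [hS]; ring
        _ = _ := by field_simp; ring
    have := hd'.div hsq one_ne_zero
    rw [zero_div] at this
    refine this.congr fun ν => ?_
    rw [Pi.div_apply, div_div_div_cancel_right₀ (Real.sqrt_pos.2 (hSp ν)).ne']
  have hA := tendsto_sqrt_mul_coeff hC hc (p := fun ν => truncPoisson C (l ν)) (N := N) (n := n)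
    (fun ν => truncPoisson_nonneg C (hl ν)) (fun ν => sum_truncPoisson C (hl ν))
    (fun ν => meanW_eq C (l ν)) (fun ν => varW_eq C (hl ν)) hcl
    (hStop.congr hS) (by simp [hmean])
  have hB := tendsto_sqrt_mul_coeff hC hc (p := fun ν => truncPoisson C (l ν * Real.exp (δ ν)))
    (N := fun ν => N ν - K ν) (n := fun ν => n ν - M ν)
    (fun ν => truncPoisson_nonneg C (hl' ν)) (fun ν => sum_truncPoisson C (hl' ν))
    (fun ν => meanW_eq C _) (fun ν => varW_eq C (hl' ν)) hcl' hS1top hd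
  have hne : (2 * Real.pi)⁻¹ * √(2 * Real.pi) ≠ 0 := by positivity
  have := (hB.div hA hne).div hsq one_ne_zero
  rw [div_self hne, div_one] at this
  refine this.congr' ?_
  filter_upwards [hS1top.eventually_gt_atTop 0] with ν h1
  have h2 := (Real.sqrt_pos.2 h1).ne'
  have h3 := (Real.sqrt_pos.2 (hSp ν)).ne'
  simp only [Pi.div_apply, ← hS]
  field_simp

/-- **Lemma (joint factorial moments in the allocation model, asymptotics).**
With `n = n(ν)`, `N = N(ν)`, `N → ∞`, `c₁ N < n ≤ CN − 1`, `CN − n → ∞`, `λ₀` the unique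
positive solution of `λ g'(λ)/g(λ) = n/N`, `μ_i = N λ₀^{m_i}/(g(λ₀) m_i!)`, and nonnegative
integers `k_i` with `∑ k_i = o((N/λ₀)^{2/3})`, the expectation (in the uniform allocation
model) of `∏_i [X_{m_i}]_{k_i}` is asymptotic to
`(∏ μ_i^{k_i}) exp(−(∑ k_i(m_i − n/N))²/(2N Var W(λ₀)) − (∑ k_i)²/(2N))`. -/
theorem statement3 (C : ℕ) (hC : 1 ≤ C) (c₁ : ℝ) (hc₁ : 0 < c₁)
    (r : ℕ) (hr : 1 ≤ r) (m : Fin r → ℕ) (hm : ∀ i, m i ≤ C)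
    (hminj : Function.Injective m)
    (n N : ℕ → ℕ) (hNpos : ∀ ν, 0 < N ν)
    (hN : Tendsto N atTop atTop)
    (hlow : ∀ ν, c₁ * N ν < n ν) (hhigh : ∀ ν, n ν ≤ C * N ν - 1)
    (hgap : Tendsto (fun ν => C * N ν - n ν) atTop atTop)
    (lam0 : ℕ → ℝ) (hlam0pos : ∀ ν, 0 < lam0 ν)
    (hlam0 : ∀ ν, lam0 ν * deriv (gfun C) (lam0 ν) / gfun C (lam0 ν) = (n ν : ℝ) / N ν)
    (k : Fin r → ℕ → ℕ)
    (hk : Tendsto (fun ν => (∑ i, (k i ν : ℝ)) / (((N ν : ℝ) / lam0 ν) ^ ((2:ℝ)/3)))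
      atTop (nhds 0)) :
    Tendsto (fun ν =>
      -- E[∏ᵢ [X_{mᵢ}]_{kᵢ}] in the uniform allocation model
      ((∑ f ∈ validPlacements (n ν) (N ν) C,
          ∏ i, ((binCount f (m i)).descFactorial (k i ν) : ℝ)) /
        ((validPlacements (n ν) (N ν) C).card : ℝ))
      / -- the claimed asymptotic expression
      ((∏ i, ((N ν : ℝ) * lam0 ν ^ (m i) / (gfun C (lam0 ν) * (m i).factorial)) ^ (k i ν)) *
        Real.exp
          (-(∑ i, (k i ν : ℝ) * ((m i : ℝ) - (n ν : ℝ) / N ν)) ^ 2 /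
              (2 * N ν * varW C (lam0 ν))
            - (∑ i, (k i ν : ℝ)) ^ 2 / (2 * N ν))))
      atTop (nhds 1) := by
  have hN0 : ∀ ν, (0 : ℝ) < N ν := fun ν => by exact_mod_cast hNpos ν
  have hmean : ∀ ν, meanW C (lam0 ν) = (n ν : ℝ) / N ν := fun ν => by
    rw [meanW_eq_deriv, hlam0]
  have hmean' : ∀ ν, (N ν : ℝ) * meanW C (lam0 ν) = n ν := fun ν => by
    rw [hmean, mul_div_cancel₀ _ (hN0 ν).ne']
  have hlamc : ∀ ν, c₁ ≤ lam0 ν := fun ν => by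
    refine le_trans ?_ (meanW_le_self C (hlam0pos ν))
    rw [hmean, le_div_iff₀ (hN0 ν)]
    exact (hlow ν).le
  obtain ⟨c, hc, hbd⟩ := truncPoisson_bounds hC (half_pos hc₁)
  have hbd0 := fun ν => hbd (lam0 ν) (by linarith [hlamc ν])
  have hv : ∀ ν, 0 < varW C (lam0 ν) := fun ν =>
    lt_of_lt_of_le (div_pos hc (hlam0pos ν)) (hbd0 ν).2.1
  have hvC : ∀ ν, varW C (lam0 ν) ≤ C ^ 2 := fun ν =>
    var_le (truncPoisson_nonneg C (hlam0pos ν)) (sum_truncPoisson C (hlam0pos ν)) (meanW_eq C _)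
      (varW_eq C (hlam0pos ν))
  obtain ⟨S, hS⟩ : ∃ S : ℕ → ℝ, ∀ ν, S ν = N ν * varW C (lam0 ν) := ⟨_, fun _ => rfl⟩
  have hSp : ∀ ν, 0 < S ν := fun ν => by rw [hS]; exact mul_pos (hN0 ν) (hv ν)
  have hNS : ∀ ν, c * (N ν / lam0 ν) ≤ S ν := fun ν => by
    have := mul_le_mul_of_nonneg_left (hbd0 ν).2.1 (hN0 ν).le
    rw [hS]
    calc c * (N ν / lam0 ν) = N ν * (c / lam0 ν) := by ring
      _ ≤ _ := this
  have hSN : ∀ ν, S ν ≤ C ^ 2 * N ν := fun ν => by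
    rw [hS, mul_comm]
    exact mul_le_mul_of_nonneg_right (hvC ν) (hN0 ν).le
  have hStop : Tendsto S atTop atTop := by
    have h1 : Tendsto (fun ν => c ^ 2 * ((C * N ν - n ν : ℕ) : ℝ)) atTop atTop :=
      (tendsto_natCast_atTop_atTop.comp hgap).const_mul_atTop (by positivity)
    refine tendsto_atTop_mono (fun ν => ?_) h1
    have hle : n ν ≤ C * N ν := (hhigh ν).trans (Nat.sub_le _ _)
    rw [Nat.cast_sub hle]
    push_cast
    have h2 := mul_le_mul_of_nonneg_left (hbd0 ν).2.2 (hN0 ν).le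
    calc c ^ 2 * ((C : ℝ) * N ν - n ν)
        = c * (N ν * (c * (C - meanW C (lam0 ν)))) := by rw [← hmean' ν]; ring
      _ ≤ c * (N ν * (1 / lam0 ν)) := by gcongr
      _ = c * (N ν / lam0 ν) := by ring
      _ ≤ S ν := hNS ν
  obtain ⟨K, hK⟩ : ∃ K : ℕ → ℕ, ∀ ν, K ν = ∑ i, k i ν := ⟨_, fun _ => rfl⟩
  obtain ⟨M, hM⟩ : ∃ M : ℕ → ℕ, ∀ ν, M ν = ∑ i, k i ν * m i := ⟨_, fun _ => rfl⟩
  have hKr : ∀ ν, ∑ i, (k i ν : ℝ) = K ν := fun ν => by rw [hK]; push_cast; rfl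
  have hMK : ∀ ν, M ν ≤ C * K ν := fun ν => by
    rw [hM, hK, Finset.mul_sum]
    exact Finset.sum_le_sum fun i _ => by rw [mul_comm]; exact Nat.mul_le_mul_right _ (hm i)
  have hKS0 : Tendsto (fun ν => (K ν : ℝ) / S ν ^ ((2 : ℝ) / 3)) atTop (nhds 0) := by
    have h1 := hk.const_mul ((c ^ ((2 : ℝ) / 3))⁻¹)
    rw [mul_zero] at h1
    refine squeeze_zero (fun ν => div_nonneg (Nat.cast_nonneg _) (Real.rpow_nonneg (hSp ν).le _))
      (fun ν => ?_) h1
    have hNl : 0 < (N ν : ℝ) / lam0 ν := div_pos (hN0 ν) (hlam0pos ν)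
    rw [hKr, inv_mul_eq_div, div_div, mul_comm _ (c ^ _), ← Real.mul_rpow hc.le hNl.le]
    have := hNS ν
    gcongr
  obtain ⟨hKS, hK3, hKS'⟩ := tendsto_rates hSp hStop hKS0
  have hC2 : (0 : ℝ) < (C : ℝ) ^ 2 := by
    have : (0 : ℝ) < C := by exact_mod_cast hC
    positivity
  have hKN : Tendsto (fun ν => (K ν : ℝ) / N ν) atTop (nhds 0) := by
    have h1 := hKS.const_mul ((C : ℝ) ^ 2)
    rw [mul_zero] at h1
    refine squeeze_zero (fun ν => by positivity) (fun ν => ?_) h1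
    have h2 := hSp ν
    rw [← mul_div_assoc, div_le_div_iff₀ (hN0 ν) h2]
    calc (K ν : ℝ) * S ν ≤ K ν * (C ^ 2 * N ν) := by gcongr; exact hSN ν
      _ = _ := by ring
  have hK3N : Tendsto (fun ν => (K ν : ℝ) ^ 3 / (N ν : ℝ) ^ 2) atTop (nhds 0) := by
    have h1 := hK3.const_mul (((C : ℝ) ^ 2) ^ 2)
    rw [mul_zero] at h1
    refine squeeze_zero (fun ν => by positivity) (fun ν => ?_) h1
    have h2 := hSp ν
    have h3 := hN0 ν
    rw [← mul_div_assoc, div_le_div_iff₀ (by positivity) (by positivity)]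
    calc (K ν : ℝ) ^ 3 * S ν ^ 2 ≤ K ν ^ 3 * (C ^ 2 * N ν) ^ 2 := by gcongr; exact hSN ν
      _ = _ := by ring
  have hKle : ∀ᶠ ν in atTop, K ν ≤ N ν := by
    filter_upwards [hKN.eventually_lt_const one_pos] with ν h1
    rw [div_lt_one (hN0 ν)] at h1
    exact_mod_cast h1.le
  have hMle : ∀ᶠ ν in atTop, M ν ≤ n ν := by
    have h1 := hKN.const_mul (C : ℝ)
    rw [mul_zero] at h1
    filter_upwards [h1.eventually_lt_const hc₁] with ν h2
    rw [← mul_div_assoc, div_lt_iff₀ (hN0 ν)] at h2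
    have h3 : (M ν : ℝ) ≤ C * K ν := by exact_mod_cast hMK ν
    have h4 := hlow ν
    exact_mod_cast (by linarith : (M ν : ℝ) ≤ n ν)
  obtain ⟨x, hx⟩ : ∃ x : ℕ → ℝ, ∀ ν, x ν = M ν - K ν * meanW C (lam0 ν) := ⟨_, fun _ => rfl⟩
  have hxsum : ∀ ν, ∑ i, (k i ν : ℝ) * ((m i : ℝ) - (n ν : ℝ) / N ν) = x ν := fun ν => by
    rw [hx, hM, hmean, ← hKr]
    push_cast
    rw [Finset.sum_mul, ← Finset.sum_sub_distrib]
    exact Finset.sum_congr rfl fun i _ => by ring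
  have hxK : ∀ ν, |x ν| ≤ C * K ν := fun ν => by
    have h1 : (M ν : ℝ) ≤ C * K ν := by exact_mod_cast hMK ν
    have h2 : meanW C (lam0 ν) ≤ C := by
      rw [hmean, div_le_iff₀ (hN0 ν)]
      exact_mod_cast (hhigh ν).trans (Nat.sub_le _ _)
    have h3 : 0 ≤ meanW C (lam0 ν) := by rw [hmean]; positivity
    have h4 : (0 : ℝ) ≤ M ν := Nat.cast_nonneg _
    have h5 : (K ν : ℝ) * meanW C (lam0 ν) ≤ K ν * C := by gcongr
    have h6 : 0 ≤ (K ν : ℝ) * meanW C (lam0 ν) := by positivity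
    rw [hx, abs_le]
    constructor <;> linarith
  obtain ⟨δ, hδ⟩ : ∃ δ : ℕ → ℝ, ∀ ν, δ ν = -x ν / S ν := ⟨_, fun _ => rfl⟩
  have hδ0 : Tendsto δ atTop (nhds 0) := by
    have h1 := hKS.const_mul (C : ℝ)
    rw [mul_zero] at h1
    refine squeeze_zero_norm (fun ν => ?_) h1
    have h2 := hSp ν
    rw [hδ, norm_div, norm_neg, Real.norm_eq_abs, Real.norm_of_nonneg h2.le, ← mul_div_assoc]
    gcongr
    exact hxK ν
  have hδ1 : ∀ᶠ ν in atTop, C * |δ ν| ≤ 1 := by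
    have h1 := hδ0.abs.const_mul (C : ℝ)
    rw [abs_zero, mul_zero] at h1
    exact (h1.eventually_lt_const one_pos).mono fun _ h => h.le
  have hexp : ∀ᶠ ν in atTop, c₁ / 2 ≤ lam0 ν * Real.exp (δ ν) := by
    have h1 := (Real.continuous_exp.tendsto 0).comp hδ0
    rw [Real.exp_zero] at h1
    filter_upwards [h1.eventually_const_lt (by norm_num : (1 : ℝ) / 2 < 1)] with ν h2
    calc c₁ / 2 = c₁ * (1 / 2) := by ring
      _ ≤ lam0 ν * Real.exp (δ ν) := mul_le_mul (hlamc ν) h2.le (by norm_num) (hlam0pos ν).le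
  obtain ⟨R, hR⟩ : ∃ R : ℕ → ℝ, ∀ ν, R ν = ∑ j ∈ range (C + 1),
    truncPoisson C (lam0 ν) j * Real.exp (δ ν * ((j : ℝ) - meanW C (lam0 ν))) :=
    ⟨_, fun _ => rfl⟩
  have htilt := hδ1.mono fun ν h => tilted_truncPoisson C (hlam0pos ν) h (hR ν)
  have hlim := ((tendsto_descFactorial_div_pow hNpos hKN hK3N).mul
    (tendsto_coeff_ratio hC hc hlam0pos hv hNpos (Eventually.of_forall fun ν => (hbd0 ν).1)
      (hexp.mono fun ν h => (hbd _ h).1) hmean' hKle hMle hS hStop hx hxK hδ hKS hKS' hKN)).mul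
    (tendsto_pow_mul_exp hNpos hv hvC hS hδ hxK hKle (htilt.mono fun _ h => h.1)
      (htilt.mono fun _ h => h.2.1) hK3)
  rw [mul_one, mul_one] at hlim
  refine hlim.congr' ?_
  filter_upwards [hKle, hMle, htilt] with ν hK1 hM1 ht
  have hg := gfun_pos C (hlam0pos ν)
  have hl := hlam0pos ν
  have hQ : 0 < ∏ i, (((m i).factorial : ℝ)⁻¹) ^ k i ν :=
    Finset.prod_pos fun i _ => by positivity
  have hx1 : ((n ν - M ν : ℕ) : ℝ) - ((N ν - K ν : ℕ) : ℝ) * meanW C (lam0 ν) = -x ν := by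
    rw [Nat.cast_sub hK1, Nat.cast_sub hM1, hx]
    linear_combination (-1 : ℝ) * hmean' ν
  have hδx : δ ν * x ν = -x ν ^ 2 / S ν := by rw [hδ]; ring
  have hprod : ∏ i, ((N ν : ℝ) * lam0 ν ^ m i / (gfun C (lam0 ν) * (m i).factorial)) ^ k i ν =
      (N ν : ℝ) ^ K ν * lam0 ν ^ M ν / gfun C (lam0 ν) ^ K ν *
        ∏ i, (((m i).factorial : ℝ)⁻¹) ^ k i ν := by
    rw [hK, hM, ← Finset.prod_pow_eq_pow_sum, ← Finset.prod_pow_eq_pow_sum,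
      ← Finset.prod_pow_eq_pow_sum, ← Finset.prod_mul_distrib, ← Finset.prod_div_distrib,
      ← Finset.prod_mul_distrib]
    refine Finset.prod_congr rfl fun i _ => ?_
    rw [mul_comm (k i ν) (m i), pow_mul, ← mul_pow, ← div_pow, ← mul_pow]
    congr 1
    field_simp
  rw [factorialMoment_eq (n ν) (N ν) C r m hm hminj (fun i => k i ν) (by rw [← hM]; exact hM1),
    hprod, hKr, hxsum, mul_assoc 2 (N ν : ℝ) (varW C (lam0 ν)), ← hS, ← hK, ← hM]
  have hid := tilted_ratio_identity (N ν - K ν) (K ν) (n ν - M ν) (M ν) hg hl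
    (lt_of_lt_of_le one_pos ht.1) ((N ν).descFactorial (K ν))
    ((truncExp C ^ N ν).coeff (n ν)) ((truncExp C ^ (N ν - K ν)).coeff (n ν - M ν))
    hQ (hN0 ν) hx1 hδx
  rw [hid, Nat.sub_add_cancel hK1, Nat.sub_add_cancel hM1,
    coeff_pow_truncPoisson C _ _ (mul_pos hl (Real.exp_pos _)), coeff_pow_truncPoisson C _ _ hl,
    gfun_mul_exp C hl, ← hR]
end

section
/- Fix integers C ≥ 1, N ≥ 1 and 0 ≤ n ≤ CN − 1 with M_n(N,C) > 0, an integer r ≥ 1, distinct integers m_1,…,m_r ∈ {0,1,…,C}, and nonnegative integers k_1,…,k_r with s := Σ_{i=1}^r k_i ≤ N and t := Σ_{i=1}^r k_i m_i ≤ n. Then, in the uniform allocation model, E[ ∏_{i=1}^r [X_{m_i}]_{k_i} ] = [N]_s · ( n! / ( (n−t)! ∏_{i=1}^r (m_i!)^{k_i} ) ) · M_{n−t}(N−s, C) / M_n(N,C). -/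
open Finset
open scoped BigOperators

/-- `M_n(N,C)`, the number of such placements. -/
def Mcount (n N C : ℕ) : ℕ := (validPlacements n N C).card

namespace Placement

variable {A B A' B' : Type*}

section

variable [Fintype A] [DecidableEq B]

/-- The number of balls that `f` places in the bin `b`. -/
def occupancy (f : A → B) (b : B) : ℕ := #{a | f a = b}

/-- The number of bins that contain exactly `m` balls. -/
def count [Fintype B] (f : A → B) (m : ℕ) : ℕ := #{b | occupancy f b = m}

variable (A B) in
/-- The placements of balls `A` into bins `B` with at most `C` balls in each bin. -/
def placements [DecidableEq A] [Fintype B] (C : ℕ) : Finset (A → B) := {f | ∀ b, occupancy f b ≤ C}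

theorem mem_placements [DecidableEq A] [Fintype B] {C : ℕ} {f : A → B} :
    f ∈ placements A B C ↔ ∀ b, occupancy f b ≤ C := by
  simp [placements]

theorem occupancy_arrowCongr [Fintype A'] [DecidableEq B'] (e : A ≃ A') (e' : B ≃ B')
    (f : A → B) (b : B) :
    occupancy (e.arrowCongr e' f) (e' b) = occupancy f b := by
  refine (Finset.card_equiv e fun a => ?_).symm
  simp

theorem count_arrowCongr [Fintype A'] [Fintype B] [Fintype B'] [DecidableEq B']
    (e : A ≃ A') (e' : B ≃ B') (f : A → B) :
    count (e.arrowCongr e' f) = count f := by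
  funext m
  refine (Finset.card_equiv e' fun b => ?_).symm
  simp only [mem_filter, mem_univ, true_and, occupancy_arrowCongr]

theorem sum_placements_congr [DecidableEq A] [Fintype A'] [DecidableEq A'] [Fintype B]
    [Fintype B'] [DecidableEq B'] (e : A ≃ A') (e' : B ≃ B') (C : ℕ) (G : (ℕ → ℕ) → ℕ) :
    ∑ f ∈ placements A B C, G (count f) = ∑ f ∈ placements A' B' C, G (count f) := by
  refine Finset.sum_equiv (e.arrowCongr e') (fun f => ?_) fun f _ => by rw [count_arrowCongr]
  simp only [mem_placements]
  rw [← e'.forall_congr_right]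
  simp only [occupancy_arrowCongr]

end

/-- Extends a placement of the balls outside `S` into the bins other than `b` by putting the balls
of `S` into `b`. -/
def extend [DecidableEq A] (S : Finset A) (b : B) (g : {a // a ∉ S} → {b' // b' ≠ b}) (a : A) : B :=
  if h : a ∈ S then b else g ⟨a, h⟩

section extend

variable [DecidableEq A] (S : Finset A) (b : B) (g : {a // a ∉ S} → {b' // b' ≠ b})

theorem extend_eq_self_iff (a : A) : extend S b g a = b ↔ a ∈ S := by
  unfold extend
  split_ifs with h
  · simp [h]
  · simpa [h] using (g ⟨a, h⟩).2

theorem extend_injective : Function.Injective (extend S b) := by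
  intro g g' h
  funext a
  have := congrFun h a.1
  simp only [extend, a.2, dite_false] at this
  exact Subtype.ext this

variable [Fintype A] [DecidableEq B]

theorem filter_extend_eq_self : ({a | extend S b g a = b} : Finset A) = S := by
  ext a
  simp [extend_eq_self_iff]

theorem occupancy_extend_self : occupancy (extend S b g) b = #S := by
  rw [occupancy, filter_extend_eq_self]

theorem occupancy_extend (b' : {b' // b' ≠ b}) :
    occupancy (extend S b g) b' = occupancy g b' := by
  refine (Finset.card_bij (fun a _ => a.1) ?_ (fun _ _ _ _ h => Subtype.ext h) ?_).symm
  · rintro ⟨a, ha⟩ h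
    simp only [mem_filter, mem_univ, true_and] at h ⊢
    simp [extend, ha, h]
  · intro a h
    simp only [mem_filter, mem_univ, true_and] at h
    have ha : a ∉ S := by
      rw [← extend_eq_self_iff S b g, h]
      exact b'.2
    refine ⟨⟨a, ha⟩, ?_, rfl⟩
    simp only [mem_filter, mem_univ, true_and]
    exact Subtype.ext (by simpa [extend, ha] using h)

theorem count_extend [Fintype B] : count (extend S b g) = count g + Pi.single #S 1 := by
  funext m
  have h := Fintype.sum_eq_add_sum_subtype_ne
    (fun b' => if occupancy (extend S b g) b' = m then 1 else 0) b
  simp only [occupancy_extend, occupancy_extend_self] at h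
  simp only [count, card_filter, Pi.add_apply, Pi.single_apply, h, eq_comm (a := m)]
  exact add_comm _ _

theorem extend_mem_placements_iff [Fintype B] {C : ℕ} (hS : #S ≤ C) :
    extend S b g ∈ placements A B C ↔ g ∈ placements {a // a ∉ S} {b' // b' ≠ b} C := by
  simp only [mem_placements]
  refine ⟨fun h b' => occupancy_extend S b g b' ▸ h b', fun h b' => ?_⟩
  by_cases hb : b' = b
  · rw [hb, occupancy_extend_self]
    exact hS
  · exact occupancy_extend S b g ⟨b', hb⟩ ▸ h ⟨b', hb⟩

theorem exists_extend_eq (f : A → B) (hf : ({a | f a = b} : Finset A) = S) :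
    ∃ g, extend S b g = f := by
  have key (a : A) : a ∈ S ↔ f a = b := by simp [← hf]
  refine ⟨fun a => ⟨f a, fun h => a.2 ((key a).2 h)⟩, funext fun a => ?_⟩
  unfold extend
  split_ifs with h
  · exact ((key a).1 h).symm
  · rfl

theorem sum_placements_fiber [Fintype B] {C : ℕ} (hS : #S ≤ C) (G : (ℕ → ℕ) → ℕ) :
    ∑ f ∈ placements A B C with ({a | f a = b} : Finset A) = S, G (count f - Pi.single #S 1) =
      ∑ g ∈ placements {a // a ∉ S} {b' // b' ≠ b} C, G (count g) := by
  symm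
  refine Finset.sum_nbij (extend S b) (fun g hg => ?_) (extend_injective S b).injOn
    (fun f hf => ?_) fun g _ => ?_
  · simp [filter_extend_eq_self, (extend_mem_placements_iff S b g hS).2 hg]
  · obtain ⟨hf, hS'⟩ := by simpa using hf
    obtain ⟨g, rfl⟩ := exists_extend_eq S b f hS'
    exact ⟨g, (extend_mem_placements_iff S b g hS).1 hf, rfl⟩
  · rw [count_extend, add_tsub_cancel_right]

end extend

theorem sum_count_mul [Fintype A] [DecidableEq A] [Fintype B] [DecidableEq B] {C m n N : ℕ}
    (hm : m ≤ C) (hA : Fintype.card A = n + m) (hB : Fintype.card B = N + 1) (G : (ℕ → ℕ) → ℕ) :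
    ∑ f ∈ placements A B C, count f m * G (count f - Pi.single m 1) =
      (N + 1) * (n + m).choose m * ∑ g ∈ placements (Fin n) (Fin N) C, G (count g) := by
  have hfiber (b : B) (S : Finset A) (hS : S ∈ powersetCard m univ) :
      ∑ f ∈ placements A B C with ({a | f a = b} : Finset A) = S, G (count f - Pi.single m 1) =
        ∑ g ∈ placements (Fin n) (Fin N) C, G (count g) := by
    obtain rfl := (mem_powersetCard.1 hS).2
    rw [sum_placements_fiber S b hm]
    refine sum_placements_congr (Fintype.equivFinOfCardEq ?_) (Fintype.equivFinOfCardEq ?_) C G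
    · rw [Fintype.card_subtype_compl, hA]
      simp
    · rw [Fintype.card_subtype_compl, hB]
      simp
  calc
    _ = ∑ f ∈ placements A B C, ∑ b : B, if occupancy f b = m
          then G (count f - Pi.single m 1) else 0 := by
      simp [count, ← sum_filter]
    _ = ∑ b : B, ∑ f ∈ placements A B C with occupancy f b = m, G (count f - Pi.single m 1) := by
      rw [sum_comm]
      simp only [sum_filter]
    _ = ∑ b : B, ∑ S ∈ powersetCard m univ,
          ∑ f ∈ placements A B C with ({a | f a = b} : Finset A) = S,
            G (count f - Pi.single m 1) := by
      refine sum_congr rfl fun b _ => ?_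
      rw [← sum_fiberwise_of_maps_to (s := {f ∈ placements A B C | occupancy f b = m})
        (t := powersetCard m univ) (g := fun f => ({a | f a = b} : Finset A))]
      · refine sum_congr rfl fun S hS => ?_
        rw [filter_filter]
        refine sum_congr (filter_congr fun f _ => ?_) fun _ _ => rfl
        refine ⟨And.right, fun h => ⟨?_, h⟩⟩
        rw [occupancy, h, (mem_powersetCard.1 hS).2]
      · intro f hf
        exact mem_powersetCard.2 ⟨subset_univ _, (mem_filter.1 hf).2⟩
    _ = _ := by
      rw [sum_congr rfl fun b _ => sum_congr rfl (hfiber b)]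
      simp [hA, hB, mul_assoc]

theorem sum_prod_descFactorial_mul {ι : Type*} [Fintype ι] [DecidableEq ι] {C : ℕ} {m : ι → ℕ}
    (hm : ∀ i, m i ≤ C) (hminj : Function.Injective m) (k : ι → ℕ) (n N : ℕ) :
    (∑ f ∈ placements (Fin (n + ∑ i, k i * m i)) (Fin (N + ∑ i, k i)) C,
        ∏ i, (count f (m i)).descFactorial (k i)) * (n.factorial * ∏ i, (m i).factorial ^ k i) =
      (N + ∑ i, k i).descFactorial (∑ i, k i) * (n + ∑ i, k i * m i).factorial *
        #(placements (Fin n) (Fin N) C) := by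
  induction hs : ∑ i, k i generalizing k with
  | zero =>
    obtain rfl : k = 0 := funext fun i => by simpa using (sum_eq_zero_iff.1 hs) i
    have ht : ∑ i, (0 : ι → ℕ) i * m i = 0 := by simp
    rw [ht]
    simp [mul_comm]
  | succ s ih =>
    obtain ⟨i₀, hi₀⟩ : ∃ i, k i ≠ 0 := by
      by_contra! h
      simp [h] at hs
    obtain ⟨k, rfl⟩ : ∃ k', k = k' + Pi.single i₀ 1 := by
      refine ⟨k - Pi.single i₀ 1, (tsub_add_cancel_of_le fun i => ?_).symm⟩
      by_cases h : i = i₀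
      · subst h
        simpa using Nat.one_le_iff_ne_zero.2 hi₀
      · simp [h]
    have hk : ∑ i, k i = s := by simpa [sum_add_distrib] using hs
    have ht : ∑ i, (k + Pi.single i₀ 1 : ι → ℕ) i * m i = ∑ i, k i * m i + m i₀ := by
      simp [add_mul, sum_add_distrib, Pi.single_apply]
    have hfac : ∏ i, (m i).factorial ^ (k + Pi.single i₀ 1 : ι → ℕ) i =
        (∏ i, (m i).factorial ^ k i) * (m i₀).factorial := by
      simp only [Pi.add_apply, pow_add, prod_mul_distrib]
      simp [Pi.single_apply, pow_ite]
    have hdesc (X : ℕ → ℕ) : ∏ i, (X (m i)).descFactorial ((k + Pi.single i₀ 1 : ι → ℕ) i) =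
        X (m i₀) * ∏ i, ((X - Pi.single (m i₀) 1 : ℕ → ℕ) (m i)).descFactorial (k i) := by
      rw [← mul_prod_erase univ _ (mem_univ i₀),
        ← mul_prod_erase univ (fun i => ((X - _) (m i)).descFactorial _) (mem_univ i₀), ← mul_assoc]
      congr 1
      · simp only [Pi.add_apply, Pi.sub_apply, Pi.single_eq_same]
        cases X (m i₀) <;> simp [Nat.succ_descFactorial_succ, -Nat.descFactorial_succ]
      · refine prod_congr rfl fun i hi => ?_
        have hne := ne_of_mem_erase hi
        simp [hne, hminj.ne hne]
    have ih := ih k hk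
    rw [ht, hfac]
    simp only [hdesc]
    rw [sum_count_mul (n := n + ∑ i, k i * m i) (N := N + s) (hm i₀)
      (by simp [add_assoc]) (by simp [add_assoc])
      (fun X => ∏ i, (X (m i)).descFactorial (k i)), ← add_assoc, ← add_assoc,
      Nat.succ_descFactorial_succ,
      ← Nat.add_choose_mul_factorial_mul_factorial (n + ∑ i, k i * m i) (m i₀)]
    linear_combination (N + s + 1) * (n + ∑ i, k i * m i + m i₀).choose (m i₀) *
      (m i₀).factorial * ih

theorem validPlacements_eq (n N C : ℕ) :
    validPlacements n N C = placements (Fin n) (Fin N) C := by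
  ext f
  simp [validPlacements, mem_placements, occupancy]

theorem binCount_eq {n N : ℕ} (f : Fin n → Fin N) (m : ℕ) : binCount f m = count f m := by
  simp only [binCount, count, occupancy]
  congr

end Placement

/-- **Lemma (exact joint factorial moment identity).** For `C ≥ 1`, `N ≥ 1`,
`0 ≤ n ≤ CN − 1` with `M_n(N,C) > 0`, distinct `m₁,…,m_r ∈ {0,…,C}`, and nonnegative
integers `k₁,…,k_r` with `s = ∑ kᵢ ≤ N` and `t = ∑ kᵢ mᵢ ≤ n`, the uniform allocation
model satisfies
`E[∏ᵢ [X_{mᵢ}]_{kᵢ}] = [N]_s · (n!/((n−t)! ∏ᵢ (mᵢ!)^{kᵢ})) · M_{n−t}(N−s,C)/M_n(N,C)`. -/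
theorem statement6 (C N n : ℕ) (hC : 1 ≤ C) (hN : 1 ≤ N) (hn : n ≤ C * N - 1)
    (hM : 0 < Mcount n N C)
    (r : ℕ) (hr : 1 ≤ r) (m : Fin r → ℕ) (hm : ∀ i, m i ≤ C)
    (hminj : Function.Injective m)
    (k : Fin r → ℕ) (hs : ∑ i, k i ≤ N) (ht : ∑ i, k i * m i ≤ n) :
    (∑ f ∈ validPlacements n N C,
        ∏ i, ((binCount f (m i)).descFactorial (k i) : ℝ)) /
      (Mcount n N C : ℝ)
    = (N.descFactorial (∑ i, k i) : ℝ) *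
        ((Nat.factorial n : ℝ) /
          ((Nat.factorial (n - ∑ i, k i * m i) : ℝ) *
            ∏ i, ((Nat.factorial (m i) : ℝ)) ^ (k i))) *
        ((Mcount (n - ∑ i, k i * m i) (N - ∑ i, k i) C : ℝ) / (Mcount n N C : ℝ)) := by
  obtain ⟨N, rfl⟩ := Nat.exists_eq_add_of_le' hs
  obtain ⟨n, rfl⟩ := Nat.exists_eq_add_of_le' ht
  have key := Placement.sum_prod_descFactorial_mul hm hminj k n N
  simp only [← Placement.validPlacements_eq, ← Placement.binCount_eq] at key
  rw [← Mcount] at key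
  rw [Nat.add_sub_cancel, Nat.add_sub_cancel]
  have hpos : (0 : ℝ) < n.factorial * ∏ i, ((m i).factorial : ℝ) ^ k i := by positivity
  have key' := congrArg (Nat.cast : ℕ → ℝ) key
  push_cast at key'
  rw [mul_div_assoc', div_left_inj' (by exact_mod_cast hM.ne'), mul_div_assoc', div_mul_eq_mul_div,
    eq_div_iff hpos.ne', key']
end
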